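/- arXiv:math/9911214 — 2 statements merged into one kernel-verified Lean document; each statement's English description precedes it below -/
import Mathlib

section
/- For each nonempty J ⊆ ∘I, the pair (W_J, S_J) is a Coxeter system, and the triple (V_J, Δ_J, Π_J), where V_J is the ℝ-span of Π_J, is a root system of (W_J, S_J): Δ_J is W_J-invariant and symmetric; each element of Δ_J is a linear combination of Π_J with all coefficients ≥ 0 or all ≤ 0 but not both; for each s ∈ S_J, s(α_s) = −α_s and s(Δ_{J+}∖{α_s}) = Δ_{J+}∖{α_s}; and w(α_{s′}) = α_s implies ws′w⁻¹ = s. Moreover, every α ∈ Δ_{J+}∖Π_J can be written as β+γ with β, γ ∈ Δ_{J+}, and the height function ht : Δ₊ → ℕ satisfies ht(β+γ) = ht(β)+ht(γ) whenever β, γ, β+γ ∈ Δ_{J+}. -/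
open scoped Pointwise

section

variable {ι V : Type*} [Fintype ι] [Nonempty ι] [AddCommGroup V] [Module ℝ V]

/-- The length of `w` with respect to a generating set `S` of a group. -/
noncomputable def lenG {G : Type*} [Group G] (S : Set G) (w : G) : ℕ :=
  sInf {n | ∃ l : List G, (∀ x ∈ l, x ∈ S) ∧ l.length = n ∧ l.prod = w}

/-- `v` is a nonnegative linear combination of the simple roots `α` of `∘Δ`. -/
def PosoComb (α : ι → V) (v : V) : Prop :=
  ∃ c : ι → ℝ, (∀ i, 0 ≤ c i) ∧ v = ∑ i, c i • α i

/-- The parabolic subgroup `∘W_J = ⟨s_j | j ∈ J⟩` of the finite Weyl group, realized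
inside the group of linear automorphisms of `𝔥* = V`. -/
def WoJ (α : ι → V) (s : V → V ≃ₗ[ℝ] V) (J : Set ι) : Subgroup (V ≃ₗ[ℝ] V) :=
  Subgroup.closure ((fun j => s (α j)) '' J)

/-- `∘Δ_J = ∘W_J(∘Π_J)` (so `∘Δ_∅ = ∅`). -/
def DeloJ (α : ι → V) (s : V → V ≃ₗ[ℝ] V) (J : Set ι) : Set V :=
  {v | ∃ g ∈ WoJ α s J, ∃ j ∈ J, v = g (α j)}

/-- `∘Δ`, the root system of the underlying finite-dimensional simple Lie algebra. -/
def Delo (α : ι → V) (s : V → V ≃ₗ[ℝ] V) : Set V := DeloJ α s Set.univ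

/-- `∘Δ^K_{J+} = (∘Δ_J ∖ ∘Δ_K) ∩ ∘Δ₊`. -/
def DeloKJpos (α : ι → V) (s : V → V ≃ₗ[ℝ] V) (J K : Set ι) : Set V :=
  (DeloJ α s J \ DeloJ α s K) ∩ {v | PosoComb α v}

/-- `∘Δ^K_{J−} = (∘Δ_J ∖ ∘Δ_K) ∩ ∘Δ₋`. -/
def DeloKJneg (α : ι → V) (s : V → V ≃ₗ[ℝ] V) (J K : Set ι) : Set V :=
  (DeloJ α s J \ DeloJ α s K) ∩ {v | PosoComb α (-v)}

/-- The set `∘W^K_J` of minimal-length representatives of the right cosets `∘W_J/∘W_K`. -/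
def MinReps (α : ι → V) (s : V → V ≃ₗ[ℝ] V) (J K : Set ι) : Set (V ≃ₗ[ℝ] V) :=
  {w | w ∈ WoJ α s J ∧ ∀ v ∈ WoJ α s K,
    lenG (Set.range fun i => s (α i)) w ≤ lenG (Set.range fun i => s (α i)) (w * v)}

/-- The affine simple roots `Π = {α₀ = δ − θ} ∪ ∘Π`, indexed by `Option ι`. -/
def alHat (α : ι → V) (δ θ : V) : Option ι → V := fun o => o.elim (δ - θ) α

/-- `v` is a nonnegative linear combination of the affine simple roots. -/
def PosComb (α : ι → V) (δ θ : V) (v : V) : Prop :=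
  ∃ c : Option ι → ℝ, (∀ o, 0 ≤ c o) ∧ v = ∑ o, c o • alHat α δ θ o

/-- The real roots `Δ^re = {mδ + ε | m ∈ ℤ, ε ∈ ∘Δ}`. -/
def DelRe (α : ι → V) (δ : V) (s : V → V ≃ₗ[ℝ] V) : Set V :=
  {v | ∃ m : ℤ, ∃ ε ∈ Delo α s, v = m • δ + ε}

/-- The imaginary roots `Δ^im = {mδ | m ∈ ℤ ∖ {0}}`. -/
def DelIm (δ : V) : Set V := {v | ∃ m : ℤ, m ≠ 0 ∧ v = m • δ}

/-- The affine root system `Δ = Δ^re ∪ Δ^im`. -/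
def Del (α : ι → V) (δ : V) (s : V → V ≃ₗ[ℝ] V) : Set V := DelRe α δ s ∪ DelIm δ

/-- The positive roots `Δ₊` (relative to `Π`). -/
def DelPos (α : ι → V) (δ θ : V) (s : V → V ≃ₗ[ℝ] V) : Set V :=
  {v ∈ Del α δ s | PosComb α δ θ v}

/-- The negative roots `Δ₋ = −Δ₊`. -/
def DelNeg (α : ι → V) (δ θ : V) (s : V → V ≃ₗ[ℝ] V) : Set V :=
  {v | -v ∈ DelPos α δ θ s}

/-- `Δ^re₊ = Δ^re ∩ Δ₊`. -/
def DelRePos (α : ι → V) (δ θ : V) (s : V → V ≃ₗ[ℝ] V) : Set V :=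
  DelRe α δ s ∩ DelPos α δ θ s

/-- `Δ^im₊ = {mδ | m ≥ 1}`. -/
def DelImPos (δ : V) : Set V := {v | ∃ m : ℕ, 0 < m ∧ v = (m : ℤ) • δ}

/-- `⟨ε⟩ = {mδ + ε | m ∈ ℤ≥0} ∩ Δ^re₊`. -/
def brkt (α : ι → V) (δ θ : V) (s : V → V ≃ₗ[ℝ] V) (ε : V) : Set V :=
  {v | ∃ m : ℕ, v = (m : ℤ) • δ + ε} ∩ DelRePos α δ θ s

/-- `⟨P⟩ = ⋃_{ε ∈ P} ⟨ε⟩`. -/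
def brSet (α : ι → V) (δ θ : V) (s : V → V ≃ₗ[ℝ] V) (P : Set V) : Set V :=
  ⋃ ε ∈ P, brkt α δ θ s ε

/-- `Δ^re_J = {mδ + ε | m ∈ ℤ, ε ∈ ∘Δ_J}`. -/
def DelReJ (α : ι → V) (δ : V) (s : V → V ≃ₗ[ℝ] V) (J : Set ι) : Set V :=
  {v | ∃ m : ℤ, ∃ ε ∈ DeloJ α s J, v = m • δ + ε}

/-- `Δ_J = Δ^re_J ∪ Δ^im`. -/
def DelJ (α : ι → V) (δ : V) (s : V → V ≃ₗ[ℝ] V) (J : Set ι) : Set V :=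
  DelReJ α δ s J ∪ DelIm δ

/-- `Δ_{J+} = Δ_J ∩ Δ₊`. -/
def DelJPos (α : ι → V) (δ θ : V) (s : V → V ≃ₗ[ℝ] V) (J : Set ι) : Set V :=
  DelJ α δ s J ∩ DelPos α δ θ s

/-- `Δ_{J+} = ⟨∘Δ_J⟩ ∪ Δ^im₊` (the description used from Section 5 onwards). -/
def DelJPosB (α : ι → V) (δ θ : V) (s : V → V ≃ₗ[ℝ] V) (J : Set ι) : Set V :=
  brSet α δ θ s (DeloJ α s J) ∪ DelImPos δ

/-- The set of highest roots of the irreducible components of `∘Δ_J`, i.e. the maximal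
elements of `∘Δ_{J+}`: the positive roots `ε` of `∘Δ_J` such that no `ε + α_j` is a root. -/
def HighRoots (α : ι → V) (s : V → V ≃ₗ[ℝ] V) (J : Set ι) : Set V :=
  {ε ∈ DeloJ α s J | PosoComb α ε ∧ ∀ j ∈ J, ε + α j ∉ DeloJ α s J}

/-- `Π_J = ∘Π_J ⊔ {δ − θ_{J_c} | c}`. -/
def PiJ (α : ι → V) (δ : V) (s : V → V ≃ₗ[ℝ] V) (J : Set ι) : Set V :=
  (α '' J) ∪ (fun x => δ - x) '' HighRoots α s J

/-- `S_J = {s_α | α ∈ Π_J}`. -/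
def SJ (α : ι → V) (δ : V) (s : V → V ≃ₗ[ℝ] V) (J : Set ι) : Set (V ≃ₗ[ℝ] V) :=
  s '' PiJ α δ s J

/-- `W_J = ⟨S_J⟩` (so `W_∅ = {1}`). -/
def WJ (α : ι → V) (δ : V) (s : V → V ≃ₗ[ℝ] V) (J : Set ι) : Subgroup (V ≃ₗ[ℝ] V) :=
  Subgroup.closure (SJ α δ s J)

/-- `Φ_J(y) = {β ∈ Δ_{J+} | y⁻¹(β) < 0}`, with `Δ_{J+} = Δ_J ∩ Δ₊`. -/
def PhiJ (α : ι → V) (δ θ : V) (s : V → V ≃ₗ[ℝ] V) (J : Set ι) (y : V ≃ₗ[ℝ] V) : Set V :=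
  {β ∈ DelJPos α δ θ s J | y⁻¹ β ∈ DelNeg α δ θ s}

/-- `Φ_J(y) = {β ∈ Δ_{J+} | y⁻¹(β) < 0}`, with `Δ_{J+} = ⟨∘Δ_J⟩ ∪ Δ^im₊`. -/
def PhiJb (α : ι → V) (δ θ : V) (s : V → V ≃ₗ[ℝ] V) (J : Set ι) (y : V ≃ₗ[ℝ] V) : Set V :=
  {β ∈ DelJPosB α δ θ s J | y⁻¹ β ∈ DelNeg α δ θ s}

/-- `Δ^K_J(u, −) = ⟨u∘Δ^K_{J−}⟩`. -/
def DKJm (α : ι → V) (δ θ : V) (s : V → V ≃ₗ[ℝ] V) (J K : Set ι) (u : V ≃ₗ[ℝ] V) : Set V :=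
  brSet α δ θ s (⇑u '' DeloKJneg α s J K)

/-- `Δ^K_J(u, +) = ⟨u∘Δ^K_{J+}⟩`. -/
def DKJp (α : ι → V) (δ θ : V) (s : V → V ≃ₗ[ℝ] V) (J K : Set ι) (u : V ≃ₗ[ℝ] V) : Set V :=
  brSet α δ θ s (⇑u '' DeloKJpos α s J K)

/-- `B` is a convex set in `A`: `B ⊆ A` and `β, γ ∈ B`, `β + γ ∈ A` imply `β + γ ∈ B`. -/
def ConvexIn (A B : Set V) : Prop :=
  B ⊆ A ∧ ∀ x ∈ B, ∀ y ∈ B, x + y ∈ A → x + y ∈ B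

/-- `B` is a biconvex set in `A`: both `B` and `A ∖ B` are convex sets in `A`. -/
def BiconvexIn (A B : Set V) : Prop :=
  ConvexIn A B ∧ ConvexIn A (A \ B)

/-- `P ⊆ ∘Δ` is a closed set. -/
def ClosedIn (Δo P : Set V) : Prop :=
  ∀ ε ∈ P, ∀ η ∈ P, ε + η ∈ Δo → ε + η ∈ P

/-- The coroot `α_j^∨ = 2α_j/(α_j|α_j)`. -/
noncomputable def coroot (α : ι → V) (B : V →ₗ[ℝ] V →ₗ[ℝ] ℝ) (j : ι) : V :=
  (2 / B (α j) (α j)) • α j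

/-- The coroot lattice `∘Q^∨_J = ⊕_{j ∈ J} ℤ α_j^∨`. -/
def QJ (α : ι → V) (B : V →ₗ[ℝ] V →ₗ[ℝ] ℝ) (J : Set ι) : Set V :=
  {lam | ∃ c : ι → ℤ, (∀ j, j ∉ J → c j = 0) ∧ lam = ∑ j, c j • coroot α B j}

/-- `g` acts as the translation `t_λ`: `g(μ) = μ − (μ|λ)δ` for `μ` in the span of `Π`. -/
def IsTransl (α : ι → V) (δ θ : V) (B : V →ₗ[ℝ] V →ₗ[ℝ] ℝ) (lam : V)
    (g : V ≃ₗ[ℝ] V) : Prop :=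
  ∀ μ ∈ Submodule.span ℝ (Set.range (alHat α δ θ)), g μ = μ - B μ lam • δ

/-- The translation subgroup `T_J = {t_λ | λ ∈ ∘Q^∨_J}` of `W_J`. -/
def TJ (α : ι → V) (δ θ : V) (B : V →ₗ[ℝ] V →ₗ[ℝ] ℝ) (s : V → V ≃ₗ[ℝ] V)
    (J : Set ι) : Set (V ≃ₗ[ℝ] V) :=
  {g | g ∈ WJ α δ s J ∧ ∃ lam ∈ QJ α B J, IsTransl α δ θ B lam g}

/-- The hypotheses describing the root datum of an untwisted affine Kac–Moody Lie algebra
over `ℝ`: `α` are the simple roots of the underlying finite-dimensional simple Lie algebra,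
`δ` is the null root, `θ` the highest root of `∘Δ`, `B` the standard invariant bilinear form,
and `s a` the reflection in a (real) root `a`. -/
structure AffineSetup (α : ι → V) (δ θ : V) (B : V →ₗ[ℝ] V →ₗ[ℝ] ℝ)
    (s : V → V ≃ₗ[ℝ] V) : Prop where
  indep : LinearIndependent ℝ (alHat α δ θ)
  Bsymm : ∀ u v : V, B u v = B v u
  Bpos : ∀ v ∈ Delo α s, 0 < B v v
  refl_def : ∀ a : V, B a a ≠ 0 → ∀ v : V, s a v = v - (2 * B v a / B a a) • a
  delta_orth : ∀ i : ι, B δ (α i) = 0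
  delta_null : B δ δ = 0
  theta_high : θ ∈ HighRoots α s Set.univ
  cryst : ∀ i : ι, ∀ v ∈ Delo α s, ∃ m : ℤ, s (α i) v = v - m • α i
  base : ∀ v ∈ Delo α s, Xor' (PosoComb α v) (PosoComb α (-v))
  finite : (Delo α s).Finite
  reduced : ∀ v ∈ Delo α s, (2 : ℝ) • v ∉ Delo α s
  irred : ∀ A : Set ι, (∀ i ∈ A, ∀ j ∈ Aᶜ, s (α i) (α j) = α j) → A = ∅ ∨ A = Set.univ

/-- `v` is a nonnegative (finitely supported) combination of elements of the set `Π`. -/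
def SpanPosSet (Pi : Set V) (v : V) : Prop :=
  ∃ c : V →₀ ℝ, ↑c.support ⊆ Pi ∧ (∀ x, 0 ≤ c x) ∧ v = c.sum fun x r => r • x

/-! ### An abstract criterion for Coxeter systems -/

section CoxAbstract

/-- Product of a word. -/
def cxP {S G : Type*} [Group G] (σ : S → G) (l : List S) : G := (l.map σ).prod

theorem cxP_nil {S G : Type*} [Group G] (σ : S → G) : cxP σ [] = 1 := rfl

theorem cxP_cons {S G : Type*} [Group G] (σ : S → G) (a : S) (l : List S) :
    cxP σ (a :: l) = σ a * cxP σ l := by simp [cxP]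

theorem cxP_append {S G : Type*} [Group G] (σ : S → G) (l l' : List S) :
    cxP σ (l ++ l') = cxP σ l * cxP σ l' := by simp [cxP]

theorem cxP_single {S G : Type*} [Group G] (σ : S → G) (a : S) : cxP σ [a] = σ a := by
  simp [cxP]

/-- Reduced words. -/
def cxRed {S G : Type*} [Group G] (σ : S → G) (u : List S) : Prop :=
  ∀ v : List S, cxP σ v = cxP σ u → u.length ≤ v.length

theorem cxRed_append_left {S G : Type*} [Group G] {σ : S → G} {u v : List S}
    (h : cxRed σ (u ++ v)) : cxRed σ u := by
  intro w hw
  have := h (w ++ v) (by rw [cxP_append, cxP_append, hw])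
  simp only [List.length_append] at this
  omega

theorem cxRed_append_right {S G : Type*} [Group G] {σ : S → G} {u v : List S}
    (h : cxRed σ (u ++ v)) : cxRed σ v := by
  intro w hw
  have := h (u ++ w) (by rw [cxP_append, cxP_append, hw])
  simp only [List.length_append] at this
  omega

theorem cxRed_of_eq {S G : Type*} [Group G] {σ : S → G} {u v : List S}
    (h : cxRed σ u) (hl : v.length ≤ u.length) (he : cxP σ v = cxP σ u) : cxRed σ v := by
  intro w hw
  exact hl.trans (h w (hw.trans he))

theorem cxRed_exists {S G : Type*} [Group G] (σ : S → G) (u : List S) :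
    ∃ r, cxRed σ r ∧ cxP σ r = cxP σ u := by
  classical
  have hne : ∃ n, ∃ r : List S, r.length = n ∧ cxP σ r = cxP σ u := ⟨_, u, rfl, rfl⟩
  obtain ⟨r, hr, hr'⟩ := Nat.find_spec hne
  refine ⟨r, fun v hv => ?_, hr'⟩
  rw [hr]
  exact Nat.find_min' hne ⟨v, rfl, hv.trans hr'⟩

theorem cx_alt {S G : Type*} [Group G] (σ : S → G) (hσ : ∀ a, σ a * σ a = 1) (k : ℕ) :
    ∀ p q : S,
    cxP σ (CoxeterSystem.alternatingWord p q k) =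
      cxP σ (CoxeterSystem.alternatingWord q p k) * (σ p * σ q) ^ k := by
  have hi : ∀ a, (σ a)⁻¹ = σ a := fun a => inv_eq_of_mul_eq_one_left (hσ a)
  induction k with
  | zero => intro p q; simp [CoxeterSystem.alternatingWord]
  | succ k ih =>
    intro p q
    rw [CoxeterSystem.alternatingWord_succ, CoxeterSystem.alternatingWord_succ,
      List.concat_eq_append, List.concat_eq_append, cxP_append, cxP_append, cxP_single,
      cxP_single, ih p q, pow_succ]
    have h2 : (σ p * σ q) ^ k * (σ q * σ p) ^ k = 1 := by
      have : σ q * σ p = (σ p * σ q)⁻¹ := by rw [mul_inv_rev, hi, hi]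
      rw [this, inv_pow, mul_inv_cancel]
    have h3 : σ p * (σ p * σ q) ^ k * σ p = (σ q * σ p) ^ k := by
      have h4 := conj_pow (i := k) (a := σ p) (b := σ p * σ q)
      rw [hi] at h4
      rw [← h4, ← mul_assoc, hσ, one_mul]
    calc cxP σ (CoxeterSystem.alternatingWord q p k) * σ q
        = cxP σ (CoxeterSystem.alternatingWord q p k) *
          ((σ p * σ q) ^ k * (σ q * σ p) ^ k * σ q) := by rw [h2, one_mul]
      _ = _ := by rw [← h3]; simp only [mul_assoc]

/-- Abstract hypotheses (folding condition) guaranteeing a Coxeter system. -/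
structure CxHyp {S W : Type*} [Group W] (σ : S → W) (N : W → S → Prop) : Prop where
  invol : ∀ a, σ a * σ a = 1
  one : ∀ a, ¬ N 1 a
  flip : ∀ w a, ¬ N w a → N (w * σ a) a
  flip' : ∀ w a, N w a → ¬ N (w * σ a) a
  fold : ∀ w a b, ¬ N w a → N (σ b * w) a → σ b * w = w * σ a

theorem CxHyp.exch {S W : Type*} [Group W] {σ : S → W} {N : W → S → Prop} (h : CxHyp σ N)
    (u : List S) (s : S) (hu : N (cxP σ u) s) :
    ∃ u1 b u2, u = u1 ++ b :: u2 ∧ cxP σ (u2 ++ [s]) = cxP σ (b :: u2) := by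
  induction u with
  | nil => exact absurd hu (h.one s)
  | cons t u ih =>
    by_cases hN : N (cxP σ u) s
    · obtain ⟨u1, b, u2, rfl, h2⟩ := ih hN
      exact ⟨t :: u1, b, u2, rfl, h2⟩
    · rw [cxP_cons] at hu
      refine ⟨[], t, u, rfl, ?_⟩
      rw [cxP_append, cxP_single, cxP_cons, h.fold _ _ _ hN hu]

theorem CxHyp.red_concat {S W : Type*} [Group W] {σ : S → W} {N : W → S → Prop}
    (h : CxHyp σ N) {u : List S} {s : S} (hr : cxRed σ u) (hN : ¬ N (cxP σ u) s) :
    cxRed σ (u ++ [s]) := by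
  intro v hv
  rw [cxP_append, cxP_single] at hv
  have h1 : N (cxP σ v) s := by rw [hv]; exact h.flip _ _ hN
  obtain ⟨v1, b, v2, rfl, h2⟩ := h.exch v s h1
  have h3 : cxP σ (v1 ++ v2) = cxP σ u := by
    have : cxP σ u = cxP σ (v1 ++ b :: v2) * σ s := by rw [hv, mul_assoc, h.invol, mul_one]
    rw [this, cxP_append, cxP_append, mul_assoc, ← h2, cxP_append, cxP_single, mul_assoc,
      h.invol, mul_one]
  have := hr _ h3
  simp only [List.length_append, List.length_cons, List.length_nil] at this ⊢
  omega

/-- The bad pairs in the proof of the theorem of Matsumoto. -/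
def cxBad {S W H : Type*} [Group W] [Group H] (σ : S → W) (τ : S → H) (k : ℕ)
    (u v : List S) : Prop :=
  u.length = k ∧ v.length = k ∧ cxRed σ u ∧ cxP σ u = cxP σ v ∧ cxP τ u ≠ cxP τ v

theorem CxHyp.bad_step {S W H : Type*} [Group W] [Group H] {σ : S → W} {N : W → S → Prop}
    (h : CxHyp σ N) {τ : S → H} {k : ℕ}
    (ih : ∀ m < k, ∀ u v, ¬ cxBad σ τ m u v) {u' v : List S} {s : S}
    (hb : cxBad σ τ k (u' ++ [s]) v) : cxBad σ τ k v (v.tail ++ [s]) := by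
  obtain ⟨hlu, hlv, hr, hf, hF⟩ := hb
  have hN : N (cxP σ v) s := by
    by_contra hN
    have h1 := h.red_concat hr (by rwa [hf]) u' (by
      rw [cxP_append, cxP_append, cxP_single, mul_assoc, h.invol, mul_one])
    simp only [List.length_append, List.length_cons, List.length_nil] at h1
    omega
  obtain ⟨v1, b, v2, rfl, h2⟩ := h.exch v s hN
  have hrv : cxRed σ (v1 ++ b :: v2) := cxRed_of_eq hr (by omega) hf.symm
  have hfs : cxP σ (v1 ++ v2 ++ [s]) = cxP σ (v1 ++ b :: v2) := by
    rw [List.append_assoc, cxP_append, h2, cxP_append]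
  have hFs : cxP τ (u' ++ [s]) = cxP τ (v1 ++ v2 ++ [s]) := by
    have hu' := cxRed_append_left hr
    have hlen : u'.length < k := by simp at hlu; omega
    by_contra hne
    refine ih _ hlen u' (v1 ++ v2) ⟨rfl, ?_, hu', ?_, ?_⟩
    · simp only [List.length_append, List.length_cons, List.length_nil] at hlu hlv ⊢
      omega
    · have := hf.trans hfs.symm
      rwa [cxP_append, cxP_append (l := v1 ++ v2), mul_left_inj] at this
    · intro h'
      exact hne (by rw [cxP_append, h', cxP_append (l := v1 ++ v2)])
  have hv1 : v1 = [] := by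
    by_contra hv1
    have hpos : 0 < v1.length := List.length_pos_iff.mpr hv1
    refine ih (b :: v2).length ?_ (b :: v2) (v2 ++ [s])
      ⟨rfl, by simp, cxRed_append_right hrv, h2.symm, ?_⟩
    · simp only [List.length_append, List.length_cons] at hlv ⊢
      omega
    · intro h'
      apply hF
      rw [hFs, List.append_assoc, cxP_append, ← h', cxP_append]
  subst hv1
  refine ⟨hlv, ?_, hrv, ?_, ?_⟩
  · simpa using hlv
  · simpa using hfs.symm
  · intro h'
    apply hF
    rw [hFs, h']
    simp

theorem CxHyp.bad_iter {S W H : Type*} [Group W] [Group H] {σ : S → W} {N : W → S → Prop}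
    (h : CxHyp σ N) {τ : S → H} {k : ℕ} (hk : 0 < k)
    (ih : ∀ m < k, ∀ u v, ¬ cxBad σ τ m u v) {u v : List S}
    (hb : cxBad σ τ k u v) (n : ℕ) (hn : n ≤ k) :
    ∃ U V p q x, cxBad σ τ k (U ++ [p]) V ∧ (∃ V', V = V' ++ [q]) ∧
      V = x ++ CoxeterSystem.alternatingWord p q n := by
  induction n with
  | zero =>
    have hu : u ≠ [] := by rintro rfl; simp [cxBad] at hb; omega
    have hv : v ≠ [] := by rintro rfl; simp [cxBad] at hb; omega
    refine ⟨u.dropLast, v, u.getLast hu, v.getLast hv, v, ?_, ⟨v.dropLast, ?_⟩, ?_⟩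
    · rwa [List.dropLast_append_getLast]
    · rw [List.dropLast_append_getLast]
    · simp [CoxeterSystem.alternatingWord]
  | succ n ihn =>
    obtain ⟨U, V, p, q, x, hbad, ⟨V', hV'⟩, hx⟩ := ihn (by omega)
    have hstep := h.bad_step ih hbad
    have hlx : x.length = k - n := by
      have := hbad.2.1
      rw [hx, List.length_append, CoxeterSystem.length_alternatingWord] at this
      omega
    have hxne : x ≠ [] := by rintro rfl; simp at hlx; omega
    refine ⟨V', V.tail ++ [p], q, p, x.tail, ?_, ⟨V.tail, rfl⟩, ?_⟩
    · rwa [← hV']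
    · rw [CoxeterSystem.alternatingWord_succ, List.concat_eq_append, hx,
        List.tail_append_of_ne_nil hxne, List.append_assoc]

theorem CxHyp.no_bad {S W H : Type*} [Group W] [Group H] {σ : S → W} {N : W → S → Prop}
    (h : CxHyp σ N) {τ : S → H} (hτ : ∀ a, τ a * τ a = 1)
    (hrel : ∀ a b n, (σ a * σ b) ^ n = 1 → (τ a * τ b) ^ n = 1) (k : ℕ) :
    ∀ u v, ¬ cxBad σ τ k u v := by
  induction k using Nat.strong_induction_on with
  | _ k ih =>
    intro u v hb
    rcases Nat.eq_zero_or_pos k with rfl | hk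
    · obtain ⟨h1, h2, -, -, h3⟩ := hb
      rw [List.length_eq_zero_iff] at h1 h2
      subst h1; subst h2; exact h3 rfl
    · obtain ⟨U, V, p, q, x, hbad, -, hx⟩ := h.bad_iter hk ih hb k le_rfl
      have hlx : x = [] := by
        have := hbad.2.1
        rw [hx, List.length_append, CoxeterSystem.length_alternatingWord] at this
        rw [← List.length_eq_zero_iff]; omega
      subst hlx
      rw [List.nil_append] at hx
      have hstep := h.bad_step ih hbad
      have htail : V.tail ++ [p] = CoxeterSystem.alternatingWord q p k := by
        have h1 := CoxeterSystem.alternatingWord_succ q p k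
        rw [CoxeterSystem.alternatingWord_succ', List.concat_eq_append, ← hx] at h1
        have hVne : V ≠ [] := by
          rintro rfl
          have := hbad.2.1
          simp at this; omega
        have h2 := congrArg List.tail h1
        rw [List.tail_cons, List.tail_append_of_ne_nil hVne] at h2
        exact h2.symm
      rw [htail, hx] at hstep
      obtain ⟨-, -, -, hf, hF⟩ := hstep
      apply hF
      rw [cx_alt σ h.invol, mul_eq_left] at hf
      rw [cx_alt τ hτ, hrel _ _ _ hf, mul_one]

theorem CxHyp.word_eq {S W H : Type*} [Group W] [Group H] {σ : S → W} {N : W → S → Prop}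
    (h : CxHyp σ N) {τ : S → H} (hτ : ∀ a, τ a * τ a = 1)
    (hrel : ∀ a b n, (σ a * σ b) ^ n = 1 → (τ a * τ b) ^ n = 1) {u v : List S}
    (hu : cxRed σ u) (hl : v.length = u.length) (hf : cxP σ u = cxP σ v) :
    cxP τ u = cxP τ v := by
  by_contra hne
  exact h.no_bad hτ hrel u.length u v ⟨rfl, hl, hu, hf, hne⟩

theorem CxHyp.word_eq' {S W H : Type*} [Group W] [Group H] {σ : S → W} {N : W → S → Prop}
    (h : CxHyp σ N) {τ : S → H} (hτ : ∀ a, τ a * τ a = 1)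
    (hrel : ∀ a b n, (σ a * σ b) ^ n = 1 → (τ a * τ b) ^ n = 1) (u : List S) :
    ∀ r : List S, cxRed σ r → cxP σ r = cxP σ u → cxP τ r = cxP τ u := by
  induction u using List.reverseRecOn with
  | nil =>
    intro r hr hf
    have := hr [] hf.symm
    have hr0 : r = [] := by rw [← List.length_eq_zero_iff]; simpa using this
    rw [hr0]
  | append_singleton u s ih =>
    intro r hr hf
    obtain ⟨r', hr', hfr'⟩ := cxRed_exists σ u
    have hF := ih r' hr' hfr'
    rw [cxP_append, cxP_single, ← hfr'] at hf
    rw [cxP_append τ, cxP_single, ← hF]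
    by_cases hN : N (cxP σ r') s
    · obtain ⟨r1, b, r2, rfl, h2⟩ := h.exch r' s hN
      have h3 := h.word_eq hτ hrel (v := r2 ++ [s]) (cxRed_append_right hr') (by simp) h2.symm
      have hf2 : cxP σ (r1 ++ r2) = cxP σ r := by
        rw [hf, cxP_append, cxP_append, mul_assoc, ← h2, cxP_append, cxP_single, mul_assoc,
          h.invol, mul_one]
      have hle := hr _ hf2
      have hge := hr' (r ++ [s]) (by
        rw [cxP_append, cxP_single, hf, mul_assoc, h.invol, mul_one])
      have hF2 := h.word_eq hτ hrel (v := r1 ++ r2) hr (by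
        simp only [List.length_append, List.length_cons, List.length_nil] at hle hge ⊢
        omega) hf2.symm
      rw [hF2, cxP_append, cxP_append, h3, cxP_append, cxP_single, mul_assoc, mul_assoc, hτ,
        mul_one]
    · have hred := h.red_concat hr' hN
      have he : cxP σ r = cxP σ (r' ++ [s]) := by rw [hf, cxP_append, cxP_single]
      have := h.word_eq hτ hrel (v := r' ++ [s]) hr
        (le_antisymm (hred _ he) (hr _ he.symm)) he
      rw [this, cxP_append, cxP_single]

theorem CxHyp.word_one {S W H : Type*} [Group W] [Group H] {σ : S → W} {N : W → S → Prop}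
    (h : CxHyp σ N) {τ : S → H} (hτ : ∀ a, τ a * τ a = 1)
    (hrel : ∀ a b n, (σ a * σ b) ^ n = 1 → (τ a * τ b) ^ n = 1) (u : List S)
    (hu : cxP σ u = 1) : cxP τ u = 1 :=
  (h.word_eq' hτ hrel u [] (fun _ _ => Nat.zero_le _) hu.symm).symm

theorem CxHyp.coxeter {S W : Type*} [Group W] {σ : S → W} {N : W → S → Prop}
    (h : CxHyp σ N) (hinj : Function.Injective σ)
    (hgen : Subgroup.closure (Set.range σ) = ⊤) :
    ∃ (M : CoxeterMatrix S) (cs : CoxeterSystem M W), ∀ a, cs.simple a = σ a := by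
  have hi : ∀ a, (σ a)⁻¹ = σ a := fun a => inv_eq_of_mul_eq_one_left (h.invol a)
  let M : CoxeterMatrix S :=
    { M := fun a b => orderOf (σ a * σ b)
      isSymm := by
        ext a b
        change orderOf (σ b * σ a) = orderOf (σ a * σ b)
        rw [← orderOf_inv, mul_inv_rev, hi, hi]
      diagonal := by
        intro a
        rw [h.invol, orderOf_one]
      off_diagonal := by
        intro a b hab h1
        change orderOf (σ a * σ b) = 1 at h1
        rw [orderOf_eq_one_iff] at h1
        apply hab
        apply hinj
        rw [eq_inv_of_mul_eq_one_left h1, hi] }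
  have hM : ∀ a b, M a b = orderOf (σ a * σ b) := fun _ _ => rfl
  have hlift : M.IsLiftable σ := fun a b => by rw [hM]; exact pow_orderOf_eq_one _
  let c0 := M.toCoxeterSystem
  let φ : M.Group →* W := c0.lift ⟨σ, hlift⟩
  have hφ : ∀ a, φ (c0.simple a) = σ a := fun a => c0.lift_apply_simple hlift a
  have hφw : ∀ l : List S, φ (c0.wordProd l) = cxP σ l := by
    intro l
    induction l with
    | nil => simp [cxP_nil]
    | cons a l ih => rw [c0.wordProd_cons, map_mul, ih, hφ, cxP_cons]
  have hinjφ : Function.Injective φ := by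
    rw [injective_iff_map_eq_one]
    intro g hg
    obtain ⟨l, rfl⟩ := c0.wordProd_surjective g
    rw [hφw] at hg
    exact h.word_one (τ := c0.simple) c0.simple_mul_simple_self (by
      intro a b n hn
      have hd := orderOf_dvd_of_pow_eq_one hn
      rw [← hM] at hd
      obtain ⟨k, rfl⟩ := hd
      rw [pow_mul, c0.simple_mul_simple_pow, one_pow]) l hg
  have hsurj : Function.Surjective φ := by
    rw [← MonoidHom.range_eq_top, eq_top_iff, ← hgen, Subgroup.closure_le]
    rintro _ ⟨a, rfl⟩
    exact ⟨_, hφ a⟩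
  let e : M.Group ≃* W := MulEquiv.ofBijective φ ⟨hinjφ, hsurj⟩
  exact ⟨M, ⟨e.symm⟩, hφ⟩

end CoxAbstract
set_option linter.unusedSectionVars false

/-! ### Basic facts about the finite root system -/

/-- The affine setup together with coordinate functionals. -/
structure Ctx (α : ι → V) (δ θ : V) (B : V →ₗ[ℝ] V →ₗ[ℝ] ℝ) (s : V → V ≃ₗ[ℝ] V)
    (X : ι → V →ₗ[ℝ] ℝ) (D : V →ₗ[ℝ] ℝ) : Prop extends AffineSetup α δ θ B s where
  X_self : ∀ i, X i (α i) = 1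
  X_ne : ∀ i j, i ≠ j → X i (α j) = 0
  X_delta : ∀ i, X i δ = 0
  D_delta : D δ = 1
  D_al : ∀ j, D (α j) = 0

theorem ctx_exists {α : ι → V} {δ θ : V} {B : V →ₗ[ℝ] V →ₗ[ℝ] ℝ} {s : V → V ≃ₗ[ℝ] V}
    (h : AffineSetup α δ θ B s) : ∃ X D, Ctx α δ θ B s X D := by
  classical
  obtain ⟨g, hg⟩ := LinearMap.exists_leftInverse_of_injective
    (Finsupp.linearCombination ℝ (alHat α δ θ)) (LinearMap.ker_eq_bot.mpr h.indep)
  have hY : ∀ o o', (g (alHat α δ θ o)) o' = if o = o' then 1 else 0 := by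
    intro o o'
    have := LinearMap.congr_fun hg (Finsupp.single o 1)
    simp only [LinearMap.comp_apply, Finsupp.linearCombination_single, one_smul,
      LinearMap.id_apply] at this
    rw [this, Finsupp.single_apply]
  have hYa : ∀ j o', (g (α j)) o' = if some j = o' then 1 else 0 := fun j o' => hY (some j) o'
  have hYd : ∀ o', (g (δ - θ)) o' = if none = o' then 1 else 0 := fun o' => hY none o'
  obtain ⟨c, -, hc⟩ := h.theta_high.2.1
  let Y : Option ι → V →ₗ[ℝ] ℝ := fun o => Finsupp.lapply o ∘ₗ g
  have hYdel : Y none δ = 1 := by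
    have h1 : δ = (δ - θ) + ∑ i, c i • α i := by rw [← hc]; abel
    change (g δ) none = 1
    rw [h1]
    simp only [map_add, map_sum, map_smul, Finsupp.add_apply, hYd, Finsupp.finsetSum_apply,
      Finsupp.smul_apply, hYa]
    simp
  have hYa' : ∀ j o', Y o' (α j) = if some j = o' then 1 else 0 := hYa
  refine ⟨fun i => Y (some i) - (Y (some i) δ) • Y none, Y none, ?_⟩
  refine { h with X_self := ?_, X_ne := ?_, X_delta := ?_, D_delta := hYdel, D_al := ?_ }
  · intro i; simp [hYa']
  · intro i j hij; simp [hYa', hij.symm]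
  · intro i; simp [hYdel]
  · intro j; simp [hYa']

theorem closure_pres {S : Set (V ≃ₗ[ℝ] V)} (hinv : ∀ g ∈ S, g * g = 1) {P : V → Prop}
    (hP : ∀ g ∈ S, ∀ v, P v → P (g v)) :
    ∀ g ∈ Subgroup.closure S, ∀ v, P v → P (g v) := by
  intro g hg
  induction hg using Subgroup.closure_induction_left with
  | one => intro v hv; exact hv
  | mul_left x hx y hy ih => intro v hv; exact hP x hx _ (ih v hv)
  | inv_mul_cancel x hx y hy ih =>
    intro v hv
    rw [inv_eq_of_mul_eq_one_left (hinv x hx)]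
    exact hP x hx _ (ih v hv)

theorem closure_form {S : Set (V ≃ₗ[ℝ] V)} {B : V →ₗ[ℝ] V →ₗ[ℝ] ℝ}
    (hP : ∀ g ∈ S, ∀ u v, B (g u) (g v) = B u v) :
    ∀ g ∈ Subgroup.closure S, ∀ u v, B (g u) (g v) = B u v := by
  intro g hg
  induction hg using Subgroup.closure_induction with
  | mem x hx => exact hP x hx
  | one => intro u v; rfl
  | mul x y hx hy ihx ihy =>
    intro u v
    rw [LinearEquiv.mul_apply, LinearEquiv.mul_apply, ihx, ihy]
  | inv x hx ih =>
    intro u v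
    rw [← ih]
    rw [← LinearEquiv.mul_apply, ← LinearEquiv.mul_apply, mul_inv_cancel]
    rfl

namespace Ctx

/-- Cartan numbers. -/
noncomputable def cc (B : V →ₗ[ℝ] V →ₗ[ℝ] ℝ) (u e : V) : ℝ := 2 * B u e / B e e

variable {α : ι → V} {δ θ : V} {B : V →ₗ[ℝ] V →ₗ[ℝ] ℝ} {s : V → V ≃ₗ[ℝ] V}
  {X : ι → V →ₗ[ℝ] ℝ} {D : V →ₗ[ℝ] ℝ} {J : Set ι}

theorem refl (c : Ctx α δ θ B s X D) {a : V} (ha : B a a ≠ 0) (v : V) :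
    s a v = v - cc B v a • a := c.refl_def a ha v

theorem refl_self (c : Ctx α δ θ B s X D) {a : V} (ha : B a a ≠ 0) : s a a = -a := by
  rw [c.refl ha, cc, mul_div_assoc, div_self ha, mul_one, two_smul]; abel

theorem refl_invol (c : Ctx α δ θ B s X D) {a : V} (ha : B a a ≠ 0) : s a * s a = 1 := by
  ext v
  rw [LinearEquiv.mul_apply, c.refl ha v, map_sub, map_smul, c.refl_self ha, c.refl ha v]
  simp

theorem refl_form (c : Ctx α δ θ B s X D) {a : V} (ha : B a a ≠ 0) (u v : V) :
    B (s a u) (s a v) = B u v := by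
  rw [c.refl ha, c.refl ha]
  simp only [map_sub, map_smul, LinearMap.sub_apply, LinearMap.smul_apply, smul_eq_mul, cc]
  rw [c.Bsymm a v]
  field_simp
  ring

theorem conj (c : Ctx α δ θ B s X D) {g : V ≃ₗ[ℝ] V} (hg : ∀ u v, B (g u) (g v) = B u v)
    {b : V} (hb : B b b ≠ 0) : g * s b * g⁻¹ = s (g b) := by
  ext v
  obtain ⟨w, rfl⟩ := g.surjective v
  have h1 : g⁻¹ (g w) = w := by
    rw [← LinearEquiv.mul_apply, inv_mul_cancel]; rfl
  have hb' : B (g b) (g b) ≠ 0 := by rwa [hg]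
  rw [LinearEquiv.mul_apply, LinearEquiv.mul_apply, h1, c.refl hb, c.refl hb', cc, cc, hg, hg]
  simp

theorem mono : DeloJ α s J ⊆ Delo α s := by
  rintro v ⟨g, hg, j, hj, rfl⟩
  refine ⟨g, ?_, j, trivial, rfl⟩
  exact Subgroup.closure_mono (Set.image_mono (Set.subset_univ J)) hg

theorem al_mem {j : ι} (hj : j ∈ J) : α j ∈ DeloJ α s J :=
  ⟨1, Subgroup.one_mem _, j, hj, rfl⟩

theorem al_mem' (j : ι) : α j ∈ Delo α s := al_mem (J := Set.univ) trivial

theorem pos (c : Ctx α δ θ B s X D) {v : V} (hv : v ∈ DeloJ α s J) : 0 < B v v :=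
  c.Bpos v (mono hv)

theorem al_ne (c : Ctx α δ θ B s X D) (j : ι) : B (α j) (α j) ≠ 0 :=
  (c.Bpos _ (al_mem' j)).ne'

theorem ne_zero (c : Ctx α δ θ B s X D) {v : V} (hv : v ∈ DeloJ α s J) : v ≠ 0 := by
  rintro rfl
  have := c.pos hv
  simp at this

theorem Wo_form (c : Ctx α δ θ B s X D) {g : V ≃ₗ[ℝ] V} (hg : g ∈ WoJ α s J) (u v : V) :
    B (g u) (g v) = B u v := by
  refine closure_form ?_ g hg u v
  rintro _ ⟨j, hj, rfl⟩ u v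
  exact c.refl_form (c.al_ne j) u v

theorem Wo_pres (c : Ctx α δ θ B s X D) {P : V → Prop}
    (hP : ∀ j ∈ J, ∀ v, P v → P (s (α j) v)) {g : V ≃ₗ[ℝ] V} (hg : g ∈ WoJ α s J) {v : V}
    (hv : P v) : P (g v) := by
  refine closure_pres ?_ ?_ g hg v hv
  · rintro _ ⟨j, hj, rfl⟩; exact c.refl_invol (c.al_ne j)
  · rintro _ ⟨j, hj, rfl⟩; exact hP j hj

theorem Wo_mem {g : V ≃ₗ[ℝ] V} (hg : g ∈ WoJ α s J) {v : V} (hv : v ∈ DeloJ α s J) :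
    g v ∈ DeloJ α s J := by
  obtain ⟨g', hg', j, hj, rfl⟩ := hv
  exact ⟨g * g', Subgroup.mul_mem _ hg hg', j, hj, rfl⟩

theorem s_mem_Wo {j : ι} (hj : j ∈ J) : s (α j) ∈ WoJ α s J :=
  Subgroup.subset_closure ⟨j, hj, rfl⟩

theorem neg_mem (c : Ctx α δ θ B s X D) {v : V} (hv : v ∈ DeloJ α s J) :
    -v ∈ DeloJ α s J := by
  obtain ⟨g, hg, j, hj, rfl⟩ := hv
  refine ⟨g * s (α j), Subgroup.mul_mem _ hg (s_mem_Wo hj), j, hj, ?_⟩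
  rw [LinearEquiv.mul_apply, c.refl_self (c.al_ne j), map_neg]

theorem refl_mem (c : Ctx α δ θ B s X D) {b v : V} (hb : b ∈ DeloJ α s J)
    (hv : v ∈ DeloJ α s J) : s b v ∈ DeloJ α s J := by
  obtain ⟨g, hg, j, hj, rfl⟩ := hb
  rw [← c.conj (c.Wo_form hg) (c.al_ne j)]
  exact Wo_mem (Subgroup.mul_mem _ (Subgroup.mul_mem _ hg (s_mem_Wo hj))
    (Subgroup.inv_mem _ hg)) hv

theorem sum_X (c : Ctx α δ θ B s X D) (k : ι → ℝ) (i : ι) : X i (∑ j, k j • α j) = k i := by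
  rw [map_sum, Finset.sum_eq_single i]
  · simp [c.X_self]
  · intro j _ hj; simp [c.X_ne i j hj.symm]
  · simp

theorem coords (c : Ctx α δ θ B s X D) {v : V} (hv : v ∈ DeloJ α s J) :
    v = ∑ i, X i v • α i := by
  rcases Xor.or (c.base v (mono hv)) with ⟨k, -, hk⟩ | ⟨k, -, hk⟩
  · have h1 : ∀ i, X i v = k i := fun i => by rw [hk, c.sum_X]
    simp_rw [h1]; exact hk
  · have h1 : ∀ i, X i v = - k i := fun i => by
      rw [← c.sum_X k i, ← hk, map_neg, neg_neg]
    simp_rw [h1, neg_smul, Finset.sum_neg_distrib, ← hk, neg_neg]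

theorem D_zero (c : Ctx α δ θ B s X D) {v : V} (hv : v ∈ DeloJ α s J) : D v = 0 := by
  rw [c.coords hv]; simp [c.D_al]

theorem B_delta (c : Ctx α δ θ B s X D) {v : V} (hv : v ∈ DeloJ α s J) : B δ v = 0 := by
  rw [c.coords hv]; simp [c.delta_orth]

theorem poso_iff (c : Ctx α δ θ B s X D) {v : V} (hv : v ∈ DeloJ α s J) :
    PosoComb α v ↔ ∀ i, 0 ≤ X i v := by
  constructor
  · rintro ⟨k, hk, rfl⟩ i; rw [c.sum_X]; exact hk i
  · intro h; exact ⟨_, h, c.coords hv⟩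

theorem X_supp (c : Ctx α δ θ B s X D) {v : V} (hv : v ∈ DeloJ α s J) {i : ι} (hi : i ∉ J) :
    X i v = 0 := by
  obtain ⟨g, hg, j, hj, rfl⟩ := hv
  refine c.Wo_pres (P := fun v => X i v = 0) ?_ hg
    (c.X_ne i j (by rintro rfl; exact hi hj))
  intro j hj v hv
  rw [c.refl (c.al_ne j), map_sub, hv, map_smul, c.X_ne i j (by rintro rfl; exact hi hj)]
  simp

theorem X_int (c : Ctx α δ θ B s X D) {v : V} (hv : v ∈ DeloJ α s J) (i : ι) :
    ∃ m : ℤ, X i v = m := by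
  classical
  obtain ⟨g, hg, j, hj, rfl⟩ := mono hv
  refine (c.Wo_pres (P := fun v => v ∈ Delo α s ∧ ∃ m : ℤ, X i v = m) ?_ hg
    ⟨al_mem' j, ?_⟩).2
  · rintro j hj v ⟨hv, m, hm⟩
    obtain ⟨n, hn⟩ := c.cryst j v hv
    refine ⟨c.refl_mem (al_mem' j) hv, ?_⟩
    by_cases hij : i = j
    · subst hij
      exact ⟨m - n, by rw [hn, map_sub, map_zsmul, c.X_self, hm]; simp⟩
    · exact ⟨m, by rw [hn, map_sub, map_zsmul, c.X_ne i j hij, hm]; simp⟩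
  · by_cases hij : i = j
    · subst hij; exact ⟨1, by simp [c.X_self]⟩
    · exact ⟨0, by simp [c.X_ne i j hij]⟩

theorem cc_form {g : V ≃ₗ[ℝ] V} (hg : ∀ u v, B (g u) (g v) = B u v) (u v : V) :
    cc B (g u) (g v) = cc B u v := by rw [cc, cc, hg, hg]

theorem cc_int (c : Ctx α δ θ B s X D) {u b : V} (hu : u ∈ Delo α s) (hb : b ∈ Delo α s) :
    ∃ m : ℤ, cc B u b = m := by
  obtain ⟨g, hg, j, hj, rfl⟩ := hb
  obtain ⟨w, rfl⟩ := g.surjective u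
  rw [cc_form (c.Wo_form hg)]
  have hw : w ∈ Delo α s := by
    have := Wo_mem (Subgroup.inv_mem _ hg) hu
    rwa [← LinearEquiv.mul_apply, inv_mul_cancel] at this
  obtain ⟨m, hm⟩ := c.cryst j w hw
  refine ⟨m, ?_⟩
  rw [c.refl (c.al_ne j)] at hm
  have := congrArg (X j) hm
  simpa [c.X_self] using this

theorem cc_self (c : Ctx α δ θ B s X D) {b : V} (hb : b ∈ DeloJ α s J) : cc B b b = 2 := by
  have := (c.pos hb).ne'
  rw [cc]; field_simp

theorem cc_mul_le (c : Ctx α δ θ B s X D) {b e : V} (hb : b ∈ Delo α s) (he : e ∈ Delo α s) :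
    cc B b e * cc B e b ≤ 4 := by
  classical
  let F := c.finite.toFinset
  let Q : V → V → ℝ := fun u v => ∑ x ∈ F, cc B u x * cc B v x
  have hmemF : ∀ x, x ∈ F ↔ x ∈ Delo α s := fun x => by simp [F]
  have hinv : ∀ a ∈ Delo α s, ∀ u v, Q (s a u) (s a v) = Q u v := by
    intro a ha u v
    have hane := (c.pos ha).ne'
    have hss : ∀ x, s a (s a x) = x := fun x => by
      rw [← LinearEquiv.mul_apply, c.refl_invol hane]; rfl
    refine Finset.sum_bij' (fun x _ => s a x) (fun x _ => s a x) ?_ ?_ ?_ ?_ ?_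
    · intro x hx; rw [hmemF] at hx ⊢; exact c.refl_mem ha hx
    · intro x hx; rw [hmemF] at hx ⊢; exact c.refl_mem ha hx
    · intro x _; exact hss x
    · intro x _; exact hss x
    · intro x _
      rw [← cc_form (c.refl_form hane) (s a u) x, ← cc_form (c.refl_form hane) (s a v) x,
        hss, hss]
  have hQ : ∀ a ∈ Delo α s, ∀ u, 2 * Q u a = cc B u a * Q a a := by
    intro a ha u
    have h1 := hinv a ha u a
    have hane := (c.pos ha).ne'
    rw [c.refl_self hane, c.refl hane u] at h1
    have h2 : Q (u - cc B u a • a) (-a) = - Q u a + cc B u a * Q a a := by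
      simp only [Q, Finset.mul_sum, ← Finset.sum_neg_distrib, ← Finset.sum_add_distrib]
      refine Finset.sum_congr rfl fun x _ => ?_
      simp only [cc, map_sub, map_neg, map_smul, LinearMap.sub_apply, LinearMap.neg_apply,
        LinearMap.smul_apply, smul_eq_mul]
      ring
    linarith
  have hsym : Q b e = Q e b := Finset.sum_congr rfl fun x _ => mul_comm _ _
  have hpos : ∀ a ∈ Delo α s, 0 < Q a a := by
    intro a ha
    have h1 : cc B a a * cc B a a ≤ Q a a :=
      Finset.single_le_sum (f := fun x => cc B a x * cc B a x)
        (fun x _ => mul_self_nonneg _) ((hmemF a).mpr ha)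
    rw [c.cc_self ha] at h1
    linarith
  have hcs : Q b e ^ 2 ≤ Q b b * Q e e := by
    have := Finset.sum_mul_sq_le_sq_mul_sq F (fun x => cc B b x) (fun x => cc B e x)
    simpa [Q, sq] using this
  have h1 := hQ e he b
  have h2 := hQ b hb e
  rw [← hsym] at h2
  have h3 : cc B b e * cc B e b * (Q b b * Q e e) ≤ 4 * (Q b b * Q e e) := by
    have : cc B b e * cc B e b * (Q b b * Q e e) = 4 * Q b e ^ 2 := by
      linear_combination (-2 * Q b e) * h2 - (cc B e b * Q b b) * h1
    rw [this]; linarith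
  exact le_of_mul_le_mul_right h3 (mul_pos (hpos b hb) (hpos e he))

theorem add_mem (c : Ctx α δ θ B s X D) {b e : V} (hb : b ∈ DeloJ α s J)
    (he : e ∈ DeloJ α s J) (hneg : B b e < 0) (hne : b + e ≠ 0) : b + e ∈ DeloJ α s J := by
  obtain ⟨n, hn⟩ := c.cc_int (mono hb) (mono he)
  obtain ⟨m, hm⟩ := c.cc_int (mono he) (mono hb)
  have hbp := c.pos hb
  have hep := c.pos he
  have hn0 : n < 0 := by
    have : (n : ℝ) < 0 := by rw [← hn, cc]; exact div_neg_of_neg_of_pos (by linarith) hep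
    exact_mod_cast this
  have hm0 : m < 0 := by
    have : (m : ℝ) < 0 := by
      rw [← hm, cc, c.Bsymm]; exact div_neg_of_neg_of_pos (by linarith) hbp
    exact_mod_cast this
  have hle := c.cc_mul_le (mono hb) (mono he)
  rw [hn, hm] at hle
  have hle' : n * m ≤ 4 := by exact_mod_cast hle
  by_cases hn1 : n = -1
  · have := c.refl_mem he hb
    rw [c.refl hep.ne', hn, hn1] at this
    simpa using this
  by_cases hm1 : m = -1
  · have := c.refl_mem hb he
    rw [c.refl hbp.ne', hm, hm1] at this
    rw [add_comm]
    simpa using this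
  exfalso
  have hn2 : n = -2 := by
    have : n ≤ -2 := by omega
    have : m ≤ -2 := by omega
    nlinarith
  have hm2 : m = -2 := by
    have : m ≤ -2 := by omega
    rw [hn2] at hle'; omega
  subst hn2 hm2
  push_cast at hn hm
  have hse : s e b = b + (2 : ℝ) • e := by rw [c.refl hep.ne', hn]; simp
  have hsb : s b e = e + (2 : ℝ) • b := by rw [c.refl hbp.ne', hm]; simp
  have hall : ∀ k : ℕ, b + (k : ℝ) • (b + e) + (k : ℝ) • (b + e) ∈ DeloJ α s J := by
    intro k
    induction k with
    | zero => simpa using hb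
    | succ k ih =>
      have h2 := c.refl_mem hb (c.refl_mem he ih)
      simp only [map_add, map_smul, map_neg, hse, hsb, c.refl_self hbp.ne',
        c.refl_self hep.ne'] at h2
      convert h2 using 1
      push_cast
      module
  have hinj : Function.Injective
      (fun k : ℕ => b + (k : ℝ) • (b + e) + (k : ℝ) • (b + e)) := by
    intro k l hkl
    have h1 : ((2 : ℝ) * (k - l)) • (b + e) = 0 := by
      have : b + (k : ℝ) • (b + e) + (k : ℝ) • (b + e) =
        b + (l : ℝ) • (b + e) + (l : ℝ) • (b + e) := hkl
      rw [← sub_eq_zero] at this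
      rw [← this]; module
    rcases smul_eq_zero.mp h1 with h2 | h2
    · have : (k : ℝ) = l := by linarith
      exact_mod_cast this
    · exact absurd h2 hne
  exact Set.infinite_of_injective_forall_mem hinj (fun k => mono (hall k)) c.finite

theorem sub_mem (c : Ctx α δ θ B s X D) {b e : V} (hb : b ∈ DeloJ α s J)
    (he : e ∈ DeloJ α s J) (hp : 0 < B b e) (hne : b ≠ e) : b - e ∈ DeloJ α s J := by
  rw [sub_eq_add_neg]
  apply c.add_mem hb (c.neg_mem he)
  · simpa using hp
  · rwa [← sub_eq_add_neg, sub_ne_zero]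

theorem prop (c : Ctx α δ θ B s X D) {b e : V} (hb : b ∈ Delo α s)
    (he : e ∈ Delo α s) {t : ℝ} (ht : b = t • e) : t = 1 ∨ t = -1 := by
  obtain ⟨n, hn⟩ := c.cc_int hb he
  obtain ⟨m, hm⟩ := c.cc_int he hb
  have hep := (c.pos he).ne'
  have ht0 : t ≠ 0 := by rintro rfl; exact c.ne_zero hb (by simpa using ht)
  have hn' : (n : ℝ) = 2 * t := by
    rw [← hn, cc, ht]; simp only [map_smul, LinearMap.smul_apply, smul_eq_mul]; field_simp
  have hm' : (m : ℝ) * t = 2 := by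
    rw [← hm, cc, ht]; simp only [map_smul, LinearMap.smul_apply, smul_eq_mul]; field_simp
  have hnm : n * m = 4 := by
    have : (n : ℝ) * m = 4 := by rw [hn']; linarith
    exact_mod_cast this
  have hdvd : n ∣ 4 := ⟨m, hnm.symm⟩
  have hle : n ≤ 4 := Int.le_of_dvd (by norm_num) hdvd
  have hge : -4 ≤ n := by
    have := Int.le_of_dvd (by norm_num) ((neg_dvd).mpr hdvd)
    linarith
  have ht2 : t = n / 2 := by linarith
  have hred := c.reduced e he
  have hred' := c.reduced (-e) (c.neg_mem he)
  have hredb := c.reduced b hb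
  have hredb' := c.reduced (-b) (c.neg_mem hb)
  interval_cases n
  · exact absurd (by rw [ht, ht2] at hb; convert hb using 1; push_cast; module) hred'
  · omega
  · right; rw [ht2]; norm_num
  · exact absurd (by convert he using 1; rw [ht, ht2]; push_cast; module) hredb'
  · omega
  · exact absurd (by convert he using 1; rw [ht, ht2]; push_cast; module) hredb
  · left; rw [ht2]; norm_num
  · omega
  · exact absurd (by rw [ht, ht2] at hb; convert hb using 1; push_cast; module) hred

end Ctx
namespace Ctx

variable {α : ι → V} {δ θ : V} {B : V →ₗ[ℝ] V →ₗ[ℝ] ℝ} {s : V → V ≃ₗ[ℝ] V}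
  {X : ι → V →ₗ[ℝ] ℝ} {D : V →ₗ[ℝ] ℝ} {J : Set ι}

theorem pos_or (c : Ctx α δ θ B s X D) {v : V} (hv : v ∈ DeloJ α s J) :
    PosoComb α v ∨ PosoComb α (-v) := Xor.or (c.base v (mono hv))

theorem pos_not (c : Ctx α δ θ B s X D) {v : V} (hv : v ∈ DeloJ α s J)
    (h1 : PosoComb α v) (h2 : PosoComb α (-v)) : False := by
  rcases c.base v (mono hv) with ⟨-, h⟩ | ⟨-, h⟩
  · exact h h2
  · exact h h1

theorem al_poso (c : Ctx α δ θ B s X D) (j : ι) : PosoComb α (α j) := by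
  classical
  rw [c.poso_iff (al_mem' j)]
  intro i
  by_cases h : i = j
  · subst h; rw [c.X_self]; norm_num
  · rw [c.X_ne i j h]

theorem poso_add {u v : V} (hu : PosoComb α u) (hv : PosoComb α v) : PosoComb α (u + v) := by
  obtain ⟨a, ha, rfl⟩ := hu
  obtain ⟨b, hb, rfl⟩ := hv
  exact ⟨fun i => a i + b i, fun i => add_nonneg (ha i) (hb i), by
    simp [add_smul, Finset.sum_add_distrib]⟩

/-- The (finite) height. -/
def hgt (X : ι → V →ₗ[ℝ] ℝ) : V →ₗ[ℝ] ℝ := ∑ i, X i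

theorem hgt_al (c : Ctx α δ θ B s X D) (j : ι) : hgt X (α j) = 1 := by
  classical
  rw [hgt, LinearMap.sum_apply, Finset.sum_eq_single j]
  · exact c.X_self j
  · intro i _ hi; exact c.X_ne i j hi
  · simp

theorem hgt_int (c : Ctx α δ θ B s X D) {v : V} (hv : v ∈ DeloJ α s J) :
    ∃ m : ℤ, hgt X v = m := by
  choose f hf using fun i => c.X_int hv i
  refine ⟨∑ i, f i, ?_⟩
  rw [hgt, LinearMap.sum_apply]
  push_cast
  exact Finset.sum_congr rfl fun i _ => hf i

theorem hgt_pos (c : Ctx α δ θ B s X D) {v : V} (hv : v ∈ DeloJ α s J)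
    (hp : PosoComb α v) : 1 ≤ hgt X v := by
  have hX := (c.poso_iff hv).mp hp
  obtain ⟨m, hm⟩ := c.hgt_int hv
  have h0 : 0 < hgt X v := by
    rw [hgt, LinearMap.sum_apply]
    refine lt_of_le_of_ne (Finset.sum_nonneg fun i _ => hX i) fun h0 => ?_
    have h1 := (Finset.sum_eq_zero_iff_of_nonneg fun i _ => hX i).mp h0.symm
    apply c.ne_zero hv
    rw [c.coords hv]
    exact Finset.sum_eq_zero fun i hi => by rw [h1 i hi, zero_smul]
  rw [hm] at h0 ⊢
  have : (0 : ℤ) < m := by exact_mod_cast h0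
  exact_mod_cast this

theorem B_expand (c : Ctx α δ θ B s X D) {v : V} (hv : v ∈ DeloJ α s J) (u : V) :
    B u v = ∑ i, X i v * B u (α i) := by
  conv_lhs => rw [c.coords hv]
  simp

theorem decomp (c : Ctx α δ θ B s X D) {v : V} (hv : v ∈ DeloJ α s J)
    (hp : PosoComb α v) :
    (∃ j ∈ J, v = α j) ∨ ∃ j ∈ J, v - α j ∈ DeloJ α s J ∧ PosoComb α (v - α j) := by
  have hX := (c.poso_iff hv).mp hp
  have h1 := c.pos hv
  rw [c.B_expand hv] at h1
  obtain ⟨j, -, hj⟩ := Finset.exists_lt_of_sum_lt (s := Finset.univ) (f := fun _ => (0 : ℝ))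
    (by simpa using h1)
  have hjJ : j ∈ J := by
    by_contra hjJ
    rw [c.X_supp hv hjJ] at hj; simp at hj
  have hB : 0 < B v (α j) := by
    by_contra hB
    have := mul_nonpos_of_nonneg_of_nonpos (hX j) (not_lt.mp hB)
    linarith
  by_cases hvj : v = α j
  · exact Or.inl ⟨j, hjJ, hvj⟩
  · right
    have hm := c.sub_mem hv (al_mem hjJ) hB hvj
    refine ⟨j, hjJ, hm, ?_⟩
    rcases c.pos_or hm with h2 | h2
    · exact h2
    · exfalso
      have h3 := c.hgt_pos (c.neg_mem hm) h2
      have h4 := c.hgt_pos hv hp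
      rw [map_neg, map_sub, c.hgt_al] at h3
      linarith

theorem pos_induct (c : Ctx α δ θ B s X D) {P : V → Prop}
    (h1 : ∀ j ∈ J, P (α j))
    (h2 : ∀ v ∈ DeloJ α s J, PosoComb α v → ∀ j ∈ J, v + α j ∈ DeloJ α s J → P v →
      P (v + α j)) {v : V} (hv : v ∈ DeloJ α s J) (hp : PosoComb α v) : P v := by
  obtain ⟨m, hm⟩ := c.hgt_int hv
  obtain ⟨n, hn⟩ : ∃ n : ℕ, m ≤ n := ⟨m.toNat, Int.self_le_toNat m⟩
  have hle : hgt X v ≤ n := by rw [hm]; exact_mod_cast hn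
  clear hm hn
  induction n generalizing v with
  | zero => have := c.hgt_pos hv hp; push_cast at hle; linarith
  | succ n ih =>
    rcases c.decomp hv hp with ⟨j, hj, rfl⟩ | ⟨j, hj, hm, hp'⟩
    · exact h1 j hj
    · have := h2 _ hm hp' j hj (by simpa using hv)
        (ih hm hp' (by rw [map_sub, c.hgt_al]; push_cast at hle; linarith))
      simpa using this

theorem pos_closure (c : Ctx α δ θ B s X D) {v : V} (hv : v ∈ DeloJ α s J)
    (hp : PosoComb α v) : v ∈ AddSubmonoid.closure (α '' J) := by
  refine c.pos_induct (P := fun v => v ∈ AddSubmonoid.closure (α '' J)) ?_ ?_ hv hp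
  · intro j hj; exact AddSubmonoid.subset_closure ⟨j, hj, rfl⟩
  · intro v _ _ j hj _ ih
    exact AddSubmonoid.add_mem _ ih (AddSubmonoid.subset_closure ⟨j, hj, rfl⟩)

theorem poso_ne_neg (c : Ctx α δ θ B s X D) {u v : V} (hu : u ∈ DeloJ α s J)
    (hpu : PosoComb α u) (hpv : PosoComb α v) : u + v ≠ 0 := by
  intro h
  have : v = -u := (neg_eq_of_add_eq_zero_right h).symm
  exact c.pos_not hu hpu (this ▸ hpv)

/-- Weakly maximal roots are dominant. -/
theorem high_dom (c : Ctx α δ θ B s X D) {t : V} (ht : t ∈ HighRoots α s J) {j : ι}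
    (hj : j ∈ J) : 0 ≤ B t (α j) := by
  by_contra hneg
  exact ht.2.2 j hj (c.add_mem ht.1 (al_mem hj) (not_le.mp hneg)
    (c.poso_ne_neg ht.1 ht.2.1 (c.al_poso j)))

theorem high_dom' (c : Ctx α δ θ B s X D) {t v : V} (ht : t ∈ HighRoots α s J)
    (hv : v ∈ DeloJ α s J) (hp : PosoComb α v) : 0 ≤ B t v := by
  rw [c.B_expand hv]
  refine Finset.sum_nonneg fun i _ => ?_
  by_cases hi : i ∈ J
  · exact mul_nonneg ((c.poso_iff hv).mp hp i) (c.high_dom ht hi)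
  · rw [c.X_supp hv hi, zero_mul]

theorem high_no_add (c : Ctx α δ θ B s X D) {t v : V} (ht : t ∈ HighRoots α s J)
    (hv : v ∈ DeloJ α s J) (hp : PosoComb α v) : t + v ∉ DeloJ α s J := by
  refine c.pos_induct (P := fun v => t + v ∉ DeloJ α s J) ?_ ?_ hv hp
  · exact fun j hj => ht.2.2 j hj
  · intro v hv hp j hj hvj ih hr
    have hpvj := poso_add hp (c.al_poso j)
    have hρ := c.pos hr
    have h1 : B (t + (v + α j)) (α j) ≤ 0 := by
      by_contra h1
      refine ih ?_
      have := c.sub_mem hr (al_mem hj) (not_le.mp h1) (fun h => ?_)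
      · convert this using 1; abel
      · apply c.poso_ne_neg ht.1 ht.2.1 hp
        have h' : t + v + α j = 0 + α j := by rw [zero_add, add_assoc, h]
        exact add_right_cancel h'
    have h2 : B (t + (v + α j)) v ≤ 0 := by
      by_contra h2
      refine ht.2.2 j hj ?_
      have := c.sub_mem hr hv (not_le.mp h2) (fun h => ?_)
      · convert this using 1; abel
      · apply c.poso_ne_neg ht.1 ht.2.1 (c.al_poso j)
        have h' : t + α j + v = 0 + v := by rw [zero_add, add_assoc, add_comm (α j), h]
        exact add_right_cancel h'
    have h3 := c.high_dom ht hj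
    have h4 := c.high_dom' ht hv hp
    have h5 := c.pos hvj
    simp only [map_add, LinearMap.add_apply] at h1 h2 h5
    linarith

theorem high_exists (c : Ctx α δ θ B s X D) {v : V} (hv : v ∈ DeloJ α s J)
    (hp : PosoComb α v) :
    ∃ t ∈ HighRoots α s J, t - v ∈ AddSubmonoid.closure (α '' J) := by
  obtain ⟨M, hM⟩ := (c.finite.image (hgt X)).bddAbove
  obtain ⟨n, hn⟩ := exists_nat_gt (M - hgt X v)
  induction n generalizing v with
  | zero =>
    have := hM ⟨v, mono hv, rfl⟩
    push_cast at hn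
    linarith
  | succ n ih =>
    by_cases h : ∃ j ∈ J, v + α j ∈ DeloJ α s J
    · obtain ⟨j, hj, hvj⟩ := h
      obtain ⟨t, ht, h2⟩ := ih hvj (poso_add hp (c.al_poso j)) (by
        rw [map_add, c.hgt_al]; push_cast at hn; linarith)
      refine ⟨t, ht, ?_⟩
      have : t - v = (t - (v + α j)) + α j := by abel
      rw [this]
      exact AddSubmonoid.add_mem _ h2 (AddSubmonoid.subset_closure ⟨j, hj, rfl⟩)
    · push Not at h
      exact ⟨v, ⟨hv, hp, h⟩, by simp⟩

/-- Cartan numbers against a highest root. -/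
theorem high_cc (c : Ctx α δ θ B s X D) {t v : V} (ht : t ∈ HighRoots α s J)
    (hv : v ∈ DeloJ α s J) (hp : PosoComb α v) (hne : v ≠ t) :
    cc B v t = 0 ∨ cc B v t = 1 := by
  obtain ⟨k, hk⟩ := c.cc_int (mono hv) (mono ht.1)
  have htp := c.pos ht.1
  have h0 : 0 ≤ cc B v t := by
    rw [cc, c.Bsymm]
    have := c.high_dom' ht hv hp
    positivity
  rw [hk] at h0 ⊢
  have h0' : 0 ≤ k := by exact_mod_cast h0
  rcases Nat.eq_zero_or_pos k.toNat with hk0 | hk0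
  · left; have : k = 0 := by omega
    exact_mod_cast this
  · right
    have hk1 : (0 : ℝ) < k := by
      have : 0 < k := by omega
      exact_mod_cast this
    have hB : 0 < B t v := by
      rw [← hk, cc] at hk1
      have h1 : 0 < 2 * B v t := by
        by_contra hc
        have := div_nonpos_of_nonpos_of_nonneg (not_lt.mp hc) htp.le
        linarith
      rw [c.Bsymm]; linarith
    have hm := c.sub_mem ht.1 hv hB hne.symm
    have hmp : PosoComb α (t - v) := by
      rcases c.pos_or hm with h | h
      · exact h
      · exfalso
        apply c.high_no_add ht (c.neg_mem hm) h
        convert hv using 1; abel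
    have hd := c.high_dom' ht hm hmp
    have hcc : (k : ℝ) * B t t = 2 * B t v := by
      rw [← hk, cc, c.Bsymm v t]; field_simp
    rw [map_sub] at hd
    have hk2 : (k : ℝ) ≤ 2 := by
      by_contra hc
      have := mul_lt_mul_of_pos_right (not_le.mp hc) htp
      linarith
    have hk2' : k ≤ 2 := by exact_mod_cast hk2
    have hkne : k ≠ 2 := by
      rintro rfl
      push_cast at hcc
      have hB0 : B t (t - v) = 0 := by rw [map_sub]; linarith
      have hr := c.refl_mem hm hv
      have hmp' := c.pos hm
      have hcv : cc B v (t - v) = -2 := by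
        have h1 : B v (t - v) = - B (t - v) (t - v) := by
          have h2 : B (t - v) (t - v) = B t (t - v) - B v (t - v) := by
            rw [map_sub B t v, LinearMap.sub_apply]
          linarith
        rw [cc, h1]; field_simp
      rw [c.refl hmp'.ne', hcv] at hr
      refine c.high_no_add ht hm hmp ?_
      convert hr using 1
      module
    have : k = 1 := by omega
    exact_mod_cast this

/-- Full support of the weakly maximal roots of the whole system. -/
theorem high_full (c : Ctx α δ θ B s X D) {t : V} (ht : t ∈ HighRoots α s Set.univ) (i : ι) :
    0 < X i t := by
  have hX := (c.poso_iff ht.1).mp ht.2.1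
  let A : Set ι := {i | X i t = 0}
  have hA : ∀ i ∈ A, ∀ j ∈ Aᶜ, s (α i) (α j) = α j := by
    intro i hi j hj
    have hle : ∀ k, k ≠ i → B (α i) (α k) ≤ 0 := by
      intro k hk
      by_contra hc
      have hne : α i ≠ α k := by
        intro h
        have h1 := c.X_self i
        rw [h, c.X_ne i k hk.symm] at h1
        norm_num at h1
      have hm := c.sub_mem (al_mem' i) (al_mem' k) (not_le.mp hc) hne
      rcases c.pos_or hm with h | h
      · have := (c.poso_iff hm).mp h k
        rw [map_sub, c.X_self, c.X_ne k i hk] at this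
        norm_num at this
      · have := (c.poso_iff (c.neg_mem hm)).mp h i
        rw [map_neg, map_sub, c.X_self, c.X_ne i k hk.symm] at this
        norm_num at this
    have hd := c.high_dom ht (Set.mem_univ i)
    rw [c.Bsymm, c.B_expand ht.1] at hd
    have hterm : ∀ k ∈ Finset.univ, X k t * B (α i) (α k) ≤ 0 := by
      intro k _
      by_cases hk : k = i
      · have : X i t = 0 := hi
        rw [hk, this, zero_mul]
      · exact mul_nonpos_of_nonneg_of_nonpos (hX k) (hle k hk)
    have hz := (Finset.sum_eq_zero_iff_of_nonpos hterm).mp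
      (le_antisymm (Finset.sum_nonpos hterm) hd) j (Finset.mem_univ j)
    have hB0 : B (α i) (α j) = 0 := by
      rcases mul_eq_zero.mp hz with h | h
      · exact absurd h hj
      · exact h
    rw [c.refl (c.al_ne i), cc, c.Bsymm, hB0]; simp
  rcases c.irred A hA with h | h
  · have hi : i ∉ A := by rw [h]; exact Set.notMem_empty i
    exact lt_of_le_of_ne (hX i) (fun h0 => hi h0.symm)
  · exfalso
    apply c.ne_zero ht.1
    rw [c.coords ht.1]
    refine Finset.sum_eq_zero fun k _ => ?_
    have : k ∈ A := by rw [h]; trivial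
    have : X k t = 0 := this
    rw [this, zero_smul]

theorem high_unique (c : Ctx α δ θ B s X D) {t u : V} (ht : t ∈ HighRoots α s Set.univ)
    (hu : u ∈ HighRoots α s Set.univ) : t = u := by
  by_contra hne
  have hB : 0 < B t u := by
    have h1 := c.pos ht.1
    rw [c.B_expand ht.1] at h1
    obtain ⟨j, -, hj⟩ := Finset.exists_lt_of_sum_lt (s := Finset.univ) (f := fun _ => (0 : ℝ))
      (by simpa using h1)
    have hj' : 0 < B t (α j) := by
      rcases (c.high_dom ht (Set.mem_univ j)).lt_or_eq with h | h
      · exact h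
      · rw [← h] at hj; simp at hj
    rw [c.B_expand hu.1]
    refine Finset.sum_pos' (fun i _ => mul_nonneg (c.high_full hu i).le
      (c.high_dom ht (Set.mem_univ i))) ⟨j, Finset.mem_univ j, mul_pos (c.high_full hu j) hj'⟩
  have hm := c.sub_mem ht.1 hu.1 hB hne
  rcases c.pos_or hm with h | h
  · apply c.high_no_add hu hm h
    convert ht.1 using 1; abel
  · apply c.high_no_add ht (c.neg_mem hm) h
    convert hu.1 using 1; abel

theorem X_closure (c : Ctx α δ θ B s X D) {v : V}
    (hv : v ∈ AddSubmonoid.closure (α '' J)) (i : ι) : 0 ≤ X i v := by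
  induction hv using AddSubmonoid.closure_induction with
  | mem x hx =>
    obtain ⟨j, -, rfl⟩ := hx
    exact (c.poso_iff (al_mem' j)).mp (c.al_poso j) i
  | zero => simp
  | add x y _ _ hx hy => rw [map_add]; exact add_nonneg hx hy

/-- `θ` dominates all roots. -/
theorem theta_ge (c : Ctx α δ θ B s X D) {v : V} (hv : v ∈ DeloJ α s J) (i : ι) :
    X i v ≤ X i θ := by
  rcases c.pos_or hv with hp | hp
  · obtain ⟨t, ht, h⟩ := c.high_exists (mono hv) hp
    rw [c.high_unique ht c.theta_high] at h
    have := c.X_closure h i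
    rw [map_sub] at this; linarith
  · have h1 := (c.poso_iff (c.neg_mem hv)).mp hp i
    have h2 := (c.high_full c.theta_high i)
    rw [map_neg] at h1; linarith

end Ctx
/-! ### The affine root system -/

theorem SpanPosSet.add {P : Set V} {u v : V} (hu : SpanPosSet P u) (hv : SpanPosSet P v) :
    SpanPosSet P (u + v) := by
  classical
  obtain ⟨a, ha, ha0, rfl⟩ := hu
  obtain ⟨b, hb, hb0, rfl⟩ := hv
  refine ⟨a + b, ?_, fun x => add_nonneg (ha0 x) (hb0 x), ?_⟩
  · intro x hx
    rcases Finset.mem_union.mp (Finsupp.support_add hx) with h | h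
    · exact ha h
    · exact hb h
  · rw [Finsupp.sum_add_index']
    · intro x; simp
    · intro x r r'; rw [add_smul]

theorem SpanPosSet.of_closure {P : Set V} {v : V} (hv : v ∈ AddSubmonoid.closure P) :
    SpanPosSet P v := by
  classical
  induction hv using AddSubmonoid.closure_induction with
  | mem x hx =>
    refine ⟨Finsupp.single x 1, ?_, ?_, ?_⟩
    · intro y hy
      have := Finsupp.support_single_subset hy
      rw [Finset.mem_singleton] at this
      exact this ▸ hx
    · intro y; rw [Finsupp.single_apply]; split_ifs <;> norm_num
    · rw [Finsupp.sum_single_index] <;> simp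
  | zero => exact ⟨0, by simp, by simp, by simp⟩
  | add x y _ _ hx hy => exact hx.add hy

theorem SpanPosSet.mem_span {P : Set V} {v : V} (hv : SpanPosSet P v) :
    v ∈ Submodule.span ℝ P := by
  obtain ⟨a, ha, -, rfl⟩ := hv
  exact Submodule.sum_mem _ fun x hx =>
    Submodule.smul_mem _ _ (Submodule.subset_span (ha hx))

theorem PosComb.add {α : ι → V} {δ θ u v : V} (hu : PosComb α δ θ u) (hv : PosComb α δ θ v) :
    PosComb α δ θ (u + v) := by
  obtain ⟨a, ha, rfl⟩ := hu
  obtain ⟨b, hb, rfl⟩ := hv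
  exact ⟨fun i => a i + b i, fun i => add_nonneg (ha i) (hb i), by
    simp only [add_smul, Finset.sum_add_distrib]⟩

theorem PosComb.smul {α : ι → V} {δ θ u : V} (hu : PosComb α δ θ u) {r : ℝ} (hr : 0 ≤ r) :
    PosComb α δ θ (r • u) := by
  obtain ⟨a, ha, rfl⟩ := hu
  exact ⟨fun i => r * a i, fun i => mul_nonneg hr (ha i), by
    simp only [mul_smul, Finset.smul_sum]⟩

theorem PosComb.zero {α : ι → V} {δ θ : V} : PosComb α δ θ 0 :=
  ⟨0, fun _ => le_rfl, by simp⟩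

theorem SpanPosSet.posComb {α : ι → V} {δ θ : V} {P : Set V} (hP : ∀ x ∈ P, PosComb α δ θ x)
    {v : V} (hv : SpanPosSet P v) : PosComb α δ θ v := by
  obtain ⟨a, ha, ha0, rfl⟩ := hv
  exact Finset.sum_induction _ (PosComb α δ θ) (fun _ _ => PosComb.add) PosComb.zero
    fun x hx => (hP x (ha hx)).smul (ha0 x)

namespace Ctx

variable {α : ι → V} {δ θ : V} {B : V →ₗ[ℝ] V →ₗ[ℝ] ℝ} {s : V → V ≃ₗ[ℝ] V}
  {X : ι → V →ₗ[ℝ] ℝ} {D : V →ₗ[ℝ] ℝ} {J : Set ι}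

theorem theta_mem (c : Ctx α δ θ B s X D) : θ ∈ Delo α s := c.theta_high.1

theorem posComb_coord (c : Ctx α δ θ B s X D) {v : V} (hv : PosComb α δ θ v) :
    0 ≤ D v ∧ (∀ i, 0 ≤ X i v + D v * X i θ) ∧ v = D v • δ + ∑ i, X i v • α i := by
  obtain ⟨k, hk, rfl⟩ := hv
  have hD : D (∑ o, k o • alHat α δ θ o) = k none := by
    simp [Fintype.sum_option, alHat, c.D_al, c.D_delta, c.D_zero c.theta_mem]
  have hX : ∀ i, X i (∑ o, k o • alHat α δ θ o) = k (some i) - k none * X i θ := by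
    intro i
    simp only [Fintype.sum_option, alHat, Option.elim, map_add, c.sum_X]
    simp [c.X_delta]; ring
  refine ⟨hD ▸ hk none, fun i => ?_, ?_⟩
  · rw [hX, hD]; have := hk (some i); linarith
  · simp_rw [hD, hX]
    rw [Fintype.sum_option]
    simp only [alHat, Option.elim, sub_smul, Finset.sum_sub_distrib, mul_smul]
    rw [← Finset.smul_sum, ← c.coords c.theta_mem]
    module

theorem posComb_of (c : Ctx α δ θ B s X D) {v : V} (h1 : 0 ≤ D v)
    (h2 : ∀ i, 0 ≤ X i v + D v * X i θ) (h3 : v = D v • δ + ∑ i, X i v • α i) :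
    PosComb α δ θ v := by
  refine ⟨fun o => o.elim (D v) (fun i => X i v + D v * X i θ), ?_, ?_⟩
  · rintro (_ | i)
    · exact h1
    · exact h2 i
  · rw [Fintype.sum_option]
    simp only [alHat, Option.elim, add_smul, Finset.sum_add_distrib, mul_smul]
    rw [← Finset.smul_sum, ← c.coords c.theta_mem]
    conv_lhs => rw [h3]
    module

theorem posComb_not (c : Ctx α δ θ B s X D) {v : V} (h1 : PosComb α δ θ v)
    (h2 : PosComb α δ θ (-v)) : v = 0 := by
  obtain ⟨a1, a2, a3⟩ := c.posComb_coord h1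
  obtain ⟨b1, b2, -⟩ := c.posComb_coord h2
  rw [map_neg] at b1
  have hD : D v = 0 := by linarith
  have hX : ∀ i, X i v = 0 := by
    intro i
    have h3 := a2 i
    have h4 := b2 i
    rw [map_neg, map_neg, hD] at h4
    rw [hD] at h3
    linarith
  rw [a3, hD]
  simp [hX]

theorem D_re (c : Ctx α δ θ B s X D) {e : V} (he : e ∈ DeloJ α s J) (m : ℤ) :
    D (m • δ + e) = m := by
  rw [map_add, map_zsmul, c.D_delta, c.D_zero he]; simp

theorem X_re (c : Ctx α δ θ B s X D) (e : V) (m : ℤ) (i : ι) :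
    X i (m • δ + e) = X i e := by
  rw [map_add, map_zsmul, c.X_delta]; simp

theorem re_pos_iff (c : Ctx α δ θ B s X D) {e : V} (he : e ∈ DeloJ α s J) (m : ℤ) :
    PosComb α δ θ (m • δ + e) ↔ 1 ≤ m ∨ (m = 0 ∧ PosoComb α e) := by
  have hθ := fun i => (c.high_full c.theta_high i).le
  constructor
  · intro h
    obtain ⟨a1, a2, -⟩ := c.posComb_coord h
    rw [c.D_re he] at a1
    have hm : 0 ≤ m := by exact_mod_cast a1
    rcases hm.lt_or_eq with h0 | h0
    · left; omega
    · right
      refine ⟨h0.symm, (c.poso_iff he).mpr fun i => ?_⟩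
      have := a2 i
      rw [c.D_re he, c.X_re, ← h0] at this
      simpa using this
  · intro h
    have h3 : m • δ + e = D (m • δ + e) • δ + ∑ i, X i (m • δ + e) • α i := by
      simp_rw [c.D_re he, c.X_re]
      rw [← c.coords he, Int.cast_smul_eq_zsmul]
    refine c.posComb_of ?_ ?_ h3
    · rw [c.D_re he]
      have : 0 ≤ m := by omega
      exact_mod_cast this
    · intro i
      rw [c.D_re he, c.X_re]
      rcases h with h | ⟨rfl, h⟩
      · have h1 := c.theta_ge (c.neg_mem he) i
        rw [map_neg] at h1
        have h2 : (1 : ℝ) ≤ m := by exact_mod_cast h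
        nlinarith [hθ i]
      · simpa using (c.poso_iff he).mp h i

theorem im_pos_iff (c : Ctx α δ θ B s X D) (m : ℤ) :
    PosComb α δ θ (m • δ) ↔ 0 ≤ m := by
  have hθ := fun i => (c.high_full c.theta_high i).le
  have hD : D (m • δ) = m := by rw [map_zsmul, c.D_delta]; simp
  have hX : ∀ i, X i (m • δ) = 0 := fun i => by rw [map_zsmul, c.X_delta]; simp
  constructor
  · intro h
    obtain ⟨a1, -, -⟩ := c.posComb_coord h
    rw [hD] at a1
    exact_mod_cast a1
  · intro h
    have h' : (0 : ℝ) ≤ m := by exact_mod_cast h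
    refine c.posComb_of (by rwa [hD]) (fun i => ?_) ?_
    · rw [hD, hX, zero_add]; exact mul_nonneg h' (hθ i)
    · simp_rw [hD, hX]; simp [Int.cast_smul_eq_zsmul]

theorem delta_ne (c : Ctx α δ θ B s X D) : δ ≠ 0 := by
  intro h; have := c.D_delta; rw [h] at this; simp at this

theorem DelJ_ne (c : Ctx α δ θ B s X D) {v : V} (hv : v ∈ DelJ α δ s J) : v ≠ 0 := by
  rintro rfl
  rcases hv with ⟨m, e, he, h⟩ | ⟨m, hm, h⟩
  · apply c.ne_zero he
    rw [c.coords he]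
    refine Finset.sum_eq_zero fun i _ => ?_
    rw [← c.X_re e m i, ← h]; simp
  · have := congrArg D h
    rw [map_zsmul, c.D_delta] at this
    simp at this
    exact hm (by exact_mod_cast this.symm)

theorem DelJ_neg (c : Ctx α δ θ B s X D) {v : V} (hv : v ∈ DelJ α δ s J) :
    -v ∈ DelJ α δ s J := by
  rcases hv with ⟨m, e, he, rfl⟩ | ⟨m, hm, rfl⟩
  · exact Or.inl ⟨-m, -e, c.neg_mem he, by rw [neg_smul]; abel⟩
  · exact Or.inr ⟨-m, neg_ne_zero.mpr hm, by rw [neg_smul]⟩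

theorem DelJ_or (c : Ctx α δ θ B s X D) {v : V} (hv : v ∈ DelJ α δ s J) :
    PosComb α δ θ v ∨ PosComb α δ θ (-v) := by
  rcases hv with ⟨m, e, he, rfl⟩ | ⟨m, hm, rfl⟩
  · have h1 : -(m • δ + e) = (-m) • δ + (-e) := by rw [neg_smul]; abel
    rw [h1, c.re_pos_iff he, c.re_pos_iff (c.neg_mem he)]
    rcases lt_trichotomy m 0 with h | h | h
    · right; left; omega
    · rcases c.pos_or he with h2 | h2
      · exact Or.inl (Or.inr ⟨h, h2⟩)
      · exact Or.inr (Or.inr ⟨by omega, h2⟩)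
    · left; left; omega
  · rw [← neg_smul, c.im_pos_iff, c.im_pos_iff]; omega

theorem DelJ_sub (v : V) (hv : v ∈ DelJ α δ s J) : v ∈ Del α δ s := by
  rcases hv with ⟨m, e, he, rfl⟩ | h
  · exact Or.inl ⟨m, e, mono he, rfl⟩
  · exact Or.inr h

theorem mem_DelJPos {v : V} :
    v ∈ DelJPos α δ θ s J ↔ v ∈ DelJ α δ s J ∧ PosComb α δ θ v :=
  ⟨fun h => ⟨h.1, h.2.2⟩, fun h => ⟨h.1, DelJ_sub v h.1, h.2⟩⟩

theorem B_re (c : Ctx α δ θ B s X D) {e f : V} (he : e ∈ Delo α s) (hf : f ∈ Delo α s)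
    (m n : ℤ) : B (m • δ + e) (n • δ + f) = B e f := by
  have h1 := c.B_delta hf
  have h2 := c.B_delta he
  rw [c.Bsymm] at h2
  simp only [map_add, map_zsmul, LinearMap.add_apply, LinearMap.smul_apply, h1, h2,
    c.delta_null]
  simp

theorem B_re_ne (c : Ctx α δ θ B s X D) {e : V} (he : e ∈ Delo α s) (m : ℤ) :
    B (m • δ + e) (m • δ + e) ≠ 0 := by
  rw [c.B_re he he]; exact (c.pos he).ne'

theorem refl_re (c : Ctx α δ θ B s X D) {e f : V} (he : e ∈ Delo α s) (hf : f ∈ Delo α s)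
    (m n k : ℤ) (hk : cc B e f = k) :
    s (n • δ + f) (m • δ + e) = (m - k * n) • δ + s f e := by
  rw [c.refl (c.B_re_ne hf n), c.refl (c.pos hf).ne']
  have : cc B (m • δ + e) (n • δ + f) = cc B e f := by
    rw [cc, cc, c.B_re he hf, c.B_re hf hf]
  rw [this, hk, sub_smul, mul_smul, Int.cast_smul_eq_zsmul, Int.cast_smul_eq_zsmul, smul_add]
  abel

theorem refl_im (c : Ctx α δ θ B s X D) {f : V} (hf : f ∈ Delo α s) (m n : ℤ) :
    s (n • δ + f) (m • δ) = m • δ := by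
  rw [c.refl (c.B_re_ne hf n), cc]
  have : B (m • δ) (n • δ + f) = 0 := by
    simp [c.B_delta hf, c.delta_null]
  rw [this]; simp

theorem refl_DelJ (c : Ctx α δ θ B s X D) {a v : V} (ha : a ∈ DelReJ α δ s J)
    (hv : v ∈ DelJ α δ s J) : s a v ∈ DelJ α δ s J := by
  obtain ⟨n, f, hf, rfl⟩ := ha
  rcases hv with ⟨m, e, he, rfl⟩ | ⟨m, hm, rfl⟩
  · obtain ⟨k, hk⟩ := c.cc_int (mono he) (mono hf)
    rw [c.refl_re (mono he) (mono hf) m n k hk]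
    exact Or.inl ⟨_, _, c.refl_mem hf he, rfl⟩
  · rw [c.refl_im (mono hf)]
    exact Or.inr ⟨m, hm, rfl⟩

theorem PiJ_re (c : Ctx α δ θ B s X D) {a : V} (ha : a ∈ PiJ α δ s J) :
    a ∈ DelReJ α δ s J := by
  rcases ha with ⟨j, hj, rfl⟩ | ⟨t, ht, rfl⟩
  · exact ⟨0, α j, al_mem hj, by simp⟩
  · exact ⟨1, -t, c.neg_mem ht.1, by simp [sub_eq_add_neg]⟩

theorem PiJ_ne (c : Ctx α δ θ B s X D) {a : V} (ha : a ∈ PiJ α δ s J) : B a a ≠ 0 := by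
  obtain ⟨m, e, he, rfl⟩ := c.PiJ_re ha
  exact c.B_re_ne (mono he) m

theorem PiJ_pos (c : Ctx α δ θ B s X D) {a : V} (ha : a ∈ PiJ α δ s J) :
    PosComb α δ θ a := by
  rcases ha with ⟨j, hj, rfl⟩ | ⟨t, ht, rfl⟩
  · have := (c.re_pos_iff (al_mem hj) 0).mpr (Or.inr ⟨rfl, c.al_poso j⟩)
    simpa using this
  · have := (c.re_pos_iff (c.neg_mem ht.1) 1).mpr (Or.inl le_rfl)
    simpa [sub_eq_add_neg] using this

theorem WJ_form (c : Ctx α δ θ B s X D) {g : V ≃ₗ[ℝ] V} (hg : g ∈ WJ α δ s J) (u v : V) :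
    B (g u) (g v) = B u v := by
  refine closure_form ?_ g hg u v
  rintro _ ⟨a, ha, rfl⟩ u v
  exact c.refl_form (c.PiJ_ne ha) u v

theorem WJ_DelJ (c : Ctx α δ θ B s X D) {g : V ≃ₗ[ℝ] V} (hg : g ∈ WJ α δ s J) {v : V}
    (hv : v ∈ DelJ α δ s J) : g v ∈ DelJ α δ s J := by
  refine closure_pres (P := fun v => v ∈ DelJ α δ s J) ?_ ?_ g hg v hv
  · rintro _ ⟨a, ha, rfl⟩; exact c.refl_invol (c.PiJ_ne ha)
  · rintro _ ⟨a, ha, rfl⟩ v hv; exact c.refl_DelJ (c.PiJ_re ha) hv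

/-- A simple reflection of the finite system permutes the other positive roots. -/
theorem simple_pos (c : Ctx α δ θ B s X D) {j : ι} {v : V} (hj : j ∈ J)
    (hv : v ∈ DeloJ α s J) (hp : PosoComb α v) (hne : v ≠ α j) : PosoComb α (s (α j) v) := by
  have hr := c.refl_mem (al_mem hj) hv
  rcases c.pos_or hr with h | h
  · exact h
  exfalso
  have hX := (c.poso_iff hv).mp hp
  have hX' := (c.poso_iff (c.neg_mem hr)).mp h
  have h0 : ∀ i, i ≠ j → X i v = 0 := by
    intro i hij
    have h1 := hX' i
    rw [c.refl (c.al_ne j), map_neg, map_sub, map_smul, c.X_ne i j hij, smul_zero,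
      sub_zero] at h1
    have := hX i
    linarith
  have hvt : v = X j v • α j := by
    conv_lhs => rw [c.coords hv]
    rw [Finset.sum_eq_single j]
    · intro i _ hi; rw [h0 i hi, zero_smul]
    · simp
  rcases c.prop (mono hv) (al_mem' j) hvt with h1 | h1
  · rw [h1, one_smul] at hvt; exact hne hvt
  · have := hX j; linarith

theorem Pi_perm (c : Ctx α δ θ B s X D) {a v : V} (ha : a ∈ PiJ α δ s J)
    (hv : v ∈ DelJ α δ s J) (hp : PosComb α δ θ v) (hne : v ≠ a) :
    PosComb α δ θ (s a v) := by
  rcases ha with ⟨j, hj, rfl⟩ | ⟨t, ht, rfl⟩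
  · have ha0 : α j = (0 : ℤ) • δ + α j := by simp
    rcases hv with ⟨m, e, he, rfl⟩ | ⟨m, hm, rfl⟩
    · obtain ⟨k, hk⟩ := c.cc_int (mono he) (al_mem' j)
      have h1 := c.refl_re (mono he) (al_mem' j) m 0 k hk
      rw [← ha0, mul_zero, sub_zero] at h1
      rw [h1, c.re_pos_iff (c.refl_mem (al_mem hj) he)]
      rcases (c.re_pos_iff he m).mp hp with h | ⟨rfl, h⟩
      · exact Or.inl h
      · refine Or.inr ⟨rfl, c.simple_pos hj he h ?_⟩
        rintro rfl
        exact hne (by simp)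
    · have h1 := c.refl_im (al_mem' j) m 0
      rw [← ha0] at h1
      rwa [h1]
  · have ha0 : δ - t = (1 : ℤ) • δ + (-t) := by simp [sub_eq_add_neg]
    have hnt := c.neg_mem ht.1
    change PosComb α δ θ (s (δ - t) v)
    change v ≠ δ - t at hne
    rcases hv with ⟨m, e, he, rfl⟩ | ⟨m, hm, rfl⟩
    · obtain ⟨k, hk⟩ := c.cc_int (mono he) (mono hnt)
      rw [ha0, c.refl_re (mono he) (mono hnt) m 1 k hk, mul_one,
        c.re_pos_iff (c.refl_mem hnt he)]
      have hcc : cc B e t = -k := by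
        rw [← hk, cc, cc]; simp [neg_div]
      have hre : s (-t) e = e + (k : ℝ) • t := by
        rw [c.refl (c.pos hnt).ne', hk]; simp
      rw [hre]
      have hm := (c.re_pos_iff he m).mp hp
      by_cases het : e = t
      · rw [het, c.cc_self ht.1] at hcc
        have : k = -2 := by
          have : (k : ℝ) = -2 := by linarith
          exact_mod_cast this
        left; omega
      by_cases hent : e = -t
      · have hcc' : cc B e t = -2 := by
          rw [hent]
          have := c.cc_self ht.1
          rw [cc] at this ⊢
          rw [map_neg, LinearMap.neg_apply, mul_neg, neg_div, this]
        have hk2 : k = 2 := by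
          have : (k : ℝ) = 2 := by linarith
          exact_mod_cast this
        subst hk2
        rcases hm with h | ⟨-, h⟩
        · have hm1 : m ≠ 1 := by
            rintro rfl
            exact hne (by rw [hent, ← ha0])
          rcases (show m = 2 ∨ 3 ≤ m by omega) with rfl | h3
          · right
            refine ⟨by norm_num, ?_⟩
            rw [hent]
            have : -t + ((2 : ℤ) : ℝ) • t = t := by push_cast; module
            rw [this]; exact ht.2.1
          · left; omega
        · exact absurd h (fun h => c.pos_not ht.1 ht.2.1 (hent ▸ h))
      rcases c.pos_or he with hpe | hpe
      · rcases c.high_cc ht he hpe het with h0 | h0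
        · have hk0 : k = 0 := by
            have : (k : ℝ) = 0 := by linarith
            exact_mod_cast this
          subst hk0
          simpa using hm
        · have hk0 : k = -1 := by
            have : (k : ℝ) = -1 := by linarith
            exact_mod_cast this
          left; omega
      · have hm1 : 1 ≤ m := by
          rcases hm with h | ⟨-, h⟩
          · exact h
          · exact absurd hpe (fun h' => c.pos_not he h h')
        have hcn : cc B (-e) t = k := by
          have : cc B (-e) t = - cc B e t := by rw [cc, cc]; simp [neg_div]
          rw [this, hcc]; simp
        rcases c.high_cc ht (c.neg_mem he) hpe (fun h => hent (by rw [← h, neg_neg]))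
          with h0 | h0
        · have hk0 : k = 0 := by
            have : (k : ℝ) = 0 := by linarith
            exact_mod_cast this
          subst hk0
          simpa using hm
        · have hk0 : k = 1 := by
            have : (k : ℝ) = 1 := by linarith
            exact_mod_cast this
          subst hk0
          rcases (show m = 1 ∨ 2 ≤ m by omega) with rfl | h3
          · right
            refine ⟨by norm_num, ?_⟩
            have hr := c.refl_mem hnt he
            rw [hre] at hr
            rcases c.pos_or hr with h | h
            · exact h
            · exfalso
              apply c.high_no_add ht (c.neg_mem hr) h
              convert c.neg_mem he using 1
              push_cast; module
          · left; omega
    · have h1 := c.refl_im (mono hnt) m 1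
      rw [← ha0] at h1
      rwa [h1]

end Ctx

namespace Ctx

variable {α : ι → V} {δ θ : V} {B : V →ₗ[ℝ] V →ₗ[ℝ] ℝ} {s : V → V ≃ₗ[ℝ] V}
  {X : ι → V →ₗ[ℝ] ℝ} {D : V →ₗ[ℝ] ℝ} {J : Set ι}

theorem cl_sub {v : V} (hv : v ∈ AddSubmonoid.closure (α '' J)) :
    v ∈ AddSubmonoid.closure (PiJ α δ s J) :=
  AddSubmonoid.closure_mono Set.subset_union_left hv

theorem cl_high {t : V} (ht : t ∈ HighRoots α s J) :
    δ - t ∈ AddSubmonoid.closure (PiJ α δ s J) :=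
  AddSubmonoid.subset_closure (Or.inr ⟨t, ht, rfl⟩)

theorem cl_delta (c : Ctx α δ θ B s X D) (hJ : J.Nonempty) :
    δ ∈ AddSubmonoid.closure (PiJ α δ s J) := by
  obtain ⟨j, hj⟩ := hJ
  obtain ⟨t, ht, -⟩ := c.high_exists (al_mem hj) (c.al_poso j)
  have := AddSubmonoid.add_mem _ (cl_high (δ := δ) ht)
    (cl_sub (δ := δ) (s := s) (c.pos_closure ht.1 ht.2.1))
  simpa using this

theorem cl_smul (c : Ctx α δ θ B s X D) (hJ : J.Nonempty) {m : ℤ} (hm : 0 ≤ m) :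
    m • δ ∈ AddSubmonoid.closure (PiJ α δ s J) := by
  obtain ⟨n, rfl⟩ := Int.eq_ofNat_of_zero_le hm
  have := AddSubmonoid.nsmul_mem _ (c.cl_delta hJ) n
  simpa using this

/-- Positive roots of `Δ_J` are sums of elements of `Π_J`. -/
theorem pos_cl (c : Ctx α δ θ B s X D) (hJ : J.Nonempty) {v : V} (hv : v ∈ DelJ α δ s J)
    (hp : PosComb α δ θ v) : v ∈ AddSubmonoid.closure (PiJ α δ s J) := by
  rcases hv with ⟨m, e, he, rfl⟩ | ⟨m, hm, rfl⟩
  · rcases c.pos_or he with h | h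
    · have hm : 0 ≤ m := by
        rcases (c.re_pos_iff he m).mp hp with h | h <;> omega
      exact AddSubmonoid.add_mem _ (c.cl_smul hJ hm) (cl_sub (c.pos_closure he h))
    · have hm : 1 ≤ m := by
        rcases (c.re_pos_iff he m).mp hp with h' | h'
        · exact h'
        · exact (c.pos_not he h'.2 h).elim
      obtain ⟨t, ht, htc⟩ := c.high_exists (c.neg_mem he) h
      have h1 := AddSubmonoid.add_mem _ (AddSubmonoid.add_mem _
        (c.cl_smul hJ (m := m - 1) (by omega)) (cl_high (δ := δ) ht)) (cl_sub (δ := δ) (s := s) htc)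
      have h2 : m • δ + e = (m - 1) • δ + (δ - t) + (t - -e) := by
        rw [sub_smul, one_smul]; abel
      rw [h2]; exact h1
  · exact c.cl_smul hJ ((c.im_pos_iff m).mp hp)

theorem not_both (c : Ctx α δ θ B s X D) {v : V} (hv : v ∈ DelJ α δ s J)
    (h1 : PosComb α δ θ v) (h2 : PosComb α δ θ (-v)) : False :=
  c.DelJ_ne hv (c.posComb_not h1 h2)

theorem span_xor (c : Ctx α δ θ B s X D) (hJ : J.Nonempty) {v : V} (hv : v ∈ DelJ α δ s J) :
    (SpanPosSet (PiJ α δ s J) v ∧ ¬ SpanPosSet (PiJ α δ s J) (-v)) ∨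
    (SpanPosSet (PiJ α δ s J) (-v) ∧ ¬ SpanPosSet (PiJ α δ s J) v) := by
  have hP : ∀ x ∈ PiJ α δ s J, PosComb α δ θ x := fun x hx => c.PiJ_pos hx
  rcases c.DelJ_or hv with h | h
  · exact Or.inl ⟨.of_closure (c.pos_cl hJ hv h), fun h' => c.not_both hv h (h'.posComb hP)⟩
  · exact Or.inr ⟨.of_closure (c.pos_cl hJ (c.DelJ_neg hv) h),
      fun h' => c.not_both hv (h'.posComb hP) h⟩

theorem PiJ_DelJ (c : Ctx α δ θ B s X D) {a : V} (ha : a ∈ PiJ α δ s J) :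
    a ∈ DelJ α δ s J := Or.inl (c.PiJ_re ha)

theorem refl_two (c : Ctx α δ θ B s X D) {a : V} (ha : a ∈ PiJ α δ s J) (v : V) :
    s a (s a v) = v := by
  rw [← LinearEquiv.mul_apply, c.refl_invol (c.PiJ_ne ha)]; rfl

theorem Pi_perm_ne (c : Ctx α δ θ B s X D) {a v : V} (ha : a ∈ PiJ α δ s J)
    (hp : PosComb α δ θ v) : s a v ≠ a := by
  intro h
  have h1 : v = -a := by rw [← c.refl_self (c.PiJ_ne ha), ← c.refl_two ha v, h]
  rw [h1] at hp
  exact c.not_both (c.PiJ_DelJ ha) (c.PiJ_pos ha) hp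

theorem Pi_maps (c : Ctx α δ θ B s X D) {a v : V} (ha : a ∈ PiJ α δ s J)
    (hv : v ∈ DelJPos α δ θ s J \ {a}) : s a v ∈ DelJPos α δ θ s J \ {a} := by
  obtain ⟨h1, h2⟩ := hv
  rw [mem_DelJPos] at h1
  exact ⟨mem_DelJPos.mpr ⟨c.refl_DelJ (c.PiJ_re ha) h1.1, c.Pi_perm ha h1.1 h1.2 h2⟩,
    c.Pi_perm_ne ha h1.2⟩

theorem Pi_inj (c : Ctx α δ θ B s X D) {a b : V} (ha : a ∈ PiJ α δ s J)
    (hb : b ∈ PiJ α δ s J) (h : s a = s b) : a = b := by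
  have h1 : -a = a - cc B a b • b := by
    rw [← c.refl (c.PiJ_ne hb), ← h, c.refl_self (c.PiJ_ne ha)]
  obtain ⟨t, ht⟩ : ∃ t : ℝ, a = t • b := by
    refine ⟨cc B a b / 2, ?_⟩
    have h2 : (2 : ℝ) • a = cc B a b • b := by
      rw [two_smul]
      have h3 : a + a = a - (-a) := by abel
      rw [h3, h1]; abel
    rw [div_eq_inv_mul, mul_smul, ← h2, smul_smul]; norm_num
  have hpa := c.PiJ_pos ha
  have hpb := c.PiJ_pos hb
  have key : t = 1 ∨ t = -1 := by
    obtain ⟨m, e, he, rfl⟩ := c.PiJ_re ha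
    obtain ⟨n, f, hf, rfl⟩ := c.PiJ_re hb
    refine c.prop (mono he) (mono hf) ?_
    rw [c.coords he, c.coords hf, Finset.smul_sum]
    refine Finset.sum_congr rfl fun i _ => ?_
    have := congrArg (X i) ht
    rw [map_smul, c.X_re, c.X_re] at this
    rw [this, smul_smul, smul_eq_mul]
  rcases key with rfl | rfl
  · simpa using ht
  · have : a = -b := by simpa using ht
    rw [this] at hpa
    exact (c.not_both (c.PiJ_DelJ hb) hpb hpa).elim

theorem cox (c : Ctx α δ θ B s X D) :
    ∃ (M : CoxeterMatrix (PiJ α δ s J)) (cs : CoxeterSystem M (WJ α δ s J)),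
        ∀ a : PiJ α δ s J, (cs.simple a : V ≃ₗ[ℝ] V) = s (a : V) := by
  let σ : PiJ α δ s J → WJ α δ s J :=
    fun a => ⟨s a, Subgroup.subset_closure ⟨a, a.2, rfl⟩⟩
  let N : WJ α δ s J → PiJ α δ s J → Prop :=
    fun w a => PosComb α δ θ (-((w : V ≃ₗ[ℝ] V) a))
  have hmem : ∀ (w : WJ α δ s J) (a : PiJ α δ s J), (w : V ≃ₗ[ℝ] V) a ∈ DelJ α δ s J :=
    fun w a => c.WJ_DelJ w.2 (c.PiJ_DelJ a.2)
  have hσ : ∀ (w : WJ α δ s J) (a : PiJ α δ s J),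
      ((w * σ a : WJ α δ s J) : V ≃ₗ[ℝ] V) a = -((w : V ≃ₗ[ℝ] V) a) := by
    intro w a
    change (w : V ≃ₗ[ℝ] V) (s a a) = _
    rw [c.refl_self (c.PiJ_ne a.2), map_neg]
  have hN : CxHyp σ N := by
    refine ⟨?_, ?_, ?_, ?_, ?_⟩
    · intro a
      exact Subtype.ext (c.refl_invol (c.PiJ_ne a.2))
    · intro a h
      exact c.not_both (c.PiJ_DelJ a.2) (c.PiJ_pos a.2) h
    · intro w a h
      change PosComb α δ θ (-_)
      rw [hσ, neg_neg]
      exact (c.DelJ_or (hmem w a)).resolve_right h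
    · intro w a h h'
      change PosComb α δ θ (-_) at h'
      rw [hσ, neg_neg] at h'
      exact c.not_both (hmem w a) h' h
    · intro w a b h h'
      have hp := (c.DelJ_or (hmem w a)).resolve_right h
      have heq : (w : V ≃ₗ[ℝ] V) a = b := by
        by_contra hne
        exact c.not_both (c.refl_DelJ (c.PiJ_re b.2) (hmem w a))
          (c.Pi_perm b.2 (hmem w a) hp hne) h'
      have h1 := c.conj (c.WJ_form w.2) (c.PiJ_ne a.2)
      rw [heq] at h1
      apply Subtype.ext
      change s b * (w : V ≃ₗ[ℝ] V) = (w : V ≃ₗ[ℝ] V) * s a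
      rw [← h1]; group
  have hinj : Function.Injective σ := fun a b h =>
    Subtype.ext (c.Pi_inj a.2 b.2 (congrArg Subtype.val h))
  have hgen : Subgroup.closure (Set.range σ) = ⊤ := by
    have h1 : Set.range σ = (Subtype.val : WJ α δ s J → _) ⁻¹' (SJ α δ s J) := by
      ext w
      constructor
      · rintro ⟨a, rfl⟩; exact ⟨a, a.2, rfl⟩
      · rintro ⟨a, ha, h⟩; exact ⟨⟨a, ha⟩, Subtype.ext h⟩
    rw [h1]
    exact Subgroup.closure_closure_coe_preimage
  obtain ⟨M, cs, h⟩ := hN.coxeter hinj hgen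
  exact ⟨M, cs, fun a => by rw [h a]⟩

theorem split (c : Ctx α δ θ B s X D) (hJ : J.Nonempty) {v : V}
    (hv : v ∈ DelJPos α δ θ s J) (hn : v ∉ PiJ α δ s J) :
    ∃ x ∈ DelJPos α δ θ s J, ∃ y ∈ DelJPos α δ θ s J, v = x + y := by
  rw [mem_DelJPos] at hv
  have hre : ∀ {m : ℤ} {e : V}, e ∈ DeloJ α s J → (1 ≤ m ∨ (m = 0 ∧ PosoComb α e)) →
      m • δ + e ∈ DelJPos α δ θ s J := fun {m e} he h =>
    mem_DelJPos.mpr ⟨Or.inl ⟨m, e, he, rfl⟩, (c.re_pos_iff he m).mpr h⟩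
  have him : ∀ {m : ℤ}, 1 ≤ m → m • δ ∈ DelJPos α δ θ s J := fun {m} h =>
    mem_DelJPos.mpr ⟨Or.inr ⟨m, by omega, rfl⟩, (c.im_pos_iff m).mpr (by omega)⟩
  have hfin : ∀ {e : V}, e ∈ DeloJ α s J → PosoComb α e → e ∈ DelJPos α δ θ s J :=
    fun {e} he h => by simpa using hre (m := 0) he (Or.inr ⟨rfl, h⟩)
  have hone : δ ∈ DelJPos α δ θ s J := by simpa using him (m := 1) le_rfl
  obtain ⟨h1, hp⟩ := hv
  rcases h1 with ⟨m, e, he, rfl⟩ | ⟨m, hm, rfl⟩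
  · rcases (c.re_pos_iff he m).mp hp with h | ⟨rfl, h⟩
    · rcases h.lt_or_eq with h2 | rfl
      · exact ⟨_, hone, _, hre (m := m - 1) he (Or.inl (by omega)), by
          rw [sub_smul, one_smul]; abel⟩
      · rcases c.pos_or he with h3 | h3
        · exact ⟨_, hone, _, hfin he h3, by rw [one_smul]⟩
        · have h4 : -e ∉ HighRoots α s J := fun h => hn (Or.inr ⟨-e, h, by simp⟩)
          have h5 : ∃ j ∈ J, -e + α j ∈ DeloJ α s J := by
            by_contra hcon
            push Not at hcon
            exact h4 ⟨c.neg_mem he, h3, hcon⟩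
          obtain ⟨j, hj, h6⟩ := h5
          exact ⟨_, hre (m := 1) (c.neg_mem h6) (Or.inl le_rfl), _,
            hfin (al_mem hj) (c.al_poso j), by abel⟩
    · rw [zero_smul, zero_add] at hn ⊢
      rcases c.decomp he h with ⟨j, hj, rfl⟩ | ⟨j, hj, h7, h8⟩
      · exact (hn (Or.inl ⟨j, hj, rfl⟩)).elim
      · exact ⟨_, hfin h7 h8, _, hfin (al_mem hj) (c.al_poso j), by abel⟩
  · have h0 := (c.im_pos_iff m).mp hp
    by_cases h1 : m = 1
    · subst h1
      obtain ⟨j, hj⟩ := hJ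
      exact ⟨_, hre (m := 1) (c.neg_mem (al_mem hj)) (Or.inl le_rfl), _,
            hfin (al_mem hj) (c.al_poso j), by abel⟩
    · exact ⟨_, hone, _, him (m := m - 1) (by omega), by rw [sub_smul, one_smul]; abel⟩

theorem height (c : Ctx α δ θ B s X D) :
    ∃ f : V →ₗ[ℝ] ℝ, ∀ v ∈ DelPos α δ θ s, ∃ n : ℕ, 0 < n ∧ f v = n := by
  have hge : ∀ {e : V}, e ∈ Delo α s → hgt X e ≤ hgt X θ := fun {e} he => by
    rw [hgt, LinearMap.sum_apply, LinearMap.sum_apply]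
    exact Finset.sum_le_sum fun i _ => c.theta_ge he i
  obtain ⟨q, hq⟩ := c.hgt_int c.theta_mem
  have hq1 : (1 : ℝ) ≤ hgt X θ := c.hgt_pos c.theta_high.1 c.theta_high.2.1
  refine ⟨(1 + hgt X θ) • D + hgt X, ?_⟩
  have fin : ∀ (r : ℝ) (k : ℤ), r = k → 0 < r → ∃ n : ℕ, 0 < n ∧ r = n := by
    rintro r k rfl hk
    have hk' : 0 < k := by exact_mod_cast hk
    refine ⟨k.toNat, by omega, ?_⟩
    have : (k.toNat : ℤ) = k := Int.toNat_of_nonneg hk'.le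
    exact_mod_cast this.symm
  have hdel : hgt X δ = 0 := by rw [hgt, LinearMap.sum_apply]; simp [c.X_delta]
  rintro v ⟨hv | hv, hp⟩
  · obtain ⟨m, e, he, rfl⟩ := hv
    obtain ⟨k, hk⟩ := c.hgt_int he
    have hval : ((1 + hgt X θ) • D + hgt X) (m • δ + e) = (1 + hgt X θ) * m + hgt X e := by
      rw [LinearMap.add_apply, LinearMap.smul_apply, c.D_re he, map_add, map_zsmul, hdel]
      simp
    rw [hval]
    apply fin _ ((1 + q) * m + k)
    · rw [hq, hk]; push_cast; ring
    · rcases (c.re_pos_iff he m).mp hp with h | ⟨rfl, h⟩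
      · have h1 := hge (c.neg_mem he)
        rw [map_neg] at h1
        have h2 : (1 : ℝ) ≤ m := by exact_mod_cast h
        nlinarith
      · have := c.hgt_pos he h
        simp; linarith
  · obtain ⟨m, hm, rfl⟩ := hv
    have h0 := (c.im_pos_iff m).mp hp
    have hval : ((1 + hgt X θ) • D + hgt X) (m • δ) = (1 + hgt X θ) * m := by
      rw [LinearMap.add_apply, LinearMap.smul_apply, map_zsmul, map_zsmul, hdel, c.D_delta]
      simp
    rw [hval]
    apply fin _ ((1 + q) * m)
    · rw [hq]; push_cast; ring
    · have h2 : (0 : ℝ) < m := by exact_mod_cast (by omega : 0 < m)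
      positivity

end Ctx

/-- Proposition 5.4: for nonempty `J ⊆ ∘I`, `(W_J, S_J)` is a Coxeter system and
`(V_J, Δ_J, Π_J)` is a root system of `(W_J, S_J)` satisfying in addition R(v) and R(vi). -/
theorem statement10 (α : ι → V) (δ θ : V) (B : V →ₗ[ℝ] V →ₗ[ℝ] ℝ) (s : V → V ≃ₗ[ℝ] V)
    (h : AffineSetup α δ θ B s) (J : Set ι) (hJ : J.Nonempty) :
    -- (W_J, S_J) is a Coxeter system, with simple reflections the `s_a`, `a ∈ Π_J`
    (∃ (M : CoxeterMatrix (PiJ α δ s J)) (cs : CoxeterSystem M (WJ α δ s J)),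
        ∀ a : PiJ α δ s J, (cs.simple a : V ≃ₗ[ℝ] V) = s (a : V)) ∧
    -- Δ_J lies in V_J, the span of Π_J
    (DelJ α δ s J ⊆ (Submodule.span ℝ (PiJ α δ s J) : Submodule ℝ V)) ∧
    -- R(i): Δ_J is W_J-invariant and symmetric
    (∀ g ∈ WJ α δ s J, ∀ v ∈ DelJ α δ s J, g v ∈ DelJ α δ s J) ∧
    (∀ v ∈ DelJ α δ s J, -v ∈ DelJ α δ s J) ∧
    -- R(ii): every element of Δ_J is a nonneg or nonpos combination of Π_J, not both
    (∀ v ∈ DelJ α δ s J,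
      Xor' (SpanPosSet (PiJ α δ s J) v) (SpanPosSet (PiJ α δ s J) (-v))) ∧
    -- R(iii)
    (∀ a ∈ PiJ α δ s J, s a a = -a ∧
      ⇑(s a) '' (DelJPos α δ θ s J \ {a}) = DelJPos α δ θ s J \ {a}) ∧
    -- R(iv)
    (∀ g ∈ WJ α δ s J, ∀ a ∈ PiJ α δ s J, ∀ b ∈ PiJ α δ s J,
      g b = a → g * s b * g⁻¹ = s a) ∧
    -- R(v): every α ∈ Δ_{J+} ∖ Π_J is a sum of two elements of Δ_{J+}
    (∀ v ∈ DelJPos α δ θ s J, v ∉ PiJ α δ s J →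
      ∃ x ∈ DelJPos α δ θ s J, ∃ y ∈ DelJPos α δ θ s J, v = x + y) ∧
    -- R(vi): the height function, positive and additive on Δ_{J+}
    (∃ ht : V → ℕ, (∀ v ∈ DelPos α δ θ s, 0 < ht v) ∧
      ∀ x y : V, x ∈ DelJPos α δ θ s J → y ∈ DelJPos α δ θ s J →
        x + y ∈ DelJPos α δ θ s J → ht (x + y) = ht x + ht y) := by
  obtain ⟨X, D, c⟩ := ctx_exists h
  refine ⟨c.cox, ?_, fun g hg v hv => c.WJ_DelJ hg hv, fun v hv => c.DelJ_neg hv,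
    fun v hv => c.span_xor hJ hv, ?_, ?_, fun v hv hn => c.split hJ hv hn, ?_⟩
  · intro v hv
    rcases c.span_xor hJ hv with ⟨h1, -⟩ | ⟨h1, -⟩
    · exact h1.mem_span
    · exact neg_mem_iff.mp h1.mem_span
  · intro a ha
    refine ⟨c.refl_self (c.PiJ_ne ha), Set.Subset.antisymm ?_ ?_⟩
    · rintro _ ⟨v, hv, rfl⟩
      exact c.Pi_maps ha hv
    · intro v hv
      exact ⟨s a v, c.Pi_maps ha hv, c.refl_two ha v⟩
  · intro g hg a ha b hb hgb
    rw [c.conj (c.WJ_form hg) (c.PiJ_ne hb), hgb]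
  · obtain ⟨f, hf⟩ := c.height
    refine ⟨fun v => ⌊f v⌋₊, ?_, ?_⟩
    · intro v hv
      obtain ⟨n, hn, h1⟩ := hf v hv
      change 0 < ⌊f v⌋₊
      rw [h1, Nat.floor_natCast]; exact hn
    · intro x y hx hy _
      obtain ⟨n, -, h1⟩ := hf x hx.2
      obtain ⟨m, -, h2⟩ := hf y hy.2
      change ⌊f (x + y)⌋₊ = ⌊f x⌋₊ + ⌊f y⌋₊
      rw [map_add, h1, h2, Nat.floor_natCast, Nat.floor_natCast, ← Nat.cast_add,
        Nat.floor_natCast]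

end
end

section
/- For each nonempty J ⊆ ∘I, the assignment y ↦ Φ_J(y) = Φ(y) ∩ Δ_{J+} is a bijection from W_J onto the set 𝔅_J of all finite biconvex sets in Δ_{J+}. Moreover, if y = s₁s₂⋯s_n (s_i ∈ S_J) is a reduced expression of y ∈ W_J∖{1} with respect to (W_J, S_J), then Φ_J(y) = {α_{s₁}, s₁(α_{s₂}), …, s₁⋯s_{n−1}(α_{s_n})}, these n elements being pairwise distinct; in particular, the cardinality of Φ_J(y) equals the length of y in (W_J, S_J). -/
open scoped Pointwise

section

variable {ι V : Type*} [Fintype ι] [Nonempty ι] [AddCommGroup V] [Module ℝ V]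

set_option linter.unusedSectionVars false

/-- Abstract data of a based root system. -/
structure Abs (A P : Set V) (s : V → V ≃ₗ[ℝ] V) (Q : V → Prop) (ht : V →ₗ[ℝ] ℝ) : Prop where
  sub : P ⊆ A
  neg : ∀ a ∈ P, s a a = -a
  inv : ∀ a ∈ P, s a * s a = 1
  perm : ∀ a ∈ P, ∀ x ∈ A, x ≠ a → s a x ∈ A
  pos : ∀ x ∈ A, 0 < ht x
  qP : ∀ a ∈ P, Q a
  qs : ∀ a ∈ P, ∀ x, Q x → Q (s a x)
  conj : ∀ a ∈ P, ∀ x, Q x → s (s a x) * s a = s a * s x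
  dec : ∀ C : Set V, C.Finite → BiconvexIn A C → C.Nonempty → ∃ a ∈ P, a ∈ C

/-- Inversion set. -/
def NN (A : Set V) (y : V ≃ₗ[ℝ] V) : Set V := {x ∈ A | -(y⁻¹ x) ∈ A}

/-- The list of roots attached to a word. -/
def rl (s : V → V ≃ₗ[ℝ] V) : List V → List V
  | [] => []
  | a :: l => a :: (rl s l).map (s a)

theorem rl_length (s : V → V ≃ₗ[ℝ] V) (l : List V) : (rl s l).length = l.length := by
  induction l with
  | nil => rfl
  | cons a l ih => simp [rl, ih]

theorem rl_get (s : V → V ≃ₗ[ℝ] V) (l : List V) (k : ℕ) (hk : k < l.length)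
    (hk' : k < (rl s l).length) :
    (rl s l)[k] = ((l.take k).map s).prod l[k] := by
  induction l generalizing k with
  | nil => simp at hk
  | cons a l ih =>
    cases k with
    | zero => simp [rl]
    | succ k =>
      simp only [rl, List.getElem_cons_succ, List.getElem_map, List.take_succ_cons, List.map_cons,
        List.prod_cons, LinearEquiv.mul_apply]
      rw [ih]

namespace Abs

variable {A P : Set V} {s : V → V ≃ₗ[ℝ] V} {Q : V → Prop} {ht : V →ₗ[ℝ] ℝ}

theorem notneg (H : Abs A P s Q ht) {x : V} (hx : x ∈ A) : -x ∉ A := by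
  intro h
  have h1 := H.pos _ hx
  have h2 := H.pos _ h
  rw [map_neg] at h2
  linarith

theorem inv_apply (H : Abs A P s Q ht) {a : V} (ha : a ∈ P) (x : V) : s a (s a x) = x := by
  have := H.inv a ha
  rw [← LinearEquiv.mul_apply, this]; rfl

theorem inv_eq (H : Abs A P s Q ht) {a : V} (ha : a ∈ P) : (s a)⁻¹ = s a :=
  inv_eq_of_mul_eq_one_left (H.inv a ha)

theorem words (H : Abs A P s Q ht) {y : V ≃ₗ[ℝ] V} (hy : y ∈ Subgroup.closure (s '' P)) :
    ∃ l : List V, (∀ a ∈ l, a ∈ P) ∧ (l.map s).prod = y := by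
  induction hy using Subgroup.closure_induction with
  | mem x hx =>
    obtain ⟨a, ha, rfl⟩ := hx
    exact ⟨[a], by simpa using ha, by simp⟩
  | one => exact ⟨[], by simp, by simp⟩
  | mul x y _ _ hx hy =>
    obtain ⟨l, hl, rfl⟩ := hx
    obtain ⟨l', hl', rfl⟩ := hy
    refine ⟨l ++ l', ?_, by simp⟩
    intro a ha
    rcases List.mem_append.1 ha with h | h
    · exact hl a h
    · exact hl' a h
  | inv x _ hx =>
    obtain ⟨l, hl, rfl⟩ := hx
    refine ⟨l.reverse, by simpa using hl, ?_⟩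
    rename_i hmem
    clear hmem
    induction l with
    | nil => simp
    | cons a l ih =>
      have ha : a ∈ P := hl a (by simp)
      have := ih (fun b hb => hl b (by simp [hb]))
      simp only [List.reverse_cons, List.map_append, List.prod_append, this, List.map_cons,
        List.map_nil, List.prod_cons, List.prod_nil, mul_one, mul_inv_rev, H.inv_eq ha]

theorem word_mem {l : List V} (hl : ∀ a ∈ l, a ∈ P) :
    (l.map s).prod ∈ Subgroup.closure (s '' P) := by
  apply Subgroup.list_prod_mem
  intro x hx
  obtain ⟨a, ha, rfl⟩ := List.mem_map.1 hx
  exact Subgroup.subset_closure ⟨a, hl a ha, rfl⟩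

/-- Elements of the group preserve `A ∪ -A`. -/
theorem pres (H : Abs A P s Q ht) {y : V ≃ₗ[ℝ] V} (hy : y ∈ Subgroup.closure (s '' P)) :
    ∀ x, (x ∈ A ∨ -x ∈ A) → (y x ∈ A ∨ -(y x) ∈ A) := by
  obtain ⟨l, hl, rfl⟩ := H.words hy
  induction l with
  | nil => intro x hx; simpa using hx
  | cons a l ih =>
    intro x hx
    have ha : a ∈ P := hl a (by simp)
    have hl' : ∀ b ∈ l, b ∈ P := fun b hb => hl b (by simp [hb])
    have h1 := ih hl' (word_mem hl') x hx
    simp only [List.map_cons, List.prod_cons, LinearEquiv.mul_apply]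
    set z := (l.map s).prod x
    have key : ∀ z ∈ A, s a z ∈ A ∨ -(s a z) ∈ A := by
      intro z hz
      by_cases h : z = a
      · right; rw [h, H.neg a ha, neg_neg]; exact H.sub ha
      · left; exact H.perm a ha z hz h
    rcases h1 with h1 | h1
    · exact key z h1
    · have := key _ h1
      simp only [map_neg, neg_neg] at this
      exact this.symm

theorem NN_sub_rl (H : Abs A P s Q ht) {l : List V} (hl : ∀ a ∈ l, a ∈ P) :
    ∀ x ∈ NN A (l.map s).prod, x ∈ rl s l := by
  induction l with
  | nil =>
    rintro x ⟨hx, hx'⟩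
    exact absurd hx' (H.notneg hx)
  | cons a l ih =>
    rintro x ⟨hx, hx'⟩
    have ha : a ∈ P := hl a (by simp)
    by_cases h : x = a
    · simp [rl, h]
    · right
      apply List.mem_map.2
      refine ⟨s a x, ih (fun b hb => hl b (by simp [hb])) _ ⟨H.perm a ha x hx h, ?_⟩, H.inv_apply ha x⟩
      simpa [LinearEquiv.mul_apply, H.inv_eq ha] using hx'

theorem rlQ (H : Abs A P s Q ht) {l : List V} (hl : ∀ a ∈ l, a ∈ P) :
    ∀ x ∈ rl s l, Q x := by
  induction l with
  | nil => simp [rl]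
  | cons a l ih =>
    have ha : a ∈ P := hl a (by simp)
    have := ih (fun b hb => hl b (by simp [hb]))
    intro x hx
    rcases List.mem_cons.1 hx with rfl | hx
    · exact H.qP _ ha
    · obtain ⟨z, hz, rfl⟩ := List.mem_map.1 hx
      exact H.qs a ha z (this z hz)

theorem exch (H : Abs A P s Q ht) {l : List V} (hl : ∀ a ∈ l, a ∈ P) :
    ∀ x ∈ rl s l, ∃ l' : List V, (∀ a ∈ l', a ∈ P) ∧ l'.length + 1 = l.length ∧
      (l'.map s).prod = s x * (l.map s).prod := by
  induction l with
  | nil => simp [rl]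
  | cons a l ih =>
    have ha : a ∈ P := hl a (by simp)
    have hl' : ∀ b ∈ l, b ∈ P := fun b hb => hl b (by simp [hb])
    intro x hx
    rcases List.mem_cons.1 hx with rfl | hx
    · refine ⟨l, hl', rfl, ?_⟩
      rw [List.map_cons, List.prod_cons, ← mul_assoc, H.inv _ ha, one_mul]
    · obtain ⟨z, hz, rfl⟩ := List.mem_map.1 hx
      obtain ⟨l', h1, h2, h3⟩ := ih hl' z hz
      refine ⟨a :: l', ?_, by simp [h2], ?_⟩
      · intro b hb
        rcases List.mem_cons.1 hb with rfl | hb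
        · exact ha
        · exact h1 b hb
      · rw [List.map_cons, List.prod_cons, List.map_cons, List.prod_cons, h3, ← mul_assoc,
          ← mul_assoc, H.conj a ha z (H.rlQ hl' z hz)]

theorem reduced_NN (H : Abs A P s Q ht) {l : List V} (hl : ∀ a ∈ l, a ∈ P)
    (hred : ∀ l' : List V, (∀ a ∈ l', a ∈ P) → (l'.map s).prod = (l.map s).prod →
      l.length ≤ l'.length) :
    (∀ x, x ∈ NN A (l.map s).prod ↔ x ∈ rl s l) ∧ (rl s l).Nodup := by
  induction l with
  | nil =>
    refine ⟨fun x => ⟨H.NN_sub_rl hl x, by simp [rl]⟩, by simp [rl]⟩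
  | cons a l ih =>
    have ha : a ∈ P := hl a (by simp)
    have hl' : ∀ b ∈ l, b ∈ P := fun b hb => hl b (by simp [hb])
    obtain ⟨ih1, ih2⟩ := ih hl' (by
      intro l' h1 h2
      have := hred (a :: l') (by
        intro b hb
        rcases List.mem_cons.1 hb with rfl | hb
        · exact ha
        · exact h1 b hb) (by simp [h2])
      simpa using this)
    have hna : a ∉ rl s l := by
      intro h
      obtain ⟨l', h1, h2, h3⟩ := H.exch hl' a h
      have := hred l' h1 (by simpa using h3)
      simp at this
      omega
    have hA : ∀ x ∈ rl s l, x ∈ A := fun x hx => ((ih1 x).2 hx).1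
    constructor
    · intro x
      refine ⟨H.NN_sub_rl hl x, ?_⟩
      intro hx
      rcases List.mem_cons.1 hx with rfl | hx
      · refine ⟨H.sub ha, ?_⟩
        have h1 : x ∉ NN A (l.map s).prod := fun h => hna ((ih1 x).1 h)
        have h2 := H.pres (inv_mem (word_mem hl')) x (Or.inl (H.sub ha))
        have h3 : -((l.map s).prod⁻¹ x) ∉ A := fun h => h1 ⟨H.sub ha, h⟩
        have h4 := h2.resolve_right h3
        simpa [LinearEquiv.mul_apply, H.inv_eq ha, H.neg _ ha] using h4
      · obtain ⟨z, hz, rfl⟩ := List.mem_map.1 hx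
        refine ⟨H.perm a ha z (hA z hz) (fun h => hna (h ▸ hz)), ?_⟩
        have := ((ih1 z).2 hz).2
        simpa [LinearEquiv.mul_apply, H.inv_eq ha, H.inv_apply ha] using this
    · simp only [rl, List.nodup_cons]
      refine ⟨?_, ih2.map (s a).injective⟩
      intro h
      obtain ⟨z, hz, hz'⟩ := List.mem_map.1 h
      have : z = -a := by
        rw [← H.inv_apply ha z, hz', H.neg a ha]
      exact H.notneg (H.sub ha) (this ▸ hA z hz)

theorem exists_reduced (H : Abs A P s Q ht) {y : V ≃ₗ[ℝ] V}
    (hy : y ∈ Subgroup.closure (s '' P)) :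
    ∃ l : List V, (∀ a ∈ l, a ∈ P) ∧ (l.map s).prod = y ∧
      ∀ l' : List V, (∀ a ∈ l', a ∈ P) → (l'.map s).prod = y → l.length ≤ l'.length := by
  classical
  have hex : ∃ n, ∃ l : List V, (∀ a ∈ l, a ∈ P) ∧ (l.map s).prod = y ∧ l.length = n := by
    obtain ⟨l, h1, h2⟩ := H.words hy
    exact ⟨_, l, h1, h2, rfl⟩
  obtain ⟨l, h1, h2, h3⟩ := Nat.find_spec hex
  refine ⟨l, h1, h2, fun l' h1' h2' => ?_⟩
  rw [h3]
  exact Nat.find_min' hex ⟨l', h1', h2', rfl⟩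

theorem NN_empty (H : Abs A P s Q ht) {y : V ≃ₗ[ℝ] V}
    (hy : y ∈ Subgroup.closure (s '' P)) (h : NN A y = ∅) : y = 1 := by
  obtain ⟨l, h1, rfl, h3⟩ := H.exists_reduced hy
  have := (H.reduced_NN h1 h3).1
  cases l with
  | nil => simp
  | cons a l =>
    have h5 := (this a).2 (by simp [rl])
    rw [h] at h5
    exact absurd h5 (by simp)

theorem NN_inj (H : Abs A P s Q ht) {y z : V ≃ₗ[ℝ] V}
    (hy : y ∈ Subgroup.closure (s '' P)) (hz : z ∈ Subgroup.closure (s '' P))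
    (h : NN A y = NN A z) : y = z := by
  have : z⁻¹ * y = 1 := by
    apply H.NN_empty (mul_mem (inv_mem hz) hy)
    rw [Set.eq_empty_iff_forall_notMem]
    rintro x ⟨hx, hx'⟩
    rw [mul_inv_rev, inv_inv, LinearEquiv.mul_apply] at hx'
    have e : z⁻¹ (z x) = x := by rw [← LinearEquiv.mul_apply, inv_mul_cancel]; rfl
    rcases H.pres hz x (Or.inl hx) with h1 | h1
    · have h2 : z x ∈ NN A z := h ▸ (⟨h1, hx'⟩ : z x ∈ NN A y)
      have h3 := h2.2
      rw [e] at h3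
      exact H.notneg hx h3
    · have h2 : -(z x) ∈ NN A z := ⟨h1, by rw [map_neg, neg_neg, e]; exact hx⟩
      rw [← h] at h2
      have h3 := h2.2
      rw [map_neg] at h3
      exact H.notneg hx' h3
  exact (inv_mul_eq_one.1 this).symm

theorem NN_finite (H : Abs A P s Q ht) {y : V ≃ₗ[ℝ] V}
    (hy : y ∈ Subgroup.closure (s '' P)) : (NN A y).Finite := by
  obtain ⟨l, h1, rfl⟩ := H.words hy
  exact (List.finite_toSet (rl s l)).subset (H.NN_sub_rl h1)

theorem NN_biconvex (H : Abs A P s Q ht) {y : V ≃ₗ[ℝ] V}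
    (hy : y ∈ Subgroup.closure (s '' P)) : BiconvexIn A (NN A y) := by
  have hp := H.pres (inv_mem hy)
  refine ⟨⟨fun x hx => hx.1, ?_⟩, ⟨fun x hx => hx.1, ?_⟩⟩
  · intro x hx z hz hxz
    refine ⟨hxz, ?_⟩
    refine (hp _ (Or.inl hxz)).resolve_left fun h => ?_
    have h1 := H.pos _ h
    have h2 := H.pos _ hx.2
    have h3 := H.pos _ hz.2
    simp only [map_neg, map_add] at h1 h2 h3
    linarith
  · intro x hx z hz hxz
    refine ⟨hxz, fun h => ?_⟩
    have hx' := (hp _ (Or.inl hx.1)).resolve_right fun h => hx.2 ⟨hx.1, h⟩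
    have hz' := (hp _ (Or.inl hz.1)).resolve_right fun h => hz.2 ⟨hz.1, h⟩
    have h1 := H.pos _ h.2
    have h2 := H.pos _ hx'
    have h3 := H.pos _ hz'
    simp only [map_neg, map_add] at h1 h2 h3
    linarith

theorem NN_surj (H : Abs A P s Q ht) (n : ℕ) : ∀ C : Set V, C.Finite → C.ncard = n →
    BiconvexIn A C → ∃ y ∈ Subgroup.closure (s '' P), NN A y = C := by
  induction n with
  | zero =>
    intro C hC hn _
    refine ⟨1, one_mem _, ?_⟩
    rw [(Set.ncard_eq_zero hC).1 hn, Set.eq_empty_iff_forall_notMem]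
    rintro x ⟨hx, hx'⟩
    exact H.notneg hx (by simpa using hx')
  | succ n ih =>
    intro C hC hn hb
    obtain ⟨a, ha, haC⟩ := H.dec C hC hb ((Set.ncard_pos hC).1 (by omega))
    have haA := H.sub ha
    have hmem : ∀ x, x ∈ s a '' (C \ {a}) ↔ s a x ∈ C ∧ s a x ≠ a := by
      intro x
      constructor
      · rintro ⟨z, hz, rfl⟩
        rw [H.inv_apply ha]
        exact ⟨hz.1, hz.2⟩
      · intro h
        exact ⟨s a x, ⟨h.1, h.2⟩, H.inv_apply ha x⟩
    have hCA := hb.1.1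
    have hsub : s a '' (C \ {a}) ⊆ A := by
      rintro _ ⟨z, hz, rfl⟩
      exact H.perm a ha z (hCA hz.1) hz.2
    have hnega : ∀ x ∈ A, s a x ≠ a := by
      intro x hx h
      have : x = -a := by rw [← H.inv_apply ha x, h, H.neg a ha]
      exact H.notneg haA (this ▸ hx)
    obtain ⟨y, hy, hyC⟩ := ih (s a '' (C \ {a})) ((hC.diff).image _) (by
      rw [Set.ncard_image_of_injective _ (s a).injective, Set.ncard_diff_singleton_of_mem haC, hn]
      rfl) (by
      refine ⟨⟨hsub, ?_⟩, ⟨fun x hx => hx.1, ?_⟩⟩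
      · intro x hx z hz hxz
        have hxA := hsub hx
        have hzA := hsub hz
        rw [hmem] at hx hz ⊢
        refine ⟨?_, hnega _ hxz⟩
        have hne : x + z ≠ a := by
          intro h
          have h1 : s a x + s a z = -a := by rw [← map_add, h, H.neg a ha]
          have h2 := H.pos _ (hCA hx.1)
          have h3 := H.pos _ (hCA hz.1)
          have h4 := H.pos _ haA
          have h5 := congrArg ht h1
          simp only [map_neg, map_add] at h5
          linarith
        have := H.perm a ha _ hxz hne
        rw [map_add] at this ⊢
        exact hb.1.2 _ hx.1 _ hz.1 this
      · intro x hx z hz hxz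
        refine ⟨hxz, fun h => ?_⟩
        have hgen : ∀ x ∈ A \ s a '' (C \ {a}), x ≠ a → s a x ∈ A \ C := by
          intro x hx hxa
          refine ⟨H.perm a ha x hx.1 hxa, fun h => hx.2 ((hmem x).2 ⟨h, hnega x hx.1⟩)⟩
        have hone : ∀ z ∈ A \ s a '' (C \ {a}), a + z ∈ s a '' (C \ {a}) → False := by
          intro z hz h
          rw [hmem, map_add, H.neg a ha] at h
          by_cases hza : z = a
          · rw [hza, H.neg a ha] at h
            have h1 := H.pos _ (hCA h.1)
            have h2 := H.pos _ haA
            simp only [map_neg, map_add] at h1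
            linarith
          · have h1 := hgen z hz hza
            have h2 := hb.1.2 _ haC _ h.1 (by simpa using h1.1)
            exact h1.2 (by simpa using h2)
        by_cases hxa : x = a
        · exact hone z hz (hxa ▸ h)
        by_cases hza : z = a
        · exact hone x hx (by rw [add_comm]; exact hza ▸ h)
        rw [hmem, map_add] at h
        exact (hb.2.2 _ (hgen x hx hxa) _ (hgen z hz hza) (hCA h.1)).2 h.1)
    refine ⟨s a * y, mul_mem (Subgroup.subset_closure ⟨a, ha, rfl⟩) hy, ?_⟩
    have hN : ∀ x, x ∈ NN A (s a * y) ↔ x ∈ A ∧ -(y⁻¹ (s a x)) ∈ A := by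
      intro x
      simp [NN, LinearEquiv.mul_apply, H.inv_eq ha]
    have hay : a ∉ NN A y := by
      rw [hyC, hmem, H.neg a ha]
      exact fun h => H.notneg haA (hCA h.1)
    ext x
    rw [hN]
    by_cases hxa : x = a
    · subst hxa
      refine ⟨fun _ => haC, fun _ => ⟨haA, ?_⟩⟩
      rw [H.neg _ ha, map_neg, neg_neg]
      exact (H.pres (inv_mem hy) _ (Or.inl haA)).resolve_right fun h => hay ⟨haA, h⟩
    · have h1 : x ∈ C ↔ s a x ∈ NN A y := by
        rw [hyC, hmem, H.inv_apply ha]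
        exact ⟨fun h => ⟨h, hxa⟩, fun h => h.1⟩
      rw [h1]
      constructor
      · rintro ⟨h2, h3⟩
        exact ⟨H.perm a ha x h2 hxa, h3⟩
      · intro h
        exact ⟨hCA (h1.2 h), h.2⟩

end Abs

/-- Root differences in a finite crystallographic system. -/
theorem sub_mem_of_pos (F : Set V) (hF : F.Finite) (c : V → V →ₗ[ℝ] ℝ)
    (h2 : ∀ e ∈ F, c e e = 2) (hr : ∀ e ∈ F, ∀ v ∈ F, v - c e v • e ∈ F)
    (hz : ∀ e ∈ F, ∀ v ∈ F, ∃ z : ℤ, c e v = z) {b g : V} (hb : b ∈ F) (hg : g ∈ F)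
    (hpos : 0 < c g b) (hne : b ≠ g) : b - g ∈ F := by
  classical
  let M := Submodule.span ℝ F
  have hfd : FiniteDimensional ℝ M := FiniteDimensional.span_of_finite ℝ hF
  have hfin : Finite F := hF
  let root : F ↪ M := ⟨fun e => ⟨e.1, Submodule.subset_span e.2⟩, fun x y hxy => by
    apply Subtype.ext; exact congrArg (fun z : M => (z : V)) hxy⟩
  have hsp : Submodule.span ℝ (Set.range root) = ⊤ := by
    have := Submodule.span_span_coe_preimage (R := ℝ) (s := F)
    convert this using 2
    ext x
    constructor
    · rintro ⟨e, rfl⟩; exact e.2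
    · intro hx; exact ⟨⟨x.1, hx⟩, rfl⟩
  let coroot : F ↪ Module.Dual ℝ M := ⟨fun e => (c e.1).comp M.subtype, by
    rintro ⟨e, he⟩ ⟨f, hf⟩ hef
    apply Subtype.ext
    simp only
    have hcc : ∀ x ∈ F, c e x = c f x := fun x hx =>
      LinearMap.congr_fun hef ⟨x, Submodule.subset_span hx⟩
    have hmem : ∀ n : ℕ, e + ((2 * n : ℕ) : ℝ) • (e - f) ∈ F := by
      intro n
      induction n with
      | zero => simpa using he
      | succ n ih =>
        have e1 := hcc e he
        have e2 := hcc f hf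
        rw [h2 e he] at e1
        rw [h2 f hf] at e2
        have h3 := hr f hf _ ih
        have h4 := hr e he _ h3
        convert h4 using 1
        simp only [map_add, map_sub, map_smul, smul_eq_mul, h2 e he, h2 f hf, ← e1, e2]
        push_cast
        module
    have hinj : ¬ Function.Injective (fun n : ℕ => (⟨_, hmem n⟩ : F)) :=
      not_injective_infinite_finite _
    simp only [Function.Injective, not_forall] at hinj
    obtain ⟨m, n, hmn, hne⟩ := hinj
    have h5 := congrArg Subtype.val hmn
    simp only [add_right_inj] at h5
    have h6 : (((2 * m : ℕ) : ℝ) - ((2 * n : ℕ) : ℝ)) • (e - f) = 0 := by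
      rw [sub_smul, h5, sub_self]
    rcases smul_eq_zero.1 h6 with h7 | h7
    · exfalso
      apply hne
      have : ((2 * m : ℕ) : ℝ) = ((2 * n : ℕ) : ℝ) := by linarith
      have := Nat.cast_injective this
      omega
    · exact sub_eq_zero.1 h7⟩
  let p : M →ₗ[ℝ] Module.Dual ℝ M →ₗ[ℝ] ℝ := Module.Dual.eval ℝ M
  have hp : ∀ i, p (root i) (coroot i) = 2 := fun i => h2 i.1 i.2
  have hs : ∀ i, Set.MapsTo (Module.preReflection (root i) (p.flip (coroot i)))
      (Set.range root) (Set.range root) := by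
    rintro i _ ⟨j, rfl⟩
    exact ⟨⟨_, hr i.1 i.2 j.1 j.2⟩, rfl⟩
  let R := RootPairing.mk'' p root coroot hp hs hsp
  have hcr : R.IsCrystallographic := ⟨fun i j => by
    obtain ⟨z, hz⟩ := hz j.1 j.2 i.1 i.2
    exact ⟨z, hz.symm⟩⟩
  have hpair : R.pairing ⟨b, hb⟩ ⟨g, hg⟩ = c g b := rfl
  have h8 : 0 < R.pairingIn ℤ ⟨b, hb⟩ ⟨g, hg⟩ := by
    rw [← R.algebraMap_pairingIn ℤ] at hpair
    rw [← hpair] at hpos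
    simpa using hpos
  obtain ⟨k, hk⟩ := R.root_sub_root_mem_of_pairingIn_pos h8 (fun h => hne (congrArg Subtype.val h))
  have := congrArg (fun z : M => (z : V)) hk
  have h9 : (k : V) = b - g := this
  rw [← h9]
  exact k.2

/-- Dual coordinates with respect to the affine simple roots. -/
structure Coords (α : ι → V) (δ θ : V) (co : ι → V →ₗ[ℝ] ℝ) (z : V →ₗ[ℝ] ℝ) : Prop where
  co_self : ∀ i, co i (α i) = 1
  co_ne : ∀ i j, i ≠ j → co i (α j) = 0
  z_al : ∀ i, z (α i) = 0
  z_zero : z (δ - θ) = 1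
  co_zero : ∀ i, co i (δ - θ) = 0

theorem exists_coords {α : ι → V} {δ θ : V} (hi : LinearIndependent ℝ (alHat α δ θ)) :
    ∃ co z, Coords α δ θ co z := by
  classical
  obtain ⟨g, hg⟩ := LinearMap.exists_extend (hi.repr : _ →ₗ[ℝ] (Option ι →₀ ℝ))
  have key : ∀ o, g (alHat α δ θ o) = Finsupp.single o 1 := by
    intro o
    have h1 : alHat α δ θ o ∈ Submodule.span ℝ (Set.range (alHat α δ θ)) :=
      Submodule.subset_span ⟨o, rfl⟩
    have h2 := LinearMap.congr_fun hg ⟨_, h1⟩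
    simp only [LinearMap.comp_apply, Submodule.subtype_apply] at h2
    rw [h2]
    exact hi.repr_eq_single o ⟨_, h1⟩ rfl
  have k1 : ∀ i, g (α i) = Finsupp.single (some i) 1 := fun i => key (some i)
  have k2 : g (δ - θ) = Finsupp.single none 1 := key none
  refine ⟨fun i => (Finsupp.lapply (some i)).comp g, (Finsupp.lapply none).comp g, ?_, ?_, ?_, ?_, ?_⟩
  · intro i; simp [k1]
  · intro i j hij
    simp [k1, Finsupp.single_apply, Ne.symm hij]
  · intro i; simp [k1]
  · simp only [LinearMap.comp_apply, k2]; simp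
  · intro i; simp only [LinearMap.comp_apply, k2]; simp

namespace AffineSetup

variable {α : ι → V} {δ θ : V} {B : V →ₗ[ℝ] V →ₗ[ℝ] ℝ} {s : V → V ≃ₗ[ℝ] V}

theorem s_self (h : AffineSetup α δ θ B s) {a : V} (ha : B a a ≠ 0) : s a a = -a := by
  rw [h.refl_def a ha, mul_div_assoc, div_self ha]
  module

theorem isom (h : AffineSetup α δ θ B s) {a : V} (ha : B a a ≠ 0) (u v : V) :
    B (s a u) (s a v) = B u v := by
  rw [h.refl_def a ha, h.refl_def a ha]
  simp only [map_sub, map_smul, LinearMap.sub_apply, LinearMap.smul_apply, smul_eq_mul]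
  rw [h.Bsymm a v]
  field_simp
  ring

theorem s_s (h : AffineSetup α δ θ B s) {a : V} (ha : B a a ≠ 0) (v : V) :
    s a (s a v) = v := by
  rw [h.refl_def a ha v, map_sub, map_smul, h.s_self ha, h.refl_def a ha v]
  module

theorem conjg (h : AffineSetup α δ θ B s) {g : V ≃ₗ[ℝ] V} (hg : ∀ u v, B (g u) (g v) = B u v)
    {x : V} (hx : B x x ≠ 0) : s (g x) * g = g * s x := by
  ext v
  rw [LinearEquiv.mul_apply, LinearEquiv.mul_apply, h.refl_def (g x) (by rwa [hg]),
    h.refl_def x hx, map_sub, map_smul, hg, hg]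

theorem mono {J K : Set ι} (hJK : J ⊆ K) {v : V} (hv : v ∈ DeloJ α s J) : v ∈ DeloJ α s K := by
  obtain ⟨g, hg, j, hj, rfl⟩ := hv
  exact ⟨g, Subgroup.closure_mono (Set.image_mono hJK) hg, j, hJK hj, rfl⟩

theorem toDelo {J : Set ι} {v : V} (hv : v ∈ DeloJ α s J) : v ∈ Delo α s :=
  mono (Set.subset_univ J) hv

theorem al_mem {J : Set ι} {j : ι} (hj : j ∈ J) : α j ∈ DeloJ α s J :=
  ⟨1, one_mem _, j, hj, rfl⟩

theorem Bp (h : AffineSetup α δ θ B s) {J : Set ι} {v : V} (hv : v ∈ DeloJ α s J) : 0 < B v v :=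
  h.Bpos v (toDelo hv)

theorem Bal (h : AffineSetup α δ θ B s) (i : ι) : 0 < B (α i) (α i) :=
  h.Bp (al_mem (Set.mem_univ i))

theorem WoJ_isom (h : AffineSetup α δ θ B s) {J : Set ι} {g : V ≃ₗ[ℝ] V} (hg : g ∈ WoJ α s J) :
    ∀ u v, B (g u) (g v) = B u v := by
  induction hg using Subgroup.closure_induction with
  | mem x hx =>
    obtain ⟨j, hj, rfl⟩ := hx
    exact h.isom (h.Bal j).ne'
  | one => intro u v; rfl
  | mul x y _ _ hx hy => intro u v; rw [LinearEquiv.mul_apply, LinearEquiv.mul_apply, hx, hy]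
  | inv x _ hx =>
    intro u v
    have e : ∀ w, x (x⁻¹ w) = w := fun w => by
      rw [← LinearEquiv.mul_apply, mul_inv_cancel]; rfl
    rw [← hx, e, e]

theorem s_mem_WoJ (h : AffineSetup α δ θ B s) {J : Set ι} {e : V} (he : e ∈ DeloJ α s J) :
    s e ∈ WoJ α s J := by
  obtain ⟨g, hg, j, hj, rfl⟩ := he
  have h1 := h.conjg (h.WoJ_isom hg) (h.Bal j).ne'
  have h2 : s (g (α j)) = g * s (α j) * g⁻¹ := by rw [← h1]; group
  rw [h2]
  exact mul_mem (mul_mem hg (Subgroup.subset_closure ⟨j, hj, rfl⟩)) (inv_mem hg)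

theorem s_mem (h : AffineSetup α δ θ B s) {J : Set ι} {e v : V} (he : e ∈ DeloJ α s J)
    (hv : v ∈ DeloJ α s J) : s e v ∈ DeloJ α s J := by
  have h1 := h.s_mem_WoJ he
  obtain ⟨g, hg, j, hj, rfl⟩ := hv
  exact ⟨s e * g, mul_mem h1 hg, j, hj, rfl⟩

theorem neg_mem (h : AffineSetup α δ θ B s) {J : Set ι} {e : V} (he : e ∈ DeloJ α s J) :
    -e ∈ DeloJ α s J := by
  rw [← h.s_self (h.Bp he).ne']
  exact h.s_mem he he

theorem ne_zero (h : AffineSetup α δ θ B s) {J : Set ι} {e : V} (he : e ∈ DeloJ α s J) :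
    e ≠ 0 := by
  intro h0
  have := h.Bp he
  rw [h0] at this
  simp at this

theorem integ (h : AffineSetup α δ θ B s) {J : Set ι} {e v : V} (he : e ∈ DeloJ α s J)
    (hv : v ∈ DeloJ α s J) : ∃ m : ℤ, 2 * B v e / B e e = m := by
  obtain ⟨g, hg, j, hj, rfl⟩ := he
  obtain ⟨g', hg', j', hj', rfl⟩ := hv
  have h1 : g⁻¹ (g' (α j')) ∈ DeloJ α s J := ⟨g⁻¹ * g', mul_mem (inv_mem hg) hg', j', hj', rfl⟩
  obtain ⟨m, hm⟩ := h.cryst j _ (toDelo h1)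
  refine ⟨m, ?_⟩
  have e : g (g⁻¹ (g' (α j'))) = g' (α j') := by
    rw [← LinearEquiv.mul_apply, mul_inv_cancel]; rfl
  rw [← e, h.WoJ_isom hg, h.WoJ_isom hg]
  rw [h.refl_def _ (h.Bal j).ne', sub_right_inj, ← Int.cast_smul_eq_zsmul ℝ] at hm
  exact smul_left_injective ℝ (h.ne_zero (al_mem hj)) hm

theorem sub_mem (h : AffineSetup α δ θ B s) {J : Set ι} {b g : V} (hb : b ∈ DeloJ α s J)
    (hg : g ∈ DeloJ α s J) (hpos : 0 < B b g) (hne : b ≠ g) : b - g ∈ DeloJ α s J := by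
  have hc : ∀ e v, ((2 / B e e) • B e) v = 2 * B v e / B e e := by
    intro e v
    rw [LinearMap.smul_apply, smul_eq_mul, h.Bsymm e v]; ring
  refine sub_mem_of_pos (DeloJ α s J) (h.finite.subset fun v hv => toDelo hv)
    (fun e => (2 / B e e) • B e) ?_ ?_ ?_ hb hg ?_ hne
  · intro e he
    have := (h.Bp he).ne'
    rw [hc]; field_simp
  · intro e he v hv
    rw [hc, ← h.refl_def e (h.Bp he).ne']
    exact h.s_mem he hv
  · intro e he v hv
    simp only [hc]
    exact h.integ he hv
  · simp only [hc]
    have := h.Bp hg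
    positivity

theorem add_mem (h : AffineSetup α δ θ B s) {J : Set ι} {b g : V} (hb : b ∈ DeloJ α s J)
    (hg : g ∈ DeloJ α s J) (hpos : B b g < 0) (hne : b ≠ -g) : b + g ∈ DeloJ α s J := by
  have := h.sub_mem hb (h.neg_mem hg) (by rw [map_neg]; linarith) hne
  simpa using this

variable {co : ι → V →ₗ[ℝ] ℝ} {z : V →ₗ[ℝ] ℝ}

theorem span_J (h : AffineSetup α δ θ B s) {J : Set ι} {v : V} (hv : v ∈ DeloJ α s J) :
    v ∈ Submodule.span ℝ (α '' J) := by
  obtain ⟨g, hg, j, hj, rfl⟩ := hv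
  have key : ∀ v ∈ Submodule.span ℝ (α '' J), g v ∈ Submodule.span ℝ (α '' J) ∧
      g⁻¹ v ∈ Submodule.span ℝ (α '' J) := by
    induction hg using Subgroup.closure_induction with
    | mem x hx =>
      obtain ⟨j, hj, rfl⟩ := hx
      have h1 : ∀ v ∈ Submodule.span ℝ (α '' J), s (α j) v ∈ Submodule.span ℝ (α '' J) := by
        intro v hv
        rw [h.refl_def _ (h.Bal j).ne']
        exact Submodule.sub_mem _ hv (Submodule.smul_mem _ _ (Submodule.subset_span ⟨j, hj, rfl⟩))
      have h2 : (s (α j))⁻¹ = s (α j) := by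
        apply inv_eq_of_mul_eq_one_left
        ext v
        exact h.s_s (h.Bal j).ne' v
      intro v hv
      simp only [h2]
      exact ⟨h1 v hv, h1 v hv⟩
    | one => intro v hv; simpa using hv
    | mul x y _ _ hx hy =>
      intro v hv
      refine ⟨(hx _ (hy v hv).1).1, ?_⟩
      rw [mul_inv_rev]
      exact (hy _ (hx v hv).2).2
    | inv x _ hx =>
      intro v hv
      rw [inv_inv]
      exact (hx v hv).symm
  exact (key _ (Submodule.subset_span ⟨j, hj, rfl⟩)).1

theorem span_all (h : AffineSetup α δ θ B s) {J : Set ι} {v : V} (hv : v ∈ DeloJ α s J) :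
    v ∈ Submodule.span ℝ (Set.range α) := by
  have := h.span_J hv
  exact Submodule.span_mono (Set.image_subset_range _ _) this

theorem expand (h : AffineSetup α δ θ B s) (C : Coords α δ θ co z) {J : Set ι} {v : V}
    (hv : v ∈ DeloJ α s J) : v = ∑ i, co i v • α i := by
  have hs := h.span_all hv
  clear hv
  induction hs using Submodule.span_induction with
  | mem x hx =>
    obtain ⟨j, rfl⟩ := hx
    rw [Finset.sum_eq_single j, C.co_self, one_smul]
    · intro i _ hij
      rw [C.co_ne i j hij, zero_smul]
    · simp
  | zero => simp
  | add x y _ _ hx hy =>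
    simp only [map_add, add_smul, Finset.sum_add_distrib]
    rw [← hx, ← hy]
  | smul a x _ hx =>
    simp only [map_smul, smul_eq_mul, mul_smul]
    rw [← Finset.smul_sum, ← hx]

theorem co_outside (h : AffineSetup α δ θ B s) (C : Coords α δ θ co z) {J : Set ι} {v : V}
    (hv : v ∈ DeloJ α s J) {i : ι} (hi : i ∉ J) : co i v = 0 := by
  have hs := h.span_J hv
  have : Submodule.span ℝ (α '' J) ≤ LinearMap.ker (co i) := by
    rw [Submodule.span_le]
    rintro _ ⟨j, hj, rfl⟩
    exact C.co_ne i j (fun h => hi (h ▸ hj))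
  exact this hs

theorem z_root (h : AffineSetup α δ θ B s) (C : Coords α δ θ co z) {J : Set ι} {v : V}
    (hv : v ∈ DeloJ α s J) : z v = 0 := by
  rw [h.expand C hv]
  simp [C.z_al]

theorem delta_root (h : AffineSetup α δ θ B s) {J : Set ι} {v : V}
    (hv : v ∈ DeloJ α s J) : B δ v = 0 := by
  have : Submodule.span ℝ (Set.range α) ≤ LinearMap.ker (B δ) := by
    rw [Submodule.span_le]
    rintro _ ⟨j, rfl⟩
    exact h.delta_orth j
  exact this (h.span_all hv)

theorem co_comb (C : Coords α δ θ co z) (c : ι → ℝ) (i : ι) : co i (∑ k, c k • α k) = c i := by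
  rw [map_sum, Finset.sum_eq_single i]
  · simp [C.co_self]
  · intro k _ hk
    simp [C.co_ne i k hk.symm]
  · simp

theorem pos_iff (h : AffineSetup α δ θ B s) (C : Coords α δ θ co z) {J : Set ι} {v : V}
    (hv : v ∈ DeloJ α s J) : PosoComb α v ↔ ∀ i, 0 ≤ co i v := by
  constructor
  · rintro ⟨c, hc, rfl⟩ i
    rw [co_comb C]; exact hc i
  · intro hp
    exact ⟨fun i => co i v, hp, h.expand C hv⟩

theorem pos_or (h : AffineSetup α δ θ B s) (C : Coords α δ θ co z) {J : Set ι} {v : V}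
    (hv : v ∈ DeloJ α s J) : (∀ i, 0 ≤ co i v) ∨ (∀ i, 0 ≤ co i (-v)) := by
  rcases h.base v (toDelo hv) with h1 | h1
  · exact Or.inl ((h.pos_iff C hv).1 h1.1)
  · exact Or.inr ((h.pos_iff C (h.neg_mem hv)).1 h1.1)

theorem not_both (h : AffineSetup α δ θ B s) (C : Coords α δ θ co z) {J : Set ι} {v : V}
    (hv : v ∈ DeloJ α s J) (h1 : ∀ i, 0 ≤ co i v) (h2 : ∀ i, 0 ≤ co i (-v)) : False := by
  apply h.ne_zero hv
  rw [h.expand C hv]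
  apply Finset.sum_eq_zero
  intro i _
  have := h1 i
  have h3 := h2 i
  rw [map_neg] at h3
  rw [show co i v = 0 by linarith, zero_smul]

theorem al_pos (C : Coords α δ θ co z) (j i : ι) : 0 ≤ co i (α j) := by
  by_cases hij : i = j
  · subst hij; rw [C.co_self]; norm_num
  · rw [C.co_ne i j hij]

theorem eq_simple (h : AffineSetup α δ θ B s) (C : Coords α δ θ co z) {J : Set ι} {e : V} {j : ι}
    (he : e ∈ DeloJ α s J) (hp : ∀ i, 0 ≤ co i e) (h0 : ∀ i, i ≠ j → co i e = 0) : e = α j := by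
  have hee : e = co j e • α j := by
    conv_lhs => rw [h.expand C he]
    rw [Finset.sum_eq_single j]
    · intro i _ hi; rw [h0 i hi, zero_smul]
    · simp
  set c := co j e with hc
  have hc0 : c ≠ 0 := by
    intro h1; rw [h1, zero_smul] at hee; exact h.ne_zero he hee
  have hcp : 0 < c := lt_of_le_of_ne (hp j) hc0.symm
  have ha : α j ∈ Delo α s := al_mem (Set.mem_univ j)
  have hB := h.Bal j
  obtain ⟨m, hm⟩ := h.integ ha (toDelo he)
  obtain ⟨n, hn⟩ := h.integ (toDelo he) ha
  rw [hee] at hm hn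
  simp only [map_smul, LinearMap.smul_apply, smul_eq_mul] at hm hn
  have hm' : 2 * c = m := by rw [← hm]; field_simp
  have hn' : 2 / c = n := by rw [← hn]; field_simp
  have hmn : m * n = 4 := by
    have : (m : ℝ) * n = 4 := by rw [← hm', ← hn']; field_simp; norm_num
    exact_mod_cast this
  have hmp : 0 < m := by
    have : (0 : ℝ) < m := by rw [← hm']; positivity
    exact_mod_cast this
  have hm4 : m ≤ 4 := Int.le_of_dvd (by norm_num) ⟨n, hmn.symm⟩
  have hred := h.reduced _ ha
  have hred' := h.reduced _ (toDelo he)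
  have hcases : m = 1 ∨ m = 2 ∨ m = 4 := by
    interval_cases m <;> omega
  rcases hcases with rfl | rfl | rfl
  · exfalso
    apply hred'
    have : α j = (2 : ℝ) • e := by
      rw [hee, smul_smul, hm']; simp
    rw [← this]; exact ha
  · have : c = 1 := by push_cast at hm'; linarith
    rw [hee, this, one_smul]
  · exfalso
    apply hred
    have : c = 2 := by push_cast at hm'; linarith
    rw [this] at hee
    rw [← hee]; exact toDelo he

theorem simple_refl (h : AffineSetup α δ θ B s) (C : Coords α δ θ co z) {e : V} {j : ι}
    (he : e ∈ Delo α s) (hp : ∀ i, 0 ≤ co i e) (hne : e ≠ α j) : ∀ i, 0 ≤ co i (s (α j) e) := by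
  have ha : α j ∈ Delo α s := al_mem (Set.mem_univ j)
  refine (h.pos_or C (h.s_mem ha he)).resolve_right fun hn => hne ?_
  apply h.eq_simple C he hp
  intro i hi
  have h1 := hn i
  rw [h.refl_def _ (h.Bal j).ne', map_neg, map_sub, map_smul, C.co_ne i j hi] at h1
  simp at h1
  have := hp i
  linarith

theorem sub_simple_pos (h : AffineSetup α δ θ B s) (C : Coords α δ θ co z) {J : Set ι} {e : V}
    {j : ι} (he : e ∈ DeloJ α s J) (hp : ∀ i, 0 ≤ co i e) (hne : e ≠ α j)
    (hs : e - α j ∈ DeloJ α s J) : ∀ i, 0 ≤ co i (e - α j) := by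
  refine (h.pos_or C hs).resolve_right fun hn => hne ?_
  apply h.eq_simple C he hp
  intro i hi
  have h1 := hn i
  rw [map_neg, map_sub, C.co_ne i j hi] at h1
  simp at h1
  have := hp i
  linarith

theorem B_expand (h : AffineSetup α δ θ B s) (C : Coords α δ θ co z) {J : Set ι} {v : V} (u : V)
    (hv : v ∈ DeloJ α s J) : B u v = ∑ i, co i v * B u (α i) := by
  conv_lhs => rw [h.expand C hv]
  simp

theorem exists_simple (h : AffineSetup α δ θ B s) (C : Coords α δ θ co z) {J : Set ι} {e : V}
    (he : e ∈ DeloJ α s J) (hp : ∀ i, 0 ≤ co i e) : ∃ j ∈ J, 0 < B e (α j) := by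
  by_contra hcon
  push Not at hcon
  have h1 := h.Bp he
  rw [h.B_expand C e he] at h1
  apply absurd h1
  rw [not_lt]
  apply Finset.sum_nonpos
  intro i _
  by_cases hi : i ∈ J
  · exact mul_nonpos_of_nonneg_of_nonpos (hp i) (hcon i hi)
  · rw [h.co_outside C he hi, zero_mul]

theorem high_dom_simple (h : AffineSetup α δ θ B s) (C : Coords α δ θ co z) {J : Set ι} {η : V}
    (hη : η ∈ HighRoots α s J) {j : ι} (hj : j ∈ J) : 0 ≤ B η (α j) := by
  obtain ⟨h1, h2, h3⟩ := hη
  by_contra hcon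
  push Not at hcon
  refine h3 j hj (h.add_mem h1 (al_mem hj) hcon ?_)
  intro he
  have := (h.pos_iff C h1).1 h2 j
  rw [he, map_neg, C.co_self] at this
  linarith

theorem high_dom (h : AffineSetup α δ θ B s) (C : Coords α δ θ co z) {J : Set ι} {η v : V}
    (hη : η ∈ HighRoots α s J) (hv : v ∈ DeloJ α s J) (hp : ∀ i, 0 ≤ co i v) : 0 ≤ B η v := by
  rw [h.B_expand C η hv]
  apply Finset.sum_nonneg
  intro i _
  by_cases hi : i ∈ J
  · exact mul_nonneg (hp i) (h.high_dom_simple C hη hi)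
  · rw [h.co_outside C hv hi, zero_mul]

theorem high_add (h : AffineSetup α δ θ B s) (C : Coords α δ θ co z) {J : Set ι} {η g : V}
    (hη : η ∈ HighRoots α s J) (hg : g ∈ DeloJ α s J) (hp : ∀ i, 0 ≤ co i g) :
    η + g ∉ DeloJ α s J := by
  intro hcon
  let bad : Set V := {g | g ∈ DeloJ α s J ∧ (∀ i, 0 ≤ co i g) ∧ η + g ∈ DeloJ α s J}
  have hbf : bad.Finite := h.finite.subset fun v hv => toDelo hv.1
  obtain ⟨m, ⟨hm1, hm2, hm3⟩, hmin⟩ :=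
    Set.exists_min_image bad (fun v => ∑ i, co i v) hbf ⟨g, hg, hp, hcon⟩
  obtain ⟨j, hj, hBj⟩ := h.exists_simple C hm1 hm2
  have hmj : m ≠ α j := by
    rintro rfl
    exact hη.2.2 j hj hm3
  have haj : α j ∈ DeloJ α s J := al_mem hj
  have hm4 := h.sub_mem hm1 haj hBj hmj
  have hm5 := h.sub_simple_pos C hm1 hm2 hmj hm4
  have hηp := (h.pos_iff C hη.1).1 hη.2.1
  have hne : η + m ≠ α j := by
    intro he
    apply hmj
    apply h.eq_simple C hm1 hm2
    intro i hi
    have h1 := congrArg (co i) he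
    rw [map_add, C.co_ne i j hi] at h1
    have := hηp i
    have := hm2 i
    linarith
  have hm6 := h.sub_mem hm3 haj (by
    rw [map_add, LinearMap.add_apply]
    have := h.high_dom_simple C hη hj
    linarith) hne
  have := hmin (m - α j) ⟨hm4, hm5, by rwa [add_sub_assoc] at hm6⟩
  simp only [map_sub, Finset.sum_sub_distrib] at this
  have h7 : ∑ i, co i (α j) = 1 := by
    rw [Finset.sum_eq_single j]
    · exact C.co_self j
    · intro i _ hi; exact C.co_ne i j hi
    · simp
  linarith

theorem high_lt_two (h : AffineSetup α δ θ B s) (C : Coords α δ θ co z) {J : Set ι} {η e : V}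
    (hη : η ∈ HighRoots α s J) (he : e ∈ DeloJ α s J) (hp : ∀ i, 0 ≤ co i e) (hne : e ≠ η) :
    2 * B e η / B η η < 2 := by
  by_contra hcon
  push Not at hcon
  have hηη := h.Bp hη.1
  set k := 2 * B e η / B η η with hk
  have hk' : k * B η η = 2 * B e η := by rw [hk]; field_simp
  have hBe : 0 < B e η := by nlinarith
  have h1 := h.sub_mem he hη.1 hBe hne
  have h2 := (h.pos_or C h1).resolve_left fun hpos => by
    refine h.high_add C hη h1 hpos ?_
    rwa [add_sub_cancel]
  have hηp := (h.pos_iff C hη.1).1 hη.2.1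
  have h3 := h.neg_mem (h.s_mem hη.1 he)
  rw [h.refl_def η hηη.ne', ← hk, neg_sub] at h3
  have h4 : k • η - e ≠ η := by
    intro h4
    have h5 : e = (k - 1) • η := by
      calc e = k • η - (k • η - e) := by abel
        _ = k • η - η := by rw [h4]
        _ = (k - 1) • η := by module
    have h6 : B e η = (k - 1) * B η η := by rw [h5]; simp
    have h7 : (k - 2) * B η η = 0 := by
      rw [h6] at hk'; linarith
    have h8 : k = 2 := by
      rcases mul_eq_zero.1 h7 with h8 | h8
      · linarith
      · exact absurd h8 hηη.ne'
    apply hne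
    rw [h5, h8]; norm_num
  have h5 := h.sub_mem h3 hη.1 (by
    rw [map_sub, map_smul, LinearMap.sub_apply, LinearMap.smul_apply, smul_eq_mul]; linarith) h4
  refine h.high_add C hη h5 ?_ (by rwa [add_sub_cancel])
  intro i
  have e1 : k • η - e - η = (k - 2) • η + -(e - η) := by module
  rw [e1, map_add, map_smul, smul_eq_mul]
  have := mul_nonneg (by linarith : (0 : ℝ) ≤ k - 2) (hηp i)
  have := h2 i
  linarith

theorem climb (h : AffineSetup α δ θ B s) (C : Coords α δ θ co z) {J : Set ι} {e : V}
    (he : e ∈ DeloJ α s J) (hp : ∀ i, 0 ≤ co i e) :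
    ∃ η ∈ HighRoots α s J, ∀ i, 0 ≤ co i (η - e) := by
  let S : Set V := {x | x ∈ DeloJ α s J ∧ ∀ i, 0 ≤ co i (x - e)}
  have hbf : S.Finite := h.finite.subset fun v hv => toDelo hv.1
  obtain ⟨m, ⟨hm1, hm2⟩, hmax⟩ :=
    Set.exists_max_image S (fun v => ∑ i, co i v) hbf ⟨e, he, by simp⟩
  refine ⟨m, ⟨hm1, (h.pos_iff C hm1).2 ?_, ?_⟩, hm2⟩
  · intro i
    have h1 := hm2 i
    have h2 := hp i
    rw [map_sub] at h1
    linarith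
  · intro j hj hcon
    have := hmax (m + α j) ⟨hcon, fun i => by
      have h1 := hm2 i
      have h2 := al_pos C j i
      rw [map_sub] at h1 ⊢
      rw [map_add]
      linarith⟩
    simp only [map_add, Finset.sum_add_distrib] at this
    have h7 : ∑ i, co i (α j) = 1 := by
      rw [Finset.sum_eq_single j]
      · exact C.co_self j
      · intro i _ hi; exact C.co_ne i j hi
      · simp
    linarith

theorem simple_nonpos (h : AffineSetup α δ θ B s) (C : Coords α δ θ co z) {i j : ι}
    (hij : i ≠ j) : B (α i) (α j) ≤ 0 := by
  by_contra hcon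
  push Not at hcon
  have hi : α i ∈ Delo α s := al_mem (Set.mem_univ i)
  have hj : α j ∈ Delo α s := al_mem (Set.mem_univ j)
  have hne : α i ≠ α j := by
    intro he
    have := congrArg (co i) he
    rw [C.co_self, C.co_ne i j hij] at this
    norm_num at this
  have h1 := h.sub_mem hi hj hcon hne
  rcases h.pos_or C h1 with h2 | h2
  · have := h2 j
    rw [map_sub, C.co_self, C.co_ne j i hij.symm] at this
    linarith
  · have := h2 i
    rw [map_neg, map_sub, C.co_self, C.co_ne i j hij] at this
    linarith

theorem high_full (h : AffineSetup α δ θ B s) (C : Coords α δ θ co z) {η : V}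
    (hη : η ∈ HighRoots α s Set.univ) : ∀ i, 0 < co i η := by
  have hηp := (h.pos_iff C hη.1).1 hη.2.1
  have hA := h.irred {i | 0 < co i η} (by
    intro i hi j hj
    have hj0 : co j η = 0 := le_antisymm (not_lt.1 hj) (hηp j)
    have h1 := h.high_dom_simple C hη (Set.mem_univ j)
    rw [h.Bsymm, h.B_expand C (α j) hη.1] at h1
    have hle : ∀ k ∈ Finset.univ, co k η * B (α j) (α k) ≤ 0 := by
      intro k _
      by_cases hk : k = j
      · rw [hk, hj0, zero_mul]
      · exact mul_nonpos_of_nonneg_of_nonpos (hηp k) (h.simple_nonpos C (Ne.symm hk))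
    have h2 := (Finset.sum_eq_zero_iff_of_nonpos hle).1 (le_antisymm (Finset.sum_nonpos hle) h1)
      i (Finset.mem_univ i)
    have h3 : B (α j) (α i) = 0 := (mul_eq_zero.1 h2).resolve_left (ne_of_gt hi)
    rw [h.refl_def _ (h.Bal i).ne', h3]
    simp)
  rcases hA with hA | hA
  · exfalso
    apply h.not_both C hη.1 hηp
    intro i
    have : i ∉ {i | 0 < co i η} := by rw [hA]; simp
    rw [map_neg]
    have : ¬ 0 < co i η := this
    linarith
  · intro i
    have : i ∈ {i | 0 < co i η} := by rw [hA]; simp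
    exact this

theorem theta_dom (h : AffineSetup α δ θ B s) (C : Coords α δ θ co z) {e : V}
    (he : e ∈ Delo α s) : ∀ i, 0 ≤ co i (θ + e) := by
  have hθ := h.theta_high
  have hθp := (h.pos_iff C hθ.1).1 hθ.2.1
  rcases h.pos_or C he with hp | hn
  · intro i
    rw [map_add]
    exact add_nonneg (hθp i) (hp i)
  · obtain ⟨η, hη, hd⟩ := h.climb C (h.neg_mem he) hn
    have hηp := (h.pos_iff C hη.1).1 hη.2.1
    have : θ = η := by
      by_contra hne
      have hB : 0 < B θ η := by
        rw [h.Bsymm, h.B_expand C η hθ.1]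
        obtain ⟨j, hj, hBj⟩ := h.exists_simple C hη.1 hηp
        apply Finset.sum_pos'
        · intro i _
          exact mul_nonneg (hθp i) (h.high_dom_simple C hη (Set.mem_univ i))
        · exact ⟨j, Finset.mem_univ j, mul_pos (h.high_full C hθ j) hBj⟩
      have h1 := h.sub_mem hθ.1 hη.1 hB hne
      rcases h.pos_or C h1 with h2 | h2
      · refine h.high_add C hη h1 h2 ?_
        rw [add_sub_cancel]; exact hθ.1
      · refine h.high_add C hθ (h.neg_mem h1) h2 ?_
        rw [neg_sub, add_sub_cancel]; exact hη.1
    intro i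
    have := hd i
    rw [sub_neg_eq_add] at this
    rwa [‹θ = η›]

theorem z_delta (h : AffineSetup α δ θ B s) (C : Coords α δ θ co z) : z δ = 1 := by
  have h1 := C.z_zero
  rw [map_sub, h.z_root C h.theta_high.1] at h1
  linarith

theorem co_delta (C : Coords α δ θ co z) (i : ι) : co i δ = co i θ := by
  have h1 := C.co_zero i
  rw [map_sub] at h1
  linarith

theorem posComb_coords (h : AffineSetup α δ θ B s) (C : Coords α δ θ co z) {v : V}
    (hv : PosComb α δ θ v) : 0 ≤ z v ∧ ∀ i, 0 ≤ co i v := by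
  obtain ⟨c, hc, rfl⟩ := hv
  rw [Fintype.sum_option]
  simp only [alHat, Option.elim]
  constructor
  · rw [map_add, map_smul, C.z_zero, map_sum]
    simp [C.z_al, hc none]
  · intro i
    rw [map_add, map_smul, C.co_zero, co_comb C]
    simpa using hc (some i)

theorem posComb_of (h : AffineSetup α δ θ B s) (C : Coords α δ θ co z) {m : ℝ} {v : V}
    (hm : 0 ≤ m) (hv : v ∈ Submodule.span ℝ (Set.range α)) (hco : ∀ i, 0 ≤ co i (m • θ + v)) :
    PosComb α δ θ (m • δ + v) := by
  have hex : ∀ w ∈ Submodule.span ℝ (Set.range α), w = ∑ i, co i w • α i := by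
    intro w hs
    induction hs using Submodule.span_induction with
    | mem x hx =>
      obtain ⟨j, rfl⟩ := hx
      rw [Finset.sum_eq_single j, C.co_self, one_smul]
      · intro i _ hij
        rw [C.co_ne i j hij, zero_smul]
      · simp
    | zero => simp
    | add x y _ _ hx hy =>
      simp only [map_add, add_smul, Finset.sum_add_distrib]
      rw [← hx, ← hy]
    | smul a x _ hx =>
      simp only [map_smul, smul_eq_mul, mul_smul]
      rw [← Finset.smul_sum, ← hx]
  refine ⟨fun o => o.elim m fun i => co i (m • θ + v), ?_, ?_⟩
  · intro o
    cases o with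
    | none => exact hm
    | some i => exact hco i
  · rw [Fintype.sum_option]
    simp only [alHat, Option.elim]
    rw [← hex _ (Submodule.add_mem _ (Submodule.smul_mem _ _ (h.span_all h.theta_high.1)) hv)]
    module

/-- Membership of real roots in `Δ_{J+}`. -/
theorem real_mem (h : AffineSetup α δ θ B s) (C : Coords α δ θ co z) {J : Set ι} {e : V} {m : ℤ}
    (he : e ∈ DeloJ α s J) (hm : 1 ≤ m ∨ (m = 0 ∧ ∀ i, 0 ≤ co i e)) :
    (m : ℝ) • δ + e ∈ DelJPos α δ θ s J := by
  have e1 : (m : ℝ) • δ + e = m • δ + e := by rw [Int.cast_smul_eq_zsmul]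
  refine ⟨Or.inl ⟨m, e, he, e1⟩, Or.inl ⟨m, e, toDelo he, e1⟩, ?_⟩
  apply h.posComb_of C
  · rcases hm with hm | hm
    · exact_mod_cast (by omega : 0 ≤ m)
    · simp [hm.1]
  · exact h.span_all he
  · intro i
    rcases hm with hm | hm
    · have h1 := h.theta_dom C (toDelo he) i
      have h2 := (h.pos_iff C h.theta_high.1).1 h.theta_high.2.1 i
      rw [map_add] at h1
      rw [map_add, map_smul, smul_eq_mul]
      have h3 : (1 : ℝ) ≤ m := by exact_mod_cast hm
      nlinarith
    · rw [hm.1]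
      simpa using hm.2 i

theorem im_mem (h : AffineSetup α δ θ B s) (C : Coords α δ θ co z) {J : Set ι} {m : ℤ}
    (hm : 1 ≤ m) : (m : ℝ) • δ ∈ DelJPos α δ θ s J := by
  have e1 : (m : ℝ) • δ = m • δ := by rw [Int.cast_smul_eq_zsmul]
  have hm0 : m ≠ 0 := by omega
  refine ⟨Or.inr ⟨m, hm0, e1⟩, Or.inr ⟨m, hm0, e1⟩, ?_⟩
  have h3 : (1 : ℝ) ≤ m := by exact_mod_cast hm
  have := h.posComb_of C (m := m) (v := 0) (by linarith) (Submodule.zero_mem _) (by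
    intro i
    have h2 := (h.pos_iff C h.theta_high.1).1 h.theta_high.2.1 i
    rw [add_zero, map_smul, smul_eq_mul]
    nlinarith)
  simpa using this

theorem mem_cases (h : AffineSetup α δ θ B s) (C : Coords α δ θ co z) {J : Set ι} {x : V}
    (hx : x ∈ DelJPos α δ θ s J) :
    (∃ m : ℤ, ∃ e ∈ DeloJ α s J, x = (m : ℝ) • δ + e ∧ (1 ≤ m ∨ (m = 0 ∧ ∀ i, 0 ≤ co i e))) ∨
    (∃ m : ℤ, 1 ≤ m ∧ x = (m : ℝ) • δ) := by
  obtain ⟨hx1, -, hx2⟩ := hx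
  obtain ⟨hz, hc⟩ := h.posComb_coords C hx2
  rcases hx1 with ⟨m, e, he, rfl⟩ | ⟨m, hm0, rfl⟩
  · left
    rw [← Int.cast_smul_eq_zsmul ℝ] at hz hc ⊢
    refine ⟨m, e, he, rfl, ?_⟩
    rw [map_add, map_smul, h.z_root C he, h.z_delta C] at hz
    have hm : 0 ≤ m := by
      have : (0 : ℝ) ≤ m := by simpa using hz
      exact_mod_cast this
    rcases hm.eq_or_lt with hm | hm
    · right
      refine ⟨hm.symm, ?_⟩
      subst hm
      simpa using hc
    · left; omega
  · right
    rw [← Int.cast_smul_eq_zsmul ℝ] at hz hc ⊢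
    refine ⟨m, ?_, rfl⟩
    rw [map_smul, h.z_delta C] at hz
    have hm : 0 ≤ m := by
      have : (0 : ℝ) ≤ m := by simpa using hz
      exact_mod_cast this
    omega

theorem ht_pos (h : AffineSetup α δ θ B s) (C : Coords α δ θ co z) {x : V}
    (hx : x ∈ DelPos α δ θ s) : 0 < (z + ∑ i, co i) x := by
  obtain ⟨hz, hc⟩ := h.posComb_coords C hx.2
  have hs : 0 ≤ ∑ i, co i x := Finset.sum_nonneg fun i _ => hc i
  rw [LinearMap.add_apply, LinearMap.sum_apply]
  rcases hx with ⟨⟨m, e, he, rfl⟩ | ⟨m, hm0, rfl⟩, -⟩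
  · by_cases hm : m = 0
    · subst hm
      rw [zero_smul, zero_add] at *
      by_contra hcon
      have h0 : ∑ i, co i e = 0 := by linarith
      rw [Finset.sum_eq_zero_iff_of_nonneg (fun i _ => hc i)] at h0
      exact h.not_both C he hc fun i => by rw [map_neg, h0 i (Finset.mem_univ i)]; simp
    · have : z (m • δ + e) ≠ 0 := by
        rw [← Int.cast_smul_eq_zsmul ℝ, map_add, map_smul, h.z_root C he, h.z_delta C]
        simpa using hm
      have := lt_of_le_of_ne hz this.symm
      linarith
  · have : z (m • δ) ≠ 0 := by
      rw [← Int.cast_smul_eq_zsmul ℝ, map_smul, h.z_delta C]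
      simpa using hm0
    have := lt_of_le_of_ne hz this.symm
    linarith

theorem PiJ_ne (h : AffineSetup α δ θ B s) {J : Set ι} {a : V} (ha : a ∈ PiJ α δ s J) :
    B a a ≠ 0 := by
  rcases ha with ⟨j, hj, rfl⟩ | ⟨η, hη, rfl⟩
  · exact (h.Bal j).ne'
  · have h1 := h.delta_root hη.1
    have h2 := h.Bsymm η δ
    have h3 := h.Bp hη.1
    simp only [map_sub, LinearMap.sub_apply, h.delta_null, h1, h2]
    simpa using h3.ne'

theorem perm_simple (h : AffineSetup α δ θ B s) (C : Coords α δ θ co z) {J : Set ι} {x : V}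
    {j : ι} (hj : j ∈ J) (hx : x ∈ DelJPos α δ θ s J) (hne : x ≠ α j) :
    s (α j) x ∈ DelJPos α δ θ s J := by
  have hsδ : s (α j) δ = δ := by
    rw [h.refl_def _ (h.Bal j).ne', h.delta_orth]; simp
  rcases h.mem_cases C hx with ⟨m, e, he, rfl, hm⟩ | ⟨m, hm, rfl⟩
  · rw [map_add, map_smul, hsδ]
    apply h.real_mem C (h.s_mem (al_mem hj) he)
    rcases hm with hm | ⟨hm, hp⟩
    · exact Or.inl hm
    · right
      subst hm
      exact ⟨rfl, h.simple_refl C (toDelo he) hp (by simpa using hne)⟩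
  · rw [map_smul, hsδ]
    exact h.im_mem C hm

theorem perm_high (h : AffineSetup α δ θ B s) (C : Coords α δ θ co z) {J : Set ι} {x η : V}
    (hη : η ∈ HighRoots α s J) (hx : x ∈ DelJPos α δ θ s J) (hne : x ≠ δ - η) :
    s (δ - η) x ∈ DelJPos α δ θ s J := by
  have ha : B (δ - η) (δ - η) ≠ 0 := h.PiJ_ne (Or.inr ⟨η, hη, rfl⟩)
  have hδη := h.delta_root hη.1
  have hηδ : B η δ = 0 := by rw [h.Bsymm]; exact hδη
  have hηη := h.Bp hη.1
  have haa : B (δ - η) (δ - η) = B η η := by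
    simp only [map_sub, LinearMap.sub_apply, h.delta_null, hδη, hηδ]; ring
  have hsδ : s (δ - η) δ = δ := by
    rw [h.refl_def _ ha, map_sub, h.delta_null, hδη]; simp
  rcases h.mem_cases C hx with ⟨m, e, he, rfl, hm⟩ | ⟨m, hm, rfl⟩
  · obtain ⟨k, hk⟩ := h.integ hη.1 he
    have hse : s (δ - η) e = (k : ℝ) • δ + s η e := by
      have heδ : B e δ = 0 := by rw [h.Bsymm]; exact h.delta_root he
      rw [h.refl_def _ ha, h.refl_def _ hηη.ne', haa, map_sub, heδ, ← hk]
      have : 2 * (0 - B e η) / B η η = -(2 * B e η / B η η) := by ring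
      rw [this]
      module
    have e1 : s (δ - η) ((m : ℝ) • δ + e) = ((m + k : ℤ) : ℝ) • δ + s η e := by
      rw [map_add, map_smul, hsδ, hse]; push_cast; module
    rw [e1]
    apply h.real_mem C (h.s_mem hη.1 he)
    have hsη : s η e = e - (k : ℝ) • η := by rw [h.refl_def _ hηη.ne', hk]
    have hηp := (h.pos_iff C hη.1).1 hη.2.1
    rcases h.pos_or C he with hp | hn
    · have hB := h.high_dom C hη he hp
      rw [h.Bsymm] at hB
      have hk0 : 0 ≤ k := by
        have : (0 : ℝ) ≤ k := by rw [← hk]; positivity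
        exact_mod_cast this
      by_cases hmk : 1 ≤ m + k
      · exact Or.inl hmk
      · right
        have hk00 : k = 0 := by omega
        refine ⟨by omega, ?_⟩
        rw [hsη, hk00]
        simpa using hp
    · have hm1 : 1 ≤ m := by
        rcases hm with hm | ⟨_, hp⟩
        · exact hm
        · exact (h.not_both C he hp hn).elim
      by_cases hen : -e = η
      · have hee : e = -η := by rw [← hen, neg_neg]
        have hk2 : k = -2 := by
          have : (k : ℝ) = -2 := by
            rw [← hk, hee, map_neg, LinearMap.neg_apply]; field_simp
          exact_mod_cast this
        have hm2 : m ≠ 1 := by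
          rintro rfl
          apply hne
          rw [hee]; push_cast; module
        by_cases hm3 : m = 2
        · right
          refine ⟨by omega, ?_⟩
          rw [hsη, hk2, hee]
          have : -η - ((-2 : ℤ) : ℝ) • η = η := by push_cast; module
          rw [this]; exact hηp
        · left; omega
      · have hne' := h.neg_mem he
        have hlt := h.high_lt_two C hη hne' hn hen
        have hB := h.high_dom C hη hne' hn
        rw [h.Bsymm] at hB
        have hkk : 2 * B (-e) η / B η η = -(k : ℝ) := by
          rw [← hk, map_neg, LinearMap.neg_apply]; ring
        rw [hkk] at hlt
        have hk1 : -1 ≤ k := by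
          have : (-k : ℤ) < 2 := by exact_mod_cast hlt
          omega
        by_cases hmk : 1 ≤ m + k
        · exact Or.inl hmk
        · right
          have hk00 : k = -1 := by
            by_contra hcon
            have hk0 : (0 : ℝ) ≤ -(k : ℝ) := by rw [← hkk]; positivity
            have hk0' : 0 ≤ -k := by exact_mod_cast hk0
            omega
          refine ⟨by omega, ?_⟩
          have hmem := h.s_mem hη.1 he
          refine (h.pos_or C hmem).resolve_right fun hneg => ?_
          refine h.high_add C hη (h.neg_mem hmem) hneg ?_
          have : η + -(s η e) = -e := by
            rw [hsη, hk00]; push_cast; module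
          rw [this]; exact hne'
  · rw [map_smul, hsδ]
    exact h.im_mem C hm

theorem PiJ_sub (h : AffineSetup α δ θ B s) (C : Coords α δ θ co z) {J : Set ι} :
    PiJ α δ s J ⊆ DelJPos α δ θ s J := by
  rintro a (⟨j, hj, rfl⟩ | ⟨η, hη, rfl⟩)
  · have := h.real_mem C (m := 0) (al_mem hj : α j ∈ DeloJ α s J) (Or.inr ⟨rfl, al_pos C j⟩)
    simpa using this
  · have := h.real_mem C (m := 1) (h.neg_mem hη.1) (Or.inl le_rfl)
    simpa [sub_eq_add_neg] using this

theorem no_im {J : Set ι} (h : AffineSetup α δ θ B s) (C : Coords α δ θ co z) {D : Set V}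
    (hD : D.Finite) (hb : BiconvexIn (DelJPos α δ θ s J) D) {m : ℤ} (hm : 1 ≤ m) :
    (m : ℝ) • δ ∉ D := by
  intro hmem
  have hall : ∀ n : ℕ, (((n + 1 : ℕ) * m : ℤ) : ℝ) • δ ∈ D := by
    intro n
    induction n with
    | zero => simpa using hmem
    | succ n ih =>
      have e1 : (((n + 1 + 1 : ℕ) * m : ℤ) : ℝ) • δ
          = (((n + 1 : ℕ) * m : ℤ) : ℝ) • δ + (m : ℝ) • δ := by
        push_cast; module
      rw [e1]
      apply hb.1.2 _ ih _ hmem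
      rw [← e1]
      apply h.im_mem C
      push_cast
      nlinarith [Int.natCast_nonneg n]
  have hfin : Finite D := hD
  have hinj : Function.Injective (fun n : ℕ => (⟨_, hall n⟩ : D)) := by
    intro p q hpq
    have h1 := congrArg (fun w : D => z w.1) hpq
    simp only [map_smul, h.z_delta C] at h1
    have h2 : ((p + 1 : ℕ) * m : ℤ) = ((q + 1 : ℕ) * m : ℤ) := by
      have : (((p + 1 : ℕ) * m : ℤ) : ℝ) = (((q + 1 : ℕ) * m : ℤ) : ℝ) := by simpa using h1
      exact_mod_cast this
    have h3 := mul_right_cancel₀ (by omega : m ≠ 0) h2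
    have h4 : p + 1 = q + 1 := by exact_mod_cast h3
    omega
  exact not_injective_infinite_finite _ hinj

theorem dec_aux (h : AffineSetup α δ θ B s) (C : Coords α δ θ co z) {J : Set ι} (D : Set V)
    (hD : D.Finite) (hb : BiconvexIn (DelJPos α δ θ s J) D) (hn : D.Nonempty) :
    ∃ a ∈ PiJ α δ s J, a ∈ D := by
  obtain ⟨x, hx, hmin⟩ := Set.exists_min_image D (z + ∑ i, co i) hD hn
  refine ⟨x, ?_, hx⟩
  have key : ∀ u ∈ DelJPos α δ θ s J, ∀ v ∈ DelJPos α δ θ s J, x = u + v → False := by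
    intro u hu v hv huv
    have hor : u ∈ D ∨ v ∈ D := by
      by_contra hcon
      push Not at hcon
      have := hb.2.2 u ⟨hu, hcon.1⟩ v ⟨hv, hcon.2⟩ (huv ▸ hb.1.1 hx)
      exact this.2 (huv ▸ hx)
    have hu' := h.ht_pos C hu.2
    have hv' := h.ht_pos C hv.2
    have hs : (z + ∑ i, co i) x = (z + ∑ i, co i) u + (z + ∑ i, co i) v := by rw [huv, map_add]
    rcases hor with h1 | h1
    · have := hmin u h1; linarith
    · have := hmin v h1; linarith
  rcases h.mem_cases C (hb.1.1 hx) with ⟨m, e, he, rfl, hm⟩ | ⟨m, hm, rfl⟩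
  · rcases h.pos_or C he with hp | hneg
    · by_cases hm1 : 1 ≤ m
      · exfalso
        have h2 := h.real_mem C (m := 0) he (Or.inr ⟨rfl, hp⟩)
        exact key _ (h.im_mem C hm1) _ h2 (by simp)
      · have hm0 : m = 0 := by omega
        subst hm0
        by_contra hcon
        obtain ⟨j, hj, hBj⟩ := h.exists_simple C he hp
        have hne : e ≠ α j := by
          rintro rfl
          apply hcon
          left
          exact ⟨j, hj, by simp⟩
        have h1 := h.sub_mem he (al_mem hj) hBj hne
        have h2 := h.sub_simple_pos C he hp hne h1
        refine key _ (h.real_mem C (m := 0) h1 (Or.inr ⟨rfl, h2⟩)) _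
          (h.real_mem C (m := 0) (al_mem hj) (Or.inr ⟨rfl, al_pos C j⟩)) ?_
        simp
    · have hm1 : 1 ≤ m := by
        rcases hm with hm | ⟨_, hp⟩
        · exact hm
        · exact (h.not_both C he hp hneg).elim
      by_cases hm2 : m = 1
      · subst hm2
        by_contra hcon
        have hne := h.neg_mem he
        have hnh : -e ∉ HighRoots α s J := by
          intro hh
          apply hcon
          right
          exact ⟨-e, hh, by simp⟩
        have hex : ∃ j ∈ J, -e + α j ∈ DeloJ α s J := by
          by_contra hcon2
          push Not at hcon2
          exact hnh ⟨hne, (h.pos_iff C hne).2 hneg, hcon2⟩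
        obtain ⟨j, hj, hje⟩ := hex
        refine key _ (h.real_mem C (m := 1) (h.neg_mem hje) (Or.inl le_rfl)) _
          (h.real_mem C (m := 0) (al_mem hj) (Or.inr ⟨rfl, al_pos C j⟩)) ?_
        push_cast
        module
      · exfalso
        refine key _ (h.im_mem C (m := m - 1) (by omega)) _
          (h.real_mem C (m := 1) he (Or.inl le_rfl)) ?_
        push_cast
        module
  · exact (h.no_im C hD hb hm hx).elim

theorem toAbs (h : AffineSetup α δ θ B s) (C : Coords α δ θ co z) (J : Set ι) :
    Abs (DelJPos α δ θ s J) (PiJ α δ s J) s (fun x => B x x ≠ 0) (z + ∑ i, co i) where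
  sub := h.PiJ_sub C
  neg a ha := h.s_self (h.PiJ_ne ha)
  inv a ha := by
    ext v
    exact h.s_s (h.PiJ_ne ha) v
  perm a ha x hx hne := by
    rcases ha with ⟨j, hj, rfl⟩ | ⟨η, hη, rfl⟩
    · exact h.perm_simple C hj hx hne
    · exact h.perm_high C hη hx hne
  pos x hx := h.ht_pos C hx.2
  qP a ha := h.PiJ_ne ha
  qs a ha x hx := by rwa [h.isom (h.PiJ_ne ha)]
  conj a ha x hx := h.conjg (h.isom (h.PiJ_ne ha)) hx
  dec D hD hb hn := h.dec_aux C D hD hb hn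

theorem phi_eq (h : AffineSetup α δ θ B s) (C : Coords α δ θ co z) {J : Set ι} {y : V ≃ₗ[ℝ] V}
    (hy : y ∈ WJ α δ s J) : PhiJ α δ θ s J y = NN (DelJPos α δ θ s J) y := by
  ext x
  constructor
  · rintro ⟨hx, hx'⟩
    refine ⟨hx, ?_⟩
    refine ((h.toAbs C J).pres (inv_mem hy) x (Or.inl hx)).resolve_left fun h1 => ?_
    have h2 := h.ht_pos C h1.2
    have h3 := h.ht_pos C hx'
    rw [map_neg] at h3
    linarith
  · rintro ⟨hx, hx'⟩
    exact ⟨hx, hx'.2⟩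

end AffineSetup

/-- Corollary 5.5: for nonempty `J ⊆ ∘I`, the map `y ↦ Φ_J(y) = Φ(y) ∩ Δ_{J+}` is a
bijection from `W_J` onto the set `𝔅_J` of all finite biconvex sets in `Δ_{J+}`; moreover,
if `y = s₁⋯s_n` is a reduced expression of `y ∈ W_J ∖ {1}` with respect to `(W_J, S_J)`,
then `Φ_J(y) = {α_{s₁}, s₁(α_{s₂}), …, s₁⋯s_{n−1}(α_{s_n})}`, these elements being pairwise
distinct; in particular `♯Φ_J(y) = ℓ_J(y)`. -/
theorem statement11 (α : ι → V) (δ θ : V) (B : V →ₗ[ℝ] V →ₗ[ℝ] ℝ) (s : V → V ≃ₗ[ℝ] V)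
    (h : AffineSetup α δ θ B s) (J : Set ι) (hJ : J.Nonempty) :
    Set.BijOn (fun g => PhiJ α δ θ s J g) (WJ α δ s J : Set (V ≃ₗ[ℝ] V))
      {Bs : Set V | Bs.Finite ∧ BiconvexIn (DelJPos α δ θ s J) Bs} ∧
    ∀ y : V ≃ₗ[ℝ] V, y ∈ WJ α δ s J → y ≠ 1 →
      ∀ l : List V, (∀ a ∈ l, a ∈ PiJ α δ s J) → (l.map s).prod = y →
        l.length = lenG (SJ α δ s J) y →
        (PhiJ α δ θ s J y =
            {v | ∃ k : Fin l.length, v = ((l.take k).map s).prod (l.get k)} ∧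
          (∀ k k' : Fin l.length,
            ((l.take k).map s).prod (l.get k) = ((l.take k').map s).prod (l.get k') →
              k = k') ∧
          (PhiJ α δ θ s J y).ncard = lenG (SJ α δ s J) y) := by
  obtain ⟨co, z, C⟩ := exists_coords h.indep
  have H := h.toAbs C J
  refine ⟨⟨?_, ?_, ?_⟩, ?_⟩
  · intro y hy
    simp only [h.phi_eq C hy]
    exact ⟨H.NN_finite hy, H.NN_biconvex hy⟩
  · intro y hy y' hy' hyy
    simp only [h.phi_eq C hy, h.phi_eq C hy'] at hyy
    exact H.NN_inj hy hy' hyy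
  · rintro D ⟨hD, hb⟩
    obtain ⟨y, hy, hyD⟩ := H.NN_surj _ D hD rfl hb
    refine ⟨y, hy, ?_⟩
    simp only [h.phi_eq C hy]
    exact hyD
  · intro y hy _ l hl hly hlen
    rw [h.phi_eq C hy]
    subst hly
    obtain ⟨h1, h2⟩ := H.reduced_NN hl (by
      intro l' hl' hl2
      rw [hlen]
      refine Nat.sInf_le ⟨l'.map s, ?_, by simp, hl2⟩
      intro x hx
      obtain ⟨a, ha, rfl⟩ := List.mem_map.1 hx
      exact ⟨a, hl' a ha, rfl⟩)
    have hlr := rl_length s l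
    have hset : NN (DelJPos α δ θ s J) (l.map s).prod
        = {v | ∃ k : Fin l.length, v = ((l.take k).map s).prod (l.get k)} := by
      ext x
      rw [h1, List.mem_iff_getElem]
      constructor
      · rintro ⟨k, hk, rfl⟩
        exact ⟨⟨k, hlr ▸ hk⟩, rl_get s l k (hlr ▸ hk) hk⟩
      · rintro ⟨k, hk⟩
        refine ⟨k, by rw [hlr]; exact k.2, ?_⟩
        rw [hk]
        exact rl_get s l k k.2 _
    refine ⟨hset, ?_, ?_⟩
    · intro k k' hkk
      have hk : (k : ℕ) < (rl s l).length := by rw [hlr]; exact k.2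
      have hk' : (k' : ℕ) < (rl s l).length := by rw [hlr]; exact k'.2
      have h3 : (rl s l)[(k : ℕ)] = (rl s l)[(k' : ℕ)] := by
        rw [rl_get s l k k.2 hk, rl_get s l k' k'.2 hk']
        exact hkk
      exact Fin.ext ((List.Nodup.getElem_inj_iff h2).1 h3)
    · classical
      have h3 : NN (DelJPos α δ θ s J) (l.map s).prod = ((rl s l).toFinset : Set V) := by
        ext x
        rw [h1]; simp
      rw [h3, Set.ncard_coe_finset, List.toFinset_card_of_nodup h2, hlr, hlen]

end
end
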